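/- arXiv:1910.02465 — 3 statements merged into one kernel-verified Lean document; each statement's English description precedes it below -/
import Mathlib

section
/- Let F be a field of characteristic p. (i) If p > 0, there is a constant C_p > 0 depending only on p such that for every n ≥ 1, every symmetric Boolean function h : {0,1}^n → {0,1} that is k-bounded with k ≥ 1, and every ε ∈ (0,1/3), pdeg^F_ε(h) ≤ C_p·(√(k·log(1/ε)) + log(1/ε)). (ii) If p = 0, there is an absolute constant C > 0 such that for every n ≥ 2 and h, k, ε as above, pdeg^F_ε(h) ≤ C·log n·(√(k·log(1/ε)) + log(1/ε)). -/
noncomputable section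

open scoped BigOperators

/-- Embed a Boolean value into a field: `true ↦ 1`, `false ↦ 0`. -/
def bF (F : Type) [Field F] (b : Bool) : F := if b then 1 else 0

/-- A finitely supported probability distribution on polynomials in
`F[x_1,…,x_n]` (a probabilistic polynomial). -/
structure ProbPoly (F : Type) [Field F] (n : ℕ) where
  k : ℕ
  w : Fin k → ℝ
  w_nonneg : ∀ i, 0 ≤ w i
  w_sum : ∑ i, w i = 1
  poly : Fin k → MvPolynomial (Fin n) F

open Classical in
/-- The probability that the probabilistic polynomial `P` errs on input `a`
with respect to the Boolean function `f`. -/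
def errAt {F : Type} [Field F] {n : ℕ} (P : ProbPoly F n)
    (f : (Fin n → Bool) → Bool) (a : Fin n → Bool) : ℝ :=
  ∑ i, if MvPolynomial.eval (fun v => bF F (a v)) (P.poly i) = bF F (f a) then 0 else P.w i

/-- The ε-error probabilistic degree of a Boolean function over `F`: the least `d`
such that some probabilistic polynomial of degree at most `d` computes `f` with
error at most `ε` at each point. -/
def pdeg (F : Type) [Field F] {n : ℕ} (f : (Fin n → Bool) → Bool) (ε : ℝ) : ℕ :=
  sInf {d | ∃ P : ProbPoly F n, (∀ i, (P.poly i).totalDegree ≤ d) ∧ ∀ a, errAt P f a ≤ ε}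

/-- Hamming weight of a Boolean input. -/
def wt {n : ℕ} (a : Fin n → Bool) : ℕ := (Finset.univ.filter fun i => a i = true).card

/-- The period of a spectrum: the least `b ≥ 1` with `spec i = spec (i+b)`
whenever `i + b ≤ n`. -/
def period (n : ℕ) (spec : ℕ → Bool) : ℕ :=
  sInf {b | 1 ≤ b ∧ ∀ i, i + b ≤ n → spec i = spec (i + b)}

/-- `B(f)`: the least `k` such that the spectrum is constant on `[k, n-k]`. -/
def Bparam (n : ℕ) (spec : ℕ → Bool) : ℕ :=
  sInf {k | ∀ i j, k ≤ i → i + k ≤ n → k ≤ j → j + k ≤ n → spec i = spec j}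

section helpers

open Finset

/-- `f` is computed by a polynomial of degree at most `d` on Boolean inputs. -/
def HD (F : Type) [Field F] (n : ℕ) (d : ℝ) (f : Finset (Fin n) → F) : Prop :=
  ∃ P : MvPolynomial (Fin n) F, (P.totalDegree : ℝ) ≤ d ∧
    ∀ x : Finset (Fin n), MvPolynomial.eval (fun v => if v ∈ x then (1 : F) else 0) P = f x

variable {F : Type} [Field F] {n : ℕ}

theorem HD.mono {d e : ℝ} {f : Finset (Fin n) → F} (h : HD F n d f) (hde : d ≤ e) :
    HD F n e f := by
  obtain ⟨P, h1, h2⟩ := h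
  exact ⟨P, h1.trans hde, h2⟩

theorem HD.congr {d : ℝ} {f g : Finset (Fin n) → F} (h : HD F n d f) (hfg : ∀ x, f x = g x) :
    HD F n d g := by
  obtain ⟨P, h1, h2⟩ := h
  exact ⟨P, h1, fun x => (h2 x).trans (hfg x)⟩

theorem HD_const (c : F) : HD F n 0 (fun _ => c) :=
  ⟨MvPolynomial.C c, by simp, by simp⟩

theorem HD_var (v : Fin n) : HD F n 1 (fun x => if v ∈ x then (1 : F) else 0) :=
  ⟨MvPolynomial.X v, by simp, by simp⟩

theorem HD.add {d : ℝ} {f g : Finset (Fin n) → F} (hf : HD F n d f) (hg : HD F n d g) :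
    HD F n d (fun x => f x + g x) := by
  obtain ⟨P, h1, h2⟩ := hf
  obtain ⟨Q, h3, h4⟩ := hg
  refine ⟨P + Q, ?_, fun x => by simp [h2, h4]⟩
  have := MvPolynomial.totalDegree_add P Q
  have h5 : ((P + Q).totalDegree : ℝ) ≤ max (P.totalDegree : ℝ) (Q.totalDegree : ℝ) := by
    exact_mod_cast this
  exact h5.trans (max_le h1 h3)

theorem HD.mul {d e : ℝ} {f g : Finset (Fin n) → F} (hf : HD F n d f) (hg : HD F n e g) :
    HD F n (d + e) (fun x => f x * g x) := by
  obtain ⟨P, h1, h2⟩ := hf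
  obtain ⟨Q, h3, h4⟩ := hg
  refine ⟨P * Q, ?_, fun x => by simp [h2, h4]⟩
  have := MvPolynomial.totalDegree_mul P Q
  have h5 : ((P * Q).totalDegree : ℝ) ≤ (P.totalDegree : ℝ) + (Q.totalDegree : ℝ) := by
    exact_mod_cast this
  linarith

theorem HD.smul {d : ℝ} {f : Finset (Fin n) → F} (c : F) (hf : HD F n d f) :
    HD F n d (fun x => c * f x) := by
  have := (HD_const (n := n) c).mul hf
  simpa using this

theorem HD.sub {d : ℝ} {f g : Finset (Fin n) → F} (hf : HD F n d f) (hg : HD F n d g) :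
    HD F n d (fun x => f x - g x) :=
  (hf.add (hg.smul (-1))).congr (fun x => by ring)

theorem HD_sum {ι : Type} (s : Finset ι) {d : ℝ} (hd : 0 ≤ d) (f : ι → Finset (Fin n) → F)
    (h : ∀ i ∈ s, HD F n d (f i)) : HD F n d (fun x => ∑ i ∈ s, f i x) := by
  classical
  induction s using Finset.induction_on with
  | empty => simpa using (HD_const (n := n) (0 : F)).mono hd
  | insert a s ha ih =>
    have h1 := (h a (by simp)).add (ih (fun i hi => h i (by simp [hi])))
    exact h1.congr (fun x => by rw [Finset.sum_insert ha])

theorem HD_prod {ι : Type} (s : Finset ι) (d : ι → ℝ) (f : ι → Finset (Fin n) → F)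
    (h : ∀ i ∈ s, HD F n (d i) (f i)) : HD F n (∑ i ∈ s, d i) (fun x => ∏ i ∈ s, f i x) := by
  classical
  induction s using Finset.induction_on with
  | empty => simpa using (HD_const (n := n) (1 : F))
  | insert a s ha ih =>
    have h1 := (h a (by simp)).mul (ih (fun i hi => h i (by simp [hi])))
    rw [Finset.sum_insert ha]
    exact h1.congr (fun x => by rw [Finset.prod_insert ha])

theorem HD.pow {d : ℝ} {f : Finset (Fin n) → F} (hf : HD F n d f) (m : ℕ) :
    HD F n (m * d) (fun x => f x ^ m) := by
  have := HD_prod (Finset.range m) (fun _ => d) (fun _ => f) (fun _ _ => hf)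
  simpa using this

theorem HD.subst {d : ℝ} {f : Finset (Fin n) → F} (hf : HD F n d f)
    (g : Finset (Fin n) → Finset (Fin n))
    (hg : ∀ v, HD F n 1 (fun x => if v ∈ g x then (1 : F) else 0)) :
    HD F n d (fun x => f (g x)) := by
  obtain ⟨P, h1, h2⟩ := hf
  have hd : 0 ≤ d := le_trans (by positivity) h1
  have h3 : HD F n d (fun x => ∑ m ∈ P.support, P.coeff m *
      ∏ v ∈ m.support, (if v ∈ g x then (1 : F) else 0) ^ m v) := by
    apply HD_sum _ hd
    intro m hm
    apply HD.smul
    have := HD_prod m.support (fun v => ((m v : ℕ) : ℝ) * 1) _ (fun v _ => (hg v).pow (m v))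
    refine this.mono (le_trans ?_ h1)
    have h4 := MvPolynomial.le_totalDegree hm
    have h5 : ∑ v ∈ m.support, m v ≤ P.totalDegree := h4
    simpa using (by exact_mod_cast h5 : (((∑ v ∈ m.support, m v : ℕ)) : ℝ) ≤ P.totalDegree)
  refine h3.congr (fun x => ?_)
  rw [← h2, MvPolynomial.eval_eq]

theorem HD.inter {d : ℝ} {f : Finset (Fin n) → F} (hf : HD F n d f) (S : Finset (Fin n)) :
    HD F n d (fun x => f (x ∩ S)) := by
  apply hf.subst
  intro v
  by_cases hv : v ∈ S
  · exact (HD_var v).congr (fun x => by simp [hv])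
  · exact ((HD_const (0 : F)).mono zero_le_one).congr (fun x => by simp [hv])

theorem HD.compl {d : ℝ} {f : Finset (Fin n) → F} (hf : HD F n d f) :
    HD F n d (fun x => f xᶜ) := by
  apply hf.subst
  intro v
  refine (((HD_const (1 : F)).mono zero_le_one).sub (HD_var v)).congr (fun x => ?_)
  by_cases hv : v ∈ x <;> simp [hv]

theorem HD_choose (j : ℕ) : HD F n j (fun x => ((x.card.choose j : ℕ) : F)) := by
  have h : HD F n j (fun x => ∑ T ∈ (Finset.univ : Finset (Fin n)).powersetCard j,
      ∏ v ∈ T, (if v ∈ x then (1 : F) else 0)) := by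
    apply HD_sum _ (by positivity)
    intro T hT
    have := HD_prod T (fun _ => (1 : ℝ)) _ (fun v _ => HD_var (F := F) v)
    rw [Finset.mem_powersetCard] at hT
    simpa [hT.2] using this
  refine h.congr (fun x => ?_)
  have h2 : ∀ T : Finset (Fin n), ∏ v ∈ T, (if v ∈ x then (1 : F) else 0)
      = if T ⊆ x then 1 else 0 := by
    intro T
    rw [Finset.prod_ite_zero]
    simp [Finset.subset_iff]
  simp_rw [h2]
  rw [← Finset.card_powersetCard j x, Finset.sum_ite, Finset.sum_const_zero, add_zero,
    Finset.sum_const, nsmul_eq_mul, mul_one]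
  congr 2
  ext T
  simp only [Finset.mem_filter, Finset.mem_powersetCard, Finset.subset_univ, true_and]
  tauto

theorem HD_choose_shift (a : ℕ) : ∀ j : ℕ, ∃ f, HD F n j f ∧
    ∀ x : Finset (Fin n), a ≤ x.card → f x = (((x.card - a).choose j : ℕ) : F) := by
  induction a with
  | zero => exact fun j => ⟨_, HD_choose j, fun x _ => by simp⟩
  | succ a iha =>
    intro j
    induction j with
    | zero => exact ⟨_, HD_choose 0, fun x _ => by simp⟩
    | succ j ihj =>
      obtain ⟨f, hf, hf'⟩ := iha (j + 1)
      obtain ⟨g, hg, hg'⟩ := ihj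
      refine ⟨_, hf.sub (hg.mono (by push_cast; linarith)), fun x hx => ?_⟩
      rw [hf' x (by omega), hg' x hx]
      obtain ⟨w, hw⟩ := Nat.exists_eq_add_of_le hx
      have e1 : x.card - a = w + 1 := by omega
      have e2 : x.card - (a + 1) = w := by omega
      rw [e1, e2, Nat.choose_succ_succ]
      push_cast
      ring

theorem HD_interp (a D : ℕ) (g : ℕ → F) : ∃ f, HD F n D f ∧
    ∀ x : Finset (Fin n), a ≤ x.card → x.card ≤ a + D → f x = g x.card := by
  choose c hc hc' using (HD_choose_shift (F := F) (n := n) a)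
  refine ⟨fun x => ∑ j ∈ Finset.range (D + 1), (fwdDiff 1)^[j] g a * c j x, ?_, ?_⟩
  · apply HD_sum _ (by positivity)
    intro j hj
    apply HD.smul
    refine (hc j).mono ?_
    have : j ≤ D := by simpa [Nat.lt_succ_iff] using hj
    exact_mod_cast this
  · intro x h1 h2
    obtain ⟨w, hw⟩ := Nat.exists_eq_add_of_le h1
    have h3 := shift_eq_sum_fwdDiff_iter (1 : ℕ) g w a
    simp only [smul_eq_mul, mul_one, nsmul_eq_mul] at h3
    rw [hw, h3]
    symm
    refine Finset.sum_subset_zero_on_sdiff ?_ ?_ ?_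
    · intro j; simp; omega
    · intro j hj
      simp at hj
      rw [hc' j x h1, hw, Nat.add_sub_cancel_left, Nat.choose_eq_zero_of_lt (by omega)]
      simp
    · intro j hj
      rw [hc' j x h1, hw, Nat.add_sub_cancel_left, mul_comm]

open Classical in
/-- Uniform expectation. -/
def ex {Ω : Type} [Fintype Ω] (f : Ω → ℝ) : ℝ := (∑ ω, f ω) / Fintype.card Ω

open Classical in
/-- Uniform probability. -/
def pr {Ω : Type} [Fintype Ω] (p : Ω → Prop) : ℝ := ex (fun ω => if p ω then (1 : ℝ) else 0)

theorem ex_mono {Ω : Type} [Fintype Ω] {f g : Ω → ℝ} (h : ∀ ω, f ω ≤ g ω) : ex f ≤ ex g := by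
  unfold ex
  gcongr
  exact h _

theorem pr_mono {Ω : Type} [Fintype Ω] {p q : Ω → Prop} (h : ∀ ω, p ω → q ω) : pr p ≤ pr q := by
  apply ex_mono
  intro ω
  by_cases h1 : p ω
  · simp [h1, h ω h1]
  · simp only [h1, if_false]; split_ifs <;> norm_num

theorem pr_or {Ω : Type} [Fintype Ω] (p q : Ω → Prop) :
    pr (fun ω => p ω ∨ q ω) ≤ pr p + pr q := by
  unfold pr ex
  rw [← add_div, ← Finset.sum_add_distrib]
  gcongr with ω
  by_cases h1 : p ω <;> by_cases h2 : q ω <;> simp [h1, h2]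

theorem pr_false {Ω : Type} [Fintype Ω] {p : Ω → Prop} (h : ∀ ω, ¬ p ω) : pr p = 0 := by
  unfold pr ex
  simp [h]

theorem pr_markov {Ω : Type} [Fintype Ω] (p : Ω → Prop) (f : Ω → ℝ) (c : ℝ) (hc : 0 < c)
    (hf : ∀ ω, 0 ≤ f ω) (h : ∀ ω, p ω → c ≤ f ω) : pr p ≤ ex f / c := by
  have h1 : ex f / c = ex (fun ω => f ω / c) := by
    unfold ex
    rw [← Finset.sum_div]
    ring
  rw [h1]
  apply ex_mono
  intro ω
  by_cases h2 : p ω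
  · simp only [h2, if_true]
    rw [le_div_iff₀ hc]
    simpa using h ω h2
  · simp only [h2, if_false]
    exact div_nonneg (hf ω) hc.le

open Classical in
theorem pr_fst {Ω Ω' : Type} [Fintype Ω] [Fintype Ω'] [Nonempty Ω'] (p : Ω → Prop) :
    pr (fun w : Ω × Ω' => p w.1) = pr p := by
  unfold pr ex
  rw [Fintype.sum_prod_type, Fintype.card_prod]
  have h : ∀ x : Ω, (∑ y : Ω', if p (x, y).1 then (1 : ℝ) else 0)
      = Fintype.card Ω' * if p x then 1 else 0 := by
    intro x
    by_cases h : p x <;> simp [h]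
  simp_rw [h]
  rw [← Finset.mul_sum]
  have : (Fintype.card Ω' : ℝ) ≠ 0 := by exact_mod_cast Fintype.card_ne_zero
  push_cast
  rw [mul_comm (Fintype.card Ω : ℝ), mul_div_mul_left _ _ this]

/-- Section-wise bound: if for every `s` the conditional probability is at most `δ`. -/
theorem pr_snd_le {Ω Ω' : Type} [Fintype Ω] [Fintype Ω'] [Nonempty Ω] (p : Ω → Ω' → Prop)
    (δ : ℝ) (h : ∀ s, pr (p s) ≤ δ) :
    pr (fun w : Ω × Ω' => p w.1 w.2) ≤ δ := by
  have h0 : (0 : ℝ) < Fintype.card Ω := by exact_mod_cast Fintype.card_pos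
  unfold pr ex at *
  rw [Fintype.sum_prod_type, Fintype.card_prod]
  push_cast
  rw [mul_comm, ← div_div, Finset.sum_div, div_le_iff₀ h0]
  refine (Finset.sum_le_sum (fun s _ => h s)).trans ?_
  simp [mul_comm]

open Classical in
/-- Random subset of coordinates. -/
def smp {n : ℕ} {G : Type} (A : G → Prop) (ω : Fin n → G) : Finset (Fin n) :=
  Finset.univ.filter (fun v => A (ω v))

open Classical in
theorem mgf {G : Type} [Fintype G] [Nonempty G] (A : G → Prop) (x : Finset (Fin n)) (z : ℝ) :
    ex (fun ω : Fin n → G => z ^ (x ∩ smp A ω).card)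
      = (1 + pr A * (z - 1)) ^ x.card := by
  have hG : (Fintype.card G : ℝ) ≠ 0 := by exact_mod_cast Fintype.card_ne_zero
  have h1 : ∀ ω : Fin n → G, z ^ (x ∩ smp A ω).card
      = ∏ v, (if v ∈ x then (if A (ω v) then z else 1) else 1) := by
    intro ω
    rw [← Finset.prod_filter, ← Finset.prod_filter, Finset.prod_const]
    congr 2
    ext v
    simp [smp]
  have h2 : ∑ ω : Fin n → G, ∏ v, (if v ∈ x then (if A (ω v) then z else 1) else 1)
      = ∏ v : Fin n, ∑ g : G, (if v ∈ x then (if A g then z else 1) else 1) := by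
    rw [Finset.prod_univ_sum, Fintype.piFinset_univ]
  unfold ex
  simp_rw [h1]
  rw [h2]
  have h3 : (Fintype.card (Fin n → G) : ℝ) = ∏ v : Fin n, (Fintype.card G : ℝ) := by
    simp
  rw [h3, ← Finset.prod_div_distrib]
  have h4 : ∀ v : Fin n, (∑ g : G, (if v ∈ x then (if A g then z else 1) else 1)) / (Fintype.card G : ℝ)
      = if v ∈ x then (1 + pr A * (z - 1)) else 1 := by
    intro v
    split_ifs
    · have h5 : ∀ g, (if A g then z else 1) = 1 + (if A g then (1 : ℝ) else 0) * (z - 1) := by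
        intro g; split_ifs <;> ring
      simp_rw [h5]
      rw [Finset.sum_add_distrib, ← Finset.sum_mul]
      unfold pr ex
      simp only [Finset.sum_const, Finset.card_univ, nsmul_eq_mul, mul_one]
      field_simp
    · simp [hG]
  simp_rw [h4]
  rw [← Finset.prod_filter, Finset.prod_const]
  simp

theorem pr_nonneg {Ω : Type} [Fintype Ω] (p : Ω → Prop) : 0 ≤ pr p := by
  rw [← pr_false (Ω := Ω) (p := fun _ => False) (by simp)]
  exact pr_mono (by simp)

theorem pr_le_one {Ω : Type} [Fintype Ω] (p : Ω → Prop) : pr p ≤ 1 := by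
  unfold pr ex
  apply div_le_one_of_le₀ _ (by positivity)
  refine (Finset.sum_le_sum (g := fun _ => (1 : ℝ)) ?_).trans ?_
  · intro ω _; split_ifs <;> norm_num
  · simp

theorem mgf_le {G : Type} [Fintype G] [Nonempty G] (A : G → Prop) (x : Finset (Fin n)) (z : ℝ)
    (hz : 0 ≤ z) :
    ex (fun ω : Fin n → G => z ^ (x ∩ smp A ω).card)
      ≤ Real.exp (x.card * pr A * (z - 1)) := by
  classical
  rw [mgf, mul_assoc, Real.exp_nat_mul]
  have h0 := pr_nonneg A
  have h1 := pr_le_one A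
  apply pow_le_pow_left₀
  · nlinarith
  · have := Real.add_one_le_exp (pr A * (z - 1)); linarith

theorem pr_bool : pr (fun b : Bool => b = true) = 1 / 2 := by
  unfold pr ex
  simp

/-- Hoeffding for the random half. -/
theorem tail_half (x : Finset (Fin n)) (W Δ : ℝ) (hW : 0 < W) (hx : (x.card : ℝ) ≤ W)
    (σ : ℝ) (hσ : σ ^ 2 = 1) (hΔ : 0 ≤ Δ) :
    pr (fun ω : Fin n → Bool => Δ ≤ σ * (2 * ((x ∩ smp (fun b => b = true) ω).card : ℝ) - x.card))
      ≤ Real.exp (-(Δ ^ 2 / (2 * W))) := by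
  set t : ℝ := σ * (Δ / W) with ht
  have h1 := pr_markov
    (fun ω : Fin n → Bool =>
      Δ ≤ σ * (2 * ((x ∩ smp (fun b => b = true) ω).card : ℝ) - x.card))
    (fun ω => Real.exp (2 * t) ^ (x ∩ smp (fun b => b = true) ω).card)
    (Real.exp (t * x.card + Δ ^ 2 / W)) (Real.exp_pos _) (fun ω => by positivity) (by
      intro ω h
      rw [← Real.exp_nat_mul]
      apply Real.exp_le_exp.mpr
      have h2 := mul_le_mul_of_nonneg_left h (show 0 ≤ Δ / W by positivity)
      have h3 : Δ / W * Δ = Δ ^ 2 / W := by ring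
      rw [h3] at h2
      have h4 : Δ / W * (σ * (2 * ((x ∩ smp (fun b => b = true) ω).card : ℝ) - x.card))
        = ((x ∩ smp (fun b => b = true) ω).card : ℝ) * (2 * t) - t * x.card := by
        rw [ht]; ring
      linarith)
  refine h1.trans ?_
  rw [mgf, pr_bool]
  have h5 : (1 + 1 / 2 * (Real.exp (2 * t) - 1)) = Real.exp t * Real.cosh t := by
    rw [Real.cosh_eq, show 2 * t = t + t by ring, Real.exp_add, Real.exp_neg]
    field_simp
    ring
  rw [h5, div_le_iff₀ (Real.exp_pos _), ← Real.exp_add]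
  have h6 : Real.exp t * Real.cosh t ≤ Real.exp (t + t ^ 2 / 2) := by
    rw [Real.exp_add]
    exact mul_le_mul_of_nonneg_left (Real.cosh_le_exp_half_sq t) (Real.exp_pos _).le
  have h7 : (Real.exp t * Real.cosh t) ^ x.card ≤ Real.exp (t + t ^ 2 / 2) ^ x.card :=
    pow_le_pow_left₀ (mul_nonneg (Real.exp_pos _).le (Real.cosh_pos _).le) h6 _
  refine h7.trans ?_
  rw [← Real.exp_nat_mul]
  apply Real.exp_le_exp.mpr
  have h8 : t ^ 2 = Δ ^ 2 / W ^ 2 := by rw [ht, mul_pow, hσ]; ring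
  have h9 : (x.card : ℝ) * (Δ ^ 2 / W ^ 2) ≤ Δ ^ 2 / W := by
    have : W * (Δ ^ 2 / W ^ 2) = Δ ^ 2 / W := by field_simp
    rw [← this]
    gcongr
  have h10 : Δ ^ 2 / (2 * W) = Δ ^ 2 / W / 2 := by field_simp
  rw [h10]
  nlinarith

/-- Simultaneous probabilistic computation of the indicators of weight `i`, for `i < k`. -/
def Sim (F : Type) [Field F] (n k : ℕ) (d δ : ℝ) : Prop :=
  ∃ (Ω : Type) (_ : Fintype Ω) (_ : Nonempty Ω) (P : Ω → ℕ → Finset (Fin n) → F),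
    (∀ ω i, HD F n d (P ω i)) ∧
    ∀ x : Finset (Fin n), pr (fun ω => ¬ ∀ i < k, P ω i x = if x.card = i then 1 else 0) ≤ δ

theorem Sim.mono {k k' : ℕ} {d d' δ δ' : ℝ} (h : Sim F n k d δ) (hk : k' ≤ k) (hd : d ≤ d')
    (hδ : δ ≤ δ') : Sim F n k' d' δ' := by
  obtain ⟨Ω, i1, i2, P, h1, h2⟩ := h
  refine ⟨Ω, i1, i2, P, fun ω i => (h1 ω i).mono hd, fun x => ?_⟩
  refine le_trans (pr_mono ?_) ((h2 x).trans hδ)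
  intro ω hω h3
  exact hω (fun i hi => h3 i (by omega))

theorem exp_neg_nat (m : ℕ) : Real.exp (-(m : ℝ)) ≤ (1 / 2) ^ m := by
  have h : -(m : ℝ) = m * (-1) := by ring
  rw [h, Real.exp_nat_mul]
  apply pow_le_pow_left₀ (Real.exp_pos _).le
  rw [Real.exp_neg, one_div]
  apply inv_anti₀ (by norm_num)
  have := Real.add_one_le_exp (1 : ℝ)
  linarith

theorem bad_half (x : Finset (Fin n)) (k k' L Δ : ℕ) (hk' : ∀ j, j < k' ↔ 4 * j < 3 * k)
    (hΔ : 4 * k * (L + 2) ≤ Δ ^ 2) (hΔ2 : 2 * Δ ≤ k) (hk : 64 * (L + 2) ≤ k) :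
    pr (fun ω : Fin n → Bool => ¬ (
      ((x ∩ smp (fun b => b = true) ω).card < k' ∧
        2 * (x ∩ smp (fun b => b = true) ω).card ≤ x.card + Δ ∧
        x.card ≤ 2 * (x ∩ smp (fun b => b = true) ω).card + Δ) ∨
      (k' ≤ (x ∩ smp (fun b => b = true) ω).card ∧ k ≤ x.card))) ≤ (1 / 2) ^ (L + 1) := by
  rcases le_or_gt x.card (2 * k) with hw | hw
  · have h1 : pr (fun ω : Fin n → Bool => ¬ (
      ((x ∩ smp (fun b => b = true) ω).card < k' ∧
        2 * (x ∩ smp (fun b => b = true) ω).card ≤ x.card + Δ ∧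
        x.card ≤ 2 * (x ∩ smp (fun b => b = true) ω).card + Δ) ∨
      (k' ≤ (x ∩ smp (fun b => b = true) ω).card ∧ k ≤ x.card))) ≤
      pr (fun ω : Fin n → Bool =>
        ((Δ : ℝ) ≤ 1 * (2 * ((x ∩ smp (fun b => b = true) ω).card : ℝ) - x.card)) ∨
        ((Δ : ℝ) ≤ (-1) * (2 * ((x ∩ smp (fun b => b = true) ω).card : ℝ) - x.card))) := by
      apply pr_mono
      intro ω
      set y := (x ∩ smp (fun b => b = true) ω).card
      intro h
      by_contra h2
      push Not at h2
      obtain ⟨h3, h4⟩ := h2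
      have h5 : 2 * y < x.card + Δ := by
        have : (2 * y : ℝ) < x.card + Δ := by linarith
        exact_mod_cast this
      have h6 : x.card < 2 * y + Δ := by
        have : (x.card : ℝ) < 2 * y + Δ := by linarith
        exact_mod_cast this
      apply h
      have := hk' y
      by_cases h7 : y < k'
      · left; omega
      · right; omega
    refine h1.trans ((pr_or _ _).trans ?_)
    have hkpos : (0 : ℝ) < 2 * k := by
      have : 0 < k := by omega
      positivity
    have hw' : (x.card : ℝ) ≤ 2 * k := by exact_mod_cast hw
    have t1 := tail_half x (2 * k) Δ hkpos hw' 1 (by norm_num) (by positivity)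
    have t2 := tail_half x (2 * k) Δ hkpos hw' (-1) (by norm_num) (by positivity)
    have t3 : Real.exp (-((Δ : ℝ) ^ 2 / (2 * (2 * k)))) ≤ (1 / 2) ^ (L + 2) := by
      refine le_trans (Real.exp_le_exp.mpr ?_) (exp_neg_nat (L + 2))
      apply neg_le_neg
      rw [le_div_iff₀ (by positivity)]
      have : ((4 * k * (L + 2) : ℕ) : ℝ) ≤ ((Δ ^ 2 : ℕ) : ℝ) := by exact_mod_cast hΔ
      push_cast at this ⊢
      linarith
    have t4 : (1 / 2 : ℝ) ^ (L + 1) = (1 / 2) ^ (L + 2) + (1 / 2) ^ (L + 2) := by ring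
    rw [t4]
    exact add_le_add (t1.trans t3) (t2.trans t3)
  · have hwpos : (0 : ℝ) < x.card := by
      have : 0 < x.card := by omega
      exact_mod_cast this
    have t1 := tail_half x x.card (x.card / 4) hwpos le_rfl (-1) (by norm_num) (by positivity)
    refine le_trans (pr_mono ?_) (t1.trans ?_)
    · intro ω
      set y := (x ∩ smp (fun b => b = true) ω).card
      intro h
      have := hk' y
      have h7 : y < k' := by
        by_contra h7
        exact h (by right; omega)
      have h8 : 4 * y < 3 * k := by omega
      have h9 : 8 * y ≤ 3 * x.card := by omega
      have h10 : (8 * y : ℝ) ≤ 3 * x.card := by exact_mod_cast h9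
      linarith
    · refine le_trans (Real.exp_le_exp.mpr ?_) (exp_neg_nat (L + 1))
      apply neg_le_neg
      have h1 : ((x.card : ℝ) / 4) ^ 2 / (2 * x.card) = x.card / 32 := by
        field_simp; norm_num
      rw [h1]
      have h2 : 32 * (L + 1) ≤ x.card := by omega
      have h3 : ((32 * (L + 1) : ℕ) : ℝ) ≤ x.card := by exact_mod_cast h2
      push_cast at h3 ⊢
      linarith

theorem Sim.step {k k' L Δ : ℕ} {d δ : ℝ} (h : Sim F n k' d δ)
    (hk' : ∀ j, j < k' ↔ 4 * j < 3 * k)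
    (hΔ : 4 * k * (L + 2) ≤ Δ ^ 2) (hΔ2 : 2 * Δ ≤ k) (hk : 64 * (L + 2) ≤ k) :
    Sim F n k (d + 2 * Δ) (δ + (1 / 2) ^ (L + 1)) := by
  obtain ⟨Ω, i1, i2, Q, h1, h2⟩ := h
  have hI : ∀ j i : ℕ, ∃ f, HD F n ((2 * Δ : ℕ) : ℝ) f ∧ ∀ x : Finset (Fin n),
      2 * j - Δ ≤ x.card → x.card ≤ (2 * j - Δ) + 2 * Δ →
      f x = if x.card = i then (1 : F) else 0 :=
    fun j i => HD_interp (2 * j - Δ) (2 * Δ) (fun w => if w = i then (1 : F) else 0)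
  choose I hI1 hI2 using hI
  have hd : 0 ≤ d := by
    obtain ⟨P, h3, _⟩ := h1 (Classical.choice i2) 0
    exact le_trans (by positivity) h3
  refine ⟨(Fin n → Bool) × Ω, inferInstance, inferInstance,
    fun w i x => ∑ j ∈ Finset.range k',
      Q w.2 j (x ∩ smp (fun b => b = true) w.1) * I j i x, ?_, ?_⟩
  · intro w i
    apply HD_sum _ (by positivity)
    intro j _
    have := ((h1 w.2 j).inter (smp (fun b => b = true) w.1)).mul (hI1 j i)
    exact this.mono (by push_cast; linarith)
  · intro x
    have e1 := pr_snd_le (Ω := Fin n → Bool) (Ω' := Ω)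
      (fun s ω => ¬ ∀ i < k', Q ω i (x ∩ smp (fun b => b = true) s)
        = if (x ∩ smp (fun b => b = true) s).card = i then 1 else 0) δ (fun s => h2 _)
    have e2 := bad_half x k k' L Δ hk' hΔ hΔ2 hk
    rw [← pr_fst (Ω' := Ω)] at e2
    refine le_trans (pr_mono ?_) ((pr_or _ _).trans (add_le_add e1 e2))
    rintro ⟨s, ω⟩ hne
    simp only at hne ⊢
    by_contra hcon
    push Not at hcon
    obtain ⟨c1, c2⟩ := hcon
    apply hne
    intro i hi
    set y := (x ∩ smp (fun b => b = true) s).card with hy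
    have c3 : ∀ j ∈ Finset.range k', Q ω j (x ∩ smp (fun b => b = true) s) * I j i x
        = if y = j then I j i x else 0 := by
      intro j hj
      rw [c1 j (Finset.mem_range.mp hj)]
      split_ifs <;> simp
    rw [Finset.sum_congr rfl c3, Finset.sum_ite_eq]
    rcases c2 with c2 | c2
    · rw [if_pos (Finset.mem_range.mpr c2.1), hI2 y i x (by omega) (by omega)]
    · rw [if_neg (by simp; omega), if_neg (by omega)]

/-- The main recursion on `k`. -/
theorem Sim.main (M B : ℝ) (hM : 1 ≤ M) (hB : 0 ≤ B)
    (base : ∀ L : ℕ, 10 ≤ L → Sim F n (80 * L) (M * (B * L)) ((1 / 2) ^ L)) :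
    ∀ k L : ℕ, 10 ≤ L →
      Sim F n k (M * ((200 + B) * Real.sqrt (k * L) + B * L)) ((1 / 2) ^ L) := by
  intro k
  induction k using Nat.strong_induction_on with
  | _ k ih =>
  intro L hL
  rcases lt_or_ge k (64 * (L + 2)) with hk | hk
  · refine (base L hL).mono (by omega) ?_ le_rfl
    have := Real.sqrt_nonneg ((k : ℝ) * L)
    have h2 : 0 ≤ (200 + B) * Real.sqrt (k * L) := by positivity
    apply mul_le_mul_of_nonneg_left _ (by linarith)
    linarith
  · set Δ := Nat.sqrt (4 * k * (L + 2)) + 1 with hΔdef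
    have hΔ : 4 * k * (L + 2) ≤ Δ ^ 2 := by
      have := Nat.lt_succ_sqrt' (4 * k * (L + 2))
      exact this.le
    have hs2 : Nat.sqrt (4 * k * (L + 2)) ^ 2 ≤ 4 * k * (L + 2) := Nat.sqrt_le' _
    have hs4 : 4 * Nat.sqrt (4 * k * (L + 2)) ≤ k := by
      by_contra hcon
      push Not at hcon
      nlinarith
    have hΔ2 : 2 * Δ ≤ k := by omega
    have hstep := (ih ((3 * k + 3) / 4) (by omega) (L + 1) (by omega)).step
      (k := k) (L := L) (Δ := Δ) (by intro j; omega) hΔ hΔ2 hk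
    refine hstep.mono le_rfl ?_ (le_of_eq (by ring))
    set s := Real.sqrt ((k : ℝ) * L) with hs
    have hLr : (10 : ℝ) ≤ L := by exact_mod_cast hL
    have hkr : (64 * (L + 2) : ℝ) ≤ k := by exact_mod_cast hk
    have hk'r : (((3 * k + 3) / 4 : ℕ) : ℝ) ≤ (3 * k + 3) / 4 := by
      have : 4 * ((3 * k + 3) / 4) ≤ 3 * k + 3 := by omega
      have h2 : (4 * (((3 * k + 3) / 4 : ℕ) : ℝ)) ≤ 3 * k + 3 := by exact_mod_cast this
      linarith
    have hss : s ^ 2 = k * L := Real.sq_sqrt (by positivity)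
    have hs0 : 0 ≤ s := Real.sqrt_nonneg _
    have hs80 : 80 ≤ s := by
      apply Real.le_sqrt_of_sq_le
      nlinarith
    have b1 : Real.sqrt ((((3 * k + 3) / 4 : ℕ) : ℝ) * ((L + 1 : ℕ) : ℝ)) ≤ 0.92 * s := by
      apply Real.sqrt_le_iff.mpr
      refine ⟨by positivity, ?_⟩
      rw [mul_pow, hss]
      push_cast
      calc (((3 * k + 3) / 4 : ℕ) : ℝ) * ((L : ℝ) + 1) ≤ ((3 * k + 3) / 4) * (1.1 * L) := by
            apply mul_le_mul hk'r _ (by positivity) (by positivity)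
            linarith
        _ ≤ (0.76 * k) * (1.1 * L) := by
            apply mul_le_mul_of_nonneg_right _ (by positivity)
            linarith
        _ ≤ 0.92 ^ 2 * (k * L) := by
            have : (0 : ℝ) ≤ k * L := by positivity
            nlinarith
    have b2 : (Δ : ℝ) ≤ 4 * s := by
      have : (Nat.sqrt (4 * k * (L + 2)) : ℝ) ≤ 3 * s := by
        have h1 : ((Nat.sqrt (4 * k * (L + 2)) : ℝ)) ^ 2 ≤ 4 * k * (L + 2) := by
          exact_mod_cast hs2
        have h2 : (Nat.sqrt (4 * k * (L + 2)) : ℝ) ^ 2 ≤ (3 * s) ^ 2 := by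
          rw [mul_pow, hss]
          refine h1.trans ?_
          have : (0 : ℝ) ≤ k := by positivity
          nlinarith
        exact (abs_le.mp (abs_le_of_sq_le_sq h2 (by positivity))).2
      rw [hΔdef]
      push_cast
      linarith
    have b3 : 2 * (Δ : ℝ) ≤ M * (8 * s) := by
      have : 8 * s ≤ M * (8 * s) := le_mul_of_one_le_left (by positivity) hM
      linarith
    refine (add_le_add le_rfl b3).trans ?_
    rw [← mul_add]
    apply mul_le_mul_of_nonneg_left _ (by linarith)
    have b4 := mul_le_mul_of_nonneg_left b1 (show 0 ≤ 200 + B by linarith)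
    push_cast at b4 ⊢
    have b5 : B * 80 ≤ B * s := mul_le_mul_of_nonneg_left hs80 hB
    nlinarith

theorem Sim.of_gap {k K : ℕ} {d δ : ℝ} (hδ : 0 ≤ δ) (Ω : Type) [Fintype Ω] [Nonempty Ω]
    (R : Ω → Finset (Fin n) → F) (hR : ∀ ω, HD F n d (R ω))
    (low : ∀ ω x, x.card < k → R ω x = 1)
    (hkK : k ≤ K + 1) (high : ∀ x : Finset (Fin n), K < x.card → pr (fun ω => R ω x ≠ 0) ≤ δ) :
    Sim F n k (d + K) δ := by
  have hI : ∀ i : ℕ, ∃ f, HD F n (K : ℝ) f ∧ ∀ x : Finset (Fin n),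
      0 ≤ x.card → x.card ≤ 0 + K → f x = if x.card = i then (1 : F) else 0 :=
    fun i => HD_interp 0 K (fun w => if w = i then (1 : F) else 0)
  choose I hI1 hI2 using hI
  refine ⟨Ω, inferInstance, inferInstance, fun ω i x => R ω x * I i x,
    fun ω i => (hR ω).mul (hI1 i), fun x => ?_⟩
  rcases lt_or_ge x.card k with h1 | h1
  · rw [pr_false]
    · exact hδ
    · intro ω hω
      apply hω
      intro i _
      show R ω x * I i x = _
      rw [low ω x h1, one_mul, hI2 i x (by omega) (by omega)]
  · rcases le_or_gt x.card K with h2 | h2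
    · rw [pr_false]
      · exact hδ
      · intro ω hω
        apply hω
        intro i hi
        show R ω x * I i x = _
        rw [hI2 i x (by omega) (by omega), if_neg (by omega), mul_zero]
    · refine le_trans (pr_mono ?_) (high x h2)
      intro ω hω h0
      apply hω
      intro i hi
      show R ω x * I i x = _
      rw [h0, zero_mul, if_neg (by omega)]

theorem pr_fin_lt (N c : ℕ) (hc : c ≤ N) :
    pr (fun g : Fin N => g.val < c) = (c : ℝ) / N := by
  unfold pr ex
  have h1 : (∑ ω : Fin N, if ω.val < c then (1 : ℝ) else 0) = c := by
    rw [Finset.sum_boole, Fin.card_filter_val_lt, Nat.min_eq_right hc]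
  rw [Fintype.card_fin, ← h1]
  congr 1
  apply Finset.sum_congr rfl
  intro ω _
  by_cases h : ω.val < c <;> simp [h]

theorem base0 (r : ℕ) (hr : n ≤ 2 ^ r) (L : ℕ) (hL : 10 ≤ L) :
    Sim F n (80 * L) ((r + 1) * (1400 * L)) ((1 / 2) ^ L) := by
  set k := 80 * L with hk
  obtain ⟨Q, hQ1, hQ2⟩ := HD_interp (F := F) (n := n) 0 (16 * k)
    (fun w => if w < k then (1 : F) else 0)
  have key : Sim F n k (((r + 1 : ℕ) : ℝ) * ((16 * k : ℕ) : ℝ) + k) ((1 / 2) ^ L) := by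
    have : Nonempty (Fin (2 ^ r)) := ⟨⟨0, by positivity⟩⟩
    refine Sim.of_gap (by positivity) (Fin n → Fin (2 ^ r))
      (fun ω x => ∏ e ∈ Finset.range (r + 1),
        Q (x ∩ smp (fun g : Fin (2 ^ r) => g.val < 2 ^ e) ω)) ?_ ?_ (by omega) ?_
    · intro ω
      have := HD_prod (Finset.range (r + 1)) (fun _ => ((16 * k : ℕ) : ℝ))
        (fun e x => Q (x ∩ smp (fun g : Fin (2 ^ r) => g.val < 2 ^ e) ω))
        (fun e _ => hQ1.inter _)
      simpa using this
    · intro ω x hx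
      apply Finset.prod_eq_one
      intro e _
      have h1 : (x ∩ smp (fun g : Fin (2 ^ r) => g.val < 2 ^ e) ω).card ≤ x.card :=
        Finset.card_le_card Finset.inter_subset_left
      rw [hQ2 _ (by omega) (by omega), if_pos (by omega)]
    · intro x hx
      rcases le_or_gt x.card (16 * k) with hw | hw
      · rw [pr_false]
        · positivity
        · intro ω hω
          apply hω
          apply Finset.prod_eq_zero (i := r) (by simp)
          have h1 : smp (fun g : Fin (2 ^ r) => g.val < 2 ^ r) ω = Finset.univ := by
            simp [smp]
          rw [h1, Finset.inter_univ, hQ2 x (by omega) (by omega), if_neg (by omega)]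
      · have hwn : x.card ≤ n := by simpa using Finset.card_le_univ x
        set i := Nat.log 2 (x.card / (2 * k)) with hi
        have hk0 : 0 < k := by omega
        have hne : x.card / (2 * k) ≠ 0 := by
          have : 1 ≤ x.card / (2 * k) := by
            rw [Nat.le_div_iff_mul_le (by omega)]; omega
          omega
        have l1 : 2 ^ i ≤ x.card / (2 * k) := Nat.pow_log_le_self 2 hne
        have l2 : x.card / (2 * k) < 2 ^ (i + 1) := Nat.lt_pow_succ_log_self (by norm_num) _
        rw [Nat.le_div_iff_mul_le (by omega)] at l1
        rw [Nat.div_lt_iff_lt_mul (by omega)] at l2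
        have hir : i ≤ r := by
          by_contra hcon
          push Not at hcon
          have : 2 ^ r < 2 ^ i := Nat.pow_lt_pow_right (by norm_num) hcon
          nlinarith
        set e := r - i with he
        set A : Fin (2 ^ r) → Prop := fun g => g.val < 2 ^ e with hA
        have hq : pr A = 1 / 2 ^ i := by
          rw [hA, pr_fin_lt _ _ (Nat.pow_le_pow_right (by norm_num) (by omega))]
          have : r = e + i := by omega
          push_cast
          rw [this, pow_add]
          field_simp
        have l1r : (2 : ℝ) ^ i * (2 * k) ≤ x.card := by exact_mod_cast l1
        have l2r : (x.card : ℝ) ≤ 2 ^ (i + 1) * (2 * k) := by exact_mod_cast l2.le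
        have hμ1 : 2 * (k : ℝ) ≤ x.card * pr A := by
          rw [hq, mul_one_div, le_div_iff₀ (by positivity)]; linarith
        have hμ2 : x.card * pr A ≤ 4 * (k : ℝ) := by
          rw [hq, mul_one_div, div_le_iff₀ (by positivity)]
          rw [pow_succ] at l2r; linarith
        have p1 := pr_markov (fun ω : Fin n → Fin (2 ^ r) => (x ∩ smp A ω).card < k)
          (fun ω => (1 / 2 : ℝ) ^ (x ∩ smp A ω).card) ((1 / 2) ^ k) (by positivity)
          (fun ω => by positivity)
          (fun ω hω => pow_le_pow_of_le_one (by norm_num) (by norm_num) hω.le)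
        have p2 := pr_markov (fun ω : Fin n → Fin (2 ^ r) => 16 * k < (x ∩ smp A ω).card)
          (fun ω => (2 : ℝ) ^ (x ∩ smp A ω).card) (2 ^ (16 * k)) (by positivity)
          (fun ω => by positivity)
          (fun ω hω => pow_le_pow_right₀ (by norm_num) hω.le)
        have m1 := mgf_le A x (1 / 2) (by norm_num)
        have m2 := mgf_le A x 2 (by norm_num)
        have hexp1 := Real.exp_one_gt_d9
        have hexp2 := Real.exp_one_lt_d9
        have q1 : pr (fun ω : Fin n → Fin (2 ^ r) => (x ∩ smp A ω).card < k) ≤ (3 / 4) ^ k := by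
          refine p1.trans ?_
          rw [div_le_iff₀ (by positivity), ← mul_pow]
          refine m1.trans ?_
          have : Real.exp (x.card * pr A * (1 / 2 - 1)) ≤ Real.exp ((k : ℝ) * (-1)) :=
            Real.exp_le_exp.mpr (by linarith)
          refine this.trans ?_
          rw [Real.exp_nat_mul]
          apply pow_le_pow_left₀ (Real.exp_pos _).le
          rw [Real.exp_neg, inv_le_comm₀ (Real.exp_pos _) (by norm_num)]
          refine le_trans ?_ hexp1.le
          norm_num
        have q2 : pr (fun ω : Fin n → Fin (2 ^ r) => 16 * k < (x ∩ smp A ω).card)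
            ≤ (3 / 4) ^ k := by
          refine p2.trans ?_
          rw [div_le_iff₀ (by positivity), pow_mul (2 : ℝ) 16 k, ← mul_pow]
          refine m2.trans ?_
          have : Real.exp (x.card * pr A * (2 - 1)) ≤ Real.exp ((k : ℝ) * 4) :=
            Real.exp_le_exp.mpr (by linarith)
          refine this.trans ?_
          rw [Real.exp_nat_mul]
          apply pow_le_pow_left₀ (Real.exp_pos _).le
          have h4 : (4 : ℝ) = ((4 : ℕ) : ℝ) * 1 := by norm_num
          rw [h4, Real.exp_nat_mul]
          have : Real.exp 1 ^ 4 ≤ 3 ^ 4 :=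
            pow_le_pow_left₀ (Real.exp_pos _).le (by linarith) 4
          refine this.trans ?_
          norm_num
        have q3 : (3 / 4 : ℝ) ^ k ≤ (1 / 2) ^ (L + 1) := by
          rw [hk, pow_mul]
          have : ((3 / 4 : ℝ) ^ 80) ^ L ≤ ((1 / 2) ^ 2) ^ L := by
            apply pow_le_pow_left₀ (by positivity)
            norm_num
          refine this.trans ?_
          rw [← pow_mul]
          exact pow_le_pow_of_le_one (by norm_num) (by norm_num) (by omega)
        have q4 : (1 / 2 : ℝ) ^ L = (1 / 2) ^ (L + 1) + (1 / 2) ^ (L + 1) := by ring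
        rw [q4]
        refine le_trans (pr_mono ?_) ((pr_or _ _).trans
          (add_le_add (q1.trans q3) (q2.trans q3)))
        intro ω hω
        by_contra hcon
        push Not at hcon
        apply hω
        apply Finset.prod_eq_zero (i := e) (by simp; omega)
        have g1 : k ≤ (x ∩ smp A ω).card := hcon.1
        have g2 : (x ∩ smp A ω).card ≤ 16 * k := hcon.2
        change Q (x ∩ smp A ω) = 0
        rw [hQ2 _ (by omega) (by omega), if_neg (by omega)]
  refine key.mono le_rfl ?_ le_rfl
  rw [hk]
  push_cast
  have : (0 : ℝ) ≤ r * L := by positivity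
  have : (0 : ℝ) ≤ L := by positivity
  nlinarith

theorem ex_update {G : Type} [Fintype G] [Nonempty G] (v : Fin n) (f : (Fin n → G) → ℝ) :
    ex f = ex (fun ω => ex (fun g : G => f (Function.update ω v g))) := by
  have hG : (Fintype.card G : ℝ) ≠ 0 := by exact_mod_cast Fintype.card_ne_zero
  have hinv : Function.Involutive (fun q : (Fin n → G) × G =>
      ((Function.update q.1 v q.2, q.1 v) : (Fin n → G) × G)) := by
    rintro ⟨ω, g⟩
    simp
  have h1 : ∑ q : (Fin n → G) × G, f (Function.update q.1 v q.2)
      = ∑ q : (Fin n → G) × G, f q.1 :=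
    Equiv.sum_comp hinv.toPerm (fun q : (Fin n → G) × G => f q.1)
  rw [Fintype.sum_prod_type, Fintype.sum_prod_type] at h1
  simp only [Finset.sum_const, Finset.card_univ, nsmul_eq_mul] at h1
  rw [← Finset.mul_sum] at h1
  unfold ex
  rw [← Finset.sum_div, h1]
  field_simp

/-- Number of selected active coordinates in bucket `b`. -/
def cnt {n T : ℕ} (ω : Fin n → Fin T × Bool) (x : Finset (Fin n)) (b : Fin T) : ℕ :=
  (x.filter (fun v => ω v = (b, true))).card

/-- Buckets with non-zero count modulo `p`. -/
def zset {n T : ℕ} (p : ℕ) (ω : Fin n → Fin T × Bool) (x : Finset (Fin n)) : Finset (Fin T) :=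
  Finset.univ.filter (fun b => ¬ p ∣ cnt ω x b)

theorem cnt_insert {T : ℕ} (ω : Fin n → Fin T × Bool) (x : Finset (Fin n)) (v : Fin n)
    (hv : v ∉ x) (g : Fin T × Bool) (b : Fin T) :
    cnt (Function.update ω v g) (insert v x) b = cnt ω x b + if g = (b, true) then 1 else 0 := by
  unfold cnt
  have h1 : x.filter (fun u => Function.update ω v g u = (b, true))
      = x.filter (fun u => ω u = (b, true)) := by
    apply Finset.filter_congr
    intro u hu
    have : u ≠ v := fun h => hv (h ▸ hu)
    simp [Function.update_of_ne this]
  rw [Finset.filter_insert, Function.update_self, h1]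
  split_ifs with h
  · rw [Finset.card_insert_of_notMem (by simp [hv])]
  · simp

theorem zset_bound {T p : ℕ} (hp : p.Prime) (ω : Fin n → Fin T × Bool) (x : Finset (Fin n))
    (v : Fin n) (hv : v ∉ x) (b : Fin T) (t : Bool) :
    (1 / 2 : ℝ) ^ (zset p (Function.update ω v (b, t)) (insert v x)).card ≤
      (1 / 2) ^ (zset p ω x).card *
        (if t = true then (if b ∈ zset p ω x then 2 else 1 / 2) else 1) := by
  have hmem : ∀ c, c ≠ b ∨ t = false →
      (c ∈ zset p (Function.update ω v (b, t)) (insert v x) ↔ c ∈ zset p ω x) := by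
    intro c hc
    simp only [zset, Finset.mem_filter, Finset.mem_univ, true_and]
    rw [cnt_insert ω x v hv, if_neg, add_zero]
    intro h
    simp only [Prod.mk.injEq] at h
    rcases hc with hc | hc
    · exact hc h.1.symm
    · rw [hc] at h; exact absurd h.2 (by simp)
  cases t with
  | false =>
    have : zset p (Function.update ω v (b, false)) (insert v x) = zset p ω x := by
      ext c; exact hmem c (Or.inr rfl)
    simp [this]
  | true =>
    by_cases hb : b ∈ zset p ω x
    · simp only [if_true, hb]
      have h1 : (zset p ω x).erase b ⊆ zset p (Function.update ω v (b, true)) (insert v x) := by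
        intro c hc
        rw [Finset.mem_erase] at hc
        exact (hmem c (Or.inl hc.1)).mpr hc.2
      have h2 := Finset.card_le_card h1
      rw [Finset.card_erase_of_mem hb] at h2
      have h3 : 0 < (zset p ω x).card := Finset.card_pos.mpr ⟨b, hb⟩
      obtain ⟨m, hm⟩ : ∃ m, (zset p ω x).card = m + 1 := ⟨_, (Nat.succ_pred_eq_of_pos h3).symm⟩
      rw [hm, pow_succ]
      have h4 : (1 / 2 : ℝ) ^ (zset p (Function.update ω v (b, true)) (insert v x)).card
        ≤ (1 / 2) ^ m := pow_le_pow_of_le_one (by norm_num) (by norm_num) (by omega)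
      linarith
    · simp only [if_true, hb, if_false]
      have h1 : insert b (zset p ω x)
          ⊆ zset p (Function.update ω v (b, true)) (insert v x) := by
        intro c hc
        rw [Finset.mem_insert] at hc
        by_cases hcb : c = b
        · subst hcb
          simp only [zset, Finset.mem_filter, Finset.mem_univ, true_and, not_not] at hb ⊢
          rw [cnt_insert ω x v hv, if_pos rfl]
          intro h
          have := (Nat.dvd_add_right hb).mp h
          exact hp.one_lt.ne' (Nat.dvd_one.mp this)
        · exact (hmem c (Or.inl hcb)).mpr (hc.resolve_left hcb)
      have h2 := Finset.card_le_card h1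
      rw [Finset.card_insert_of_notMem hb] at h2
      rw [← pow_succ]
      exact pow_le_pow_of_le_one (by norm_num) (by norm_num) h2

theorem potential {p : ℕ} (hp : p.Prime) (τ : ℕ) (hτ : 0 < τ) (x : Finset (Fin n)) :
    ex (fun ω : Fin n → Fin (6 * τ) × Bool => (1 / 2 : ℝ) ^ (zset p ω x).card)
      ≤ (7 / 8) ^ x.card + 16 * (1 / 2) ^ τ := by
  have hne : Nonempty (Fin (6 * τ)) := ⟨⟨0, by omega⟩⟩
  have hτr : (0 : ℝ) < τ := by exact_mod_cast hτ
  have hcard : (0 : ℝ) < Fintype.card (Fin n → Fin (6 * τ) × Bool) := by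
    exact_mod_cast Fintype.card_pos
  induction x using Finset.induction_on with
  | empty =>
    have h1 : ex (fun ω : Fin n → Fin (6 * τ) × Bool => (1 / 2 : ℝ) ^ (zset p ω ∅).card)
        ≤ ex (fun ω : Fin n → Fin (6 * τ) × Bool => 1) :=
      ex_mono (fun ω => pow_le_one₀ (by norm_num) (by norm_num))
    refine h1.trans ?_
    have h2 : ex (fun ω : Fin n → Fin (6 * τ) × Bool => (1 : ℝ)) = 1 := by
      unfold ex
      rw [Finset.sum_const, Finset.card_univ, nsmul_eq_mul, mul_one, div_self hcard.ne']
    rw [h2]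
    simp
  | insert v x hv ih =>
    rw [ex_update v]
    have h1 : ∀ ω : Fin n → Fin (6 * τ) × Bool,
        ex (fun g => (1 / 2 : ℝ) ^ (zset p (Function.update ω v g) (insert v x)).card)
          ≤ 7 / 8 * (1 / 2) ^ (zset p ω x).card + 2 * (1 / 2) ^ τ := by
      intro ω
      set Z := zset p ω x with hZ
      set z := Z.card with hz
      have hzT : z ≤ 6 * τ := by
        have := Finset.card_le_univ Z
        simpa using this
      have hzTr : (z : ℝ) ≤ 6 * τ := by exact_mod_cast hzT
      have e1 : ex (fun g => (1 / 2 : ℝ) ^ (zset p (Function.update ω v g) (insert v x)).card)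
          ≤ ex (fun g : Fin (6 * τ) × Bool => (1 / 2 : ℝ) ^ z *
            (if g.2 = true then (if g.1 ∈ Z then 2 else 1 / 2) else 1)) :=
        ex_mono (fun g => zset_bound hp ω x v hv g.1 g.2)
      refine e1.trans ?_
      have e2 : ∑ b : Fin (6 * τ), (if b ∈ Z then (2 : ℝ) else 1 / 2)
          = 3 / 2 * z + 1 / 2 * (6 * τ) := by
        have : ∀ b, (if b ∈ Z then (2 : ℝ) else 1 / 2)
            = 3 / 2 * (if b ∈ Z then (1 : ℝ) else 0) + 1 / 2 := by
          intro b; split_ifs <;> norm_num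
        simp_rw [this]
        rw [Finset.sum_add_distrib, ← Finset.mul_sum]
        simp [hz]
        ring
      have e3 : ex (fun g : Fin (6 * τ) × Bool => (1 / 2 : ℝ) ^ z *
            (if g.2 = true then (if g.1 ∈ Z then 2 else 1 / 2) else 1))
          = (1 / 2) ^ z * ((3 / 2 * z + 3 / 2 * (6 * τ)) / (12 * τ)) := by
        unfold ex
        rw [← Finset.mul_sum, Fintype.sum_prod_type]
        simp only [Fintype.sum_bool, if_true, Bool.false_eq_true, if_false]
        rw [Finset.sum_add_distrib, e2]
        simp only [Finset.sum_const, Finset.card_univ, Fintype.card_fin, nsmul_eq_mul, mul_one,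
          Fintype.card_prod, Fintype.card_bool]
        push_cast
        rw [mul_div_assoc]
        congr 2 <;> ring
      rw [e3]
      have hpz : (0 : ℝ) < (1 / 2) ^ z := by positivity
      have hpt : (0 : ℝ) < (1 / 2) ^ τ := by positivity
      rcases le_or_gt z τ with hc | hc
      · have : (3 / 2 * (z : ℝ) + 3 / 2 * (6 * τ)) / (12 * τ) ≤ 7 / 8 := by
          rw [div_le_iff₀ (by positivity)]
          have : (z : ℝ) ≤ τ := by exact_mod_cast hc
          linarith
        nlinarith
      · have : (3 / 2 * (z : ℝ) + 3 / 2 * (6 * τ)) / (12 * τ) ≤ 2 := by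
          rw [div_le_iff₀ (by positivity)]
          linarith
        have h3 : (1 / 2 : ℝ) ^ z ≤ (1 / 2) ^ τ :=
          pow_le_pow_of_le_one (by norm_num) (by norm_num) hc.le
        nlinarith
    refine (ex_mono h1).trans ?_
    have h2 : ex (fun ω : Fin n → Fin (6 * τ) × Bool =>
        7 / 8 * (1 / 2 : ℝ) ^ (zset p ω x).card + 2 * (1 / 2) ^ τ)
        = 7 / 8 * ex (fun ω : Fin n → Fin (6 * τ) × Bool => (1 / 2 : ℝ) ^ (zset p ω x).card)
          + 2 * (1 / 2) ^ τ := by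
      unfold ex
      rw [Finset.sum_add_distrib, ← Finset.mul_sum, Finset.sum_const, Finset.card_univ,
        nsmul_eq_mul]
      field_simp
    rw [h2, Finset.card_insert_of_notMem hv, pow_succ]
    linarith

theorem cast_pow_char (p : ℕ) (hp : p.Prime) [CharP F p] (m : ℕ) :
    (m : F) ^ (p - 1) = if p ∣ m then 0 else 1 := by
  have : Fact p.Prime := ⟨hp⟩
  split_ifs with h
  · rw [(CharP.cast_eq_zero_iff F p m).mpr h, zero_pow]
    have := hp.two_le
    omega
  · have h1 : (m : ZMod p) ≠ 0 := by rwa [Ne, ZMod.natCast_eq_zero_iff]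
    have h2 := ZMod.pow_card_sub_one_eq_one h1
    have h3 := congrArg (ZMod.castHom (dvd_refl p) F) h2
    simpa using h3

theorem HD_cnt {T : ℕ} (ω : Fin n → Fin T × Bool) (b : Fin T) :
    HD F n 1 (fun x => (cnt ω x b : F)) := by
  have h := HD_sum (F := F) (n := n) (Finset.univ.filter (fun v => ω v = (b, true)))
    zero_le_one (fun v x => if v ∈ x then (1 : F) else 0) (fun v _ => HD_var v)
  refine h.congr (fun x => ?_)
  rw [Finset.sum_boole, cnt]
  congr 2
  ext v
  simp [and_comm]

theorem basep (p : ℕ) (hp : p.Prime) [CharP F p] (L : ℕ) (hL : 10 ≤ L) :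
    Sim F n (80 * L) (600 * p * L) ((1 / 2) ^ L) := by
  set k := 80 * L with hk
  set τ := k + L + 6 with hτ
  have hne : Nonempty (Fin (6 * τ)) := ⟨⟨0, by omega⟩⟩
  have hp2 := hp.two_le
  let V : (Fin n → Fin (6 * τ) × Bool) → Fin (6 * τ) → Finset (Fin n) → F :=
    fun ω b x => (cnt ω x b : F) ^ (p - 1)
  have hV : ∀ ω b, HD F n ((p - 1 : ℕ) : ℝ) (V ω b) := fun ω b => by
    simpa using (HD_cnt (F := F) ω b).pow (p - 1)
  let R : (Fin n → Fin (6 * τ) × Bool) → Finset (Fin n) → F :=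
    fun ω x => ∑ B ∈ (Finset.univ : Finset (Finset (Fin (6 * τ)))).filter (fun B => B.card < k),
      ∏ b, (if b ∈ B then V ω b x else 1 - V ω b x)
  have hRval : ∀ ω x, R ω x = if (zset p ω x).card < k then 1 else 0 := by
    intro ω x
    have h1 : ∀ B : Finset (Fin (6 * τ)), ∏ b, (if b ∈ B then V ω b x else 1 - V ω b x)
        = if zset p ω x = B then 1 else 0 := by
      intro B
      have h2 : ∀ b, (if b ∈ B then V ω b x else 1 - V ω b x)
          = if (b ∈ B ↔ b ∈ zset p ω x) then 1 else 0 := by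
        intro b
        simp only [V, cast_pow_char p hp, zset, Finset.mem_filter, Finset.mem_univ, true_and]
        by_cases c1 : b ∈ B <;> by_cases c2 : p ∣ cnt ω x b <;> simp [c1, c2]
      simp_rw [h2]
      rw [Finset.prod_ite_zero]
      simp only [Finset.mem_univ, true_implies, Finset.prod_const_one]
      congr 1
      rw [Finset.ext_iff]
      simp only [eq_iff_iff]
      exact forall_congr' (fun b => Iff.comm)
    simp only [R]
    simp_rw [h1]
    rw [Finset.sum_ite_eq]
    simp
  have hRdeg : ∀ ω, HD F n (((6 * τ : ℕ) : ℝ) * ((p - 1 : ℕ) : ℝ)) (R ω) := by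
    intro ω
    apply HD_sum _ (by positivity)
    intro B _
    have := HD_prod (F := F) (n := n) Finset.univ (fun _ : Fin (6 * τ) => ((p - 1 : ℕ) : ℝ))
      (fun b x => if b ∈ B then V ω b x else 1 - V ω b x) (by
        intro b _
        by_cases hb : b ∈ B
        · simpa [hb] using hV ω b
        · simpa [hb] using ((HD_const (1 : F)).mono (by positivity)).sub (hV ω b))
    simpa using this
  have key := Sim.of_gap (F := F) (n := n) (k := k) (K := 6 * τ) (δ := (1 / 2) ^ L)
    (by positivity) _ R hRdeg (by
      intro ω x hx
      rw [hRval, if_pos]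
      refine lt_of_le_of_lt ?_ hx
      have : zset p ω x ⊆ x.image (fun v => (ω v).1) := by
        intro b hb
        simp only [zset, Finset.mem_filter, Finset.mem_univ, true_and] at hb
        have h0 : cnt ω x b ≠ 0 := fun h => hb (h ▸ dvd_zero p)
        obtain ⟨v, hv⟩ := Finset.card_ne_zero.mp h0
        rw [Finset.mem_filter] at hv
        exact Finset.mem_image.mpr ⟨v, hv.1, by rw [hv.2]⟩
      exact (Finset.card_le_card this).trans Finset.card_image_le)
    (by omega) (by
      intro x hx
      have m1 := pr_markov (fun ω : Fin n → Fin (6 * τ) × Bool => R ω x ≠ 0)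
        (fun ω => (1 / 2 : ℝ) ^ (zset p ω x).card) ((1 / 2) ^ k) (by positivity)
        (fun ω => by positivity) (by
          intro ω hω
          rw [hRval] at hω
          have : (zset p ω x).card < k := by
            by_contra hcon
            exact hω (if_neg hcon)
          exact pow_le_pow_of_le_one (by norm_num) (by norm_num) this.le)
      refine m1.trans ?_
      rw [div_le_iff₀ (by positivity)]
      refine (potential hp τ (by omega) x).trans ?_
      have a1 : (7 / 8 : ℝ) ^ x.card ≤ (1 / 2) ^ τ := by
        have : (7 / 8 : ℝ) ^ x.card ≤ (7 / 8) ^ (6 * τ) :=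
          pow_le_pow_of_le_one (by norm_num) (by norm_num) hx.le
        refine this.trans ?_
        rw [pow_mul]
        apply pow_le_pow_left₀ (by positivity)
        norm_num
      have a2 : (1 / 2 : ℝ) ^ τ = (1 / 2) ^ L * (1 / 2) ^ k * (1 / 64) := by
        rw [hτ, pow_add, pow_add]; norm_num; ring
      have a3 : (0 : ℝ) < (1 / 2) ^ L * (1 / 2) ^ k := by positivity
      linarith)
  refine key.mono le_rfl ?_ le_rfl
  have hpr : ((p - 1 : ℕ) : ℝ) = p - 1 := by
    rw [Nat.cast_sub (by omega)]; simp
  have hτr : (τ : ℝ) ≤ 100 * L := by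
    have : τ ≤ 100 * L := by omega
    exact_mod_cast this
  have hp2r : (2 : ℝ) ≤ p := by exact_mod_cast hp2
  rw [hpr]
  push_cast
  nlinarith

theorem pdeg_le_of {D ε : ℝ} (h : (Fin n → Bool) → Bool) (spec : ℕ → Bool)
    (hs : ∀ a, h a = spec (wt a)) (Ω : Type) [Fintype Ω] [Nonempty Ω]
    (R : Ω → Finset (Fin n) → F) (hR : ∀ ω, HD F n D (R ω))
    (herr : ∀ x : Finset (Fin n), pr (fun ω => R ω x ≠ bF F (spec x.card)) ≤ ε) :
    (pdeg F h ε : ℝ) ≤ D := by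
  classical
  choose P hP1 hP2 using hR
  have hD : 0 ≤ D := le_trans (by positivity) (hP1 (Classical.arbitrary Ω))
  have hc : (Fintype.card Ω : ℝ) ≠ 0 := by exact_mod_cast Fintype.card_ne_zero
  let E := Fintype.equivFin Ω
  have hmem : pdeg F h ε ≤ ⌊D⌋₊ := by
    apply Nat.sInf_le
    refine ⟨⟨Fintype.card Ω, fun _ => 1 / Fintype.card Ω, fun _ => by positivity,
      by simp [hc], fun i => P (E.symm i)⟩, fun i => Nat.le_floor (hP1 _), fun a => ?_⟩
    set x : Finset (Fin n) := Finset.univ.filter (fun v => a v = true) with hx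
    have hv : (fun v => bF F (a v)) = fun v => if v ∈ x then (1 : F) else 0 := by
      funext v
      simp [bF, hx]
    have hfa : bF F (h a) = bF F (spec x.card) := by rw [hs a]; rfl
    have key : errAt (⟨Fintype.card Ω, fun _ => 1 / Fintype.card Ω, fun _ => by positivity,
      by simp [hc], fun i => P (E.symm i)⟩ : ProbPoly F n) h a
        = pr (fun ω => R ω x ≠ bF F (spec x.card)) := by
      unfold errAt pr ex
      simp only [hv, hP2, hfa]
      rw [Finset.sum_div, ← Equiv.sum_comp E.symm]
      apply Finset.sum_congr rfl
      intro i _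
      by_cases hh : R (E.symm i) x = bF F (spec x.card) <;> simp [hh]
    rw [key]
    exact herr x
  calc (pdeg F h ε : ℝ) ≤ (⌊D⌋₊ : ℝ) := by exact_mod_cast hmem
    _ ≤ D := Nat.floor_le hD

theorem pdeg_le_of_sim {D δ ε : ℝ} (k : ℕ) (hk : 1 ≤ k) (hS : Sim F n (3 * k) D δ)
    (hε : 2 * δ ≤ ε) (hδ : 0 ≤ δ) (h : (Fin n → Bool) → Bool) (spec : ℕ → Bool)
    (hs : ∀ a, h a = spec (wt a))
    (hb : ∀ i j, k ≤ i → i + k ≤ n → k ≤ j → j + k ≤ n → spec i = spec j) :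
    (pdeg F h ε : ℝ) ≤ D := by
  obtain ⟨Ω, i1, i2, P, h1, h2⟩ := hS
  have hD : 0 ≤ D := by
    obtain ⟨P, h3, _⟩ := h1 (Classical.choice i2) 0
    exact le_trans (by positivity) h3
  rcases le_or_gt n (2 * k) with hn | hn
  · refine pdeg_le_of h spec hs Ω
      (fun ω x => ∑ j ∈ Finset.range (3 * k), bF F (spec j) * P ω j x) ?_ ?_
    · intro ω
      apply HD_sum _ hD
      intro j _
      exact (h1 ω j).smul _
    · intro x
      have hwn : x.card ≤ n := by simpa using Finset.card_le_univ x
      refine (pr_mono ?_).trans ((h2 x).trans (by linarith))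
      intro ω hω hgood
      apply hω
      have c3 : ∀ j ∈ Finset.range (3 * k), bF F (spec j) * P ω j x
          = if x.card = j then bF F (spec j) else 0 := by
        intro j hj
        rw [hgood j (Finset.mem_range.mp hj)]
        split_ifs <;> simp
      rw [Finset.sum_congr rfl c3, Finset.sum_ite_eq, if_pos (Finset.mem_range.mpr (by omega))]
  · set c : F := bF F (spec k) with hc
    refine pdeg_le_of h spec hs Ω
      (fun ω x => (c + ∑ j ∈ Finset.range k, (bF F (spec j) - c) * P ω j x)
        + ∑ j ∈ Finset.range k, (bF F (spec (n - j)) - c) * P ω j xᶜ) ?_ ?_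
    · intro ω
      refine (((HD_const c).mono hD).add (HD_sum _ hD _ ?_)).add (HD_sum _ hD _ ?_)
      · intro j _
        exact (h1 ω j).smul _
      · intro j _
        exact ((h1 ω j).compl).smul _
    · intro x
      have hwn : x.card ≤ n := by simpa using Finset.card_le_univ x
      have hcc : xᶜ.card = n - x.card := by rw [Finset.card_compl, Fintype.card_fin]
      refine (pr_mono ?_).trans
        ((pr_or _ _).trans ((add_le_add (h2 x) (h2 xᶜ)).trans (by linarith)))
      intro ω hω
      by_contra hcon
      push Not at hcon
      obtain ⟨g1, g2⟩ := hcon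
      apply hω
      have c1 : ∀ j ∈ Finset.range k, (bF F (spec j) - c) * P ω j x
          = if x.card = j then (bF F (spec j) - c) else 0 := by
        intro j hj
        rw [g1 j (by have := Finset.mem_range.mp hj; omega)]
        split_ifs <;> simp
      have c2 : ∀ j ∈ Finset.range k, (bF F (spec (n - j)) - c) * P ω j xᶜ
          = if xᶜ.card = j then (bF F (spec (n - j)) - c) else 0 := by
        intro j hj
        rw [g2 j (by have := Finset.mem_range.mp hj; omega)]
        split_ifs <;> simp
      show (c + ∑ j ∈ Finset.range k, (bF F (spec j) - c) * P ω j x)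
        + ∑ j ∈ Finset.range k, (bF F (spec (n - j)) - c) * P ω j xᶜ = _
      rw [Finset.sum_congr rfl c1, Finset.sum_congr rfl c2, Finset.sum_ite_eq,
        Finset.sum_ite_eq, hcc]
      simp only [Finset.mem_range]
      by_cases d1 : x.card < k
      · rw [if_pos d1, if_neg (by omega)]
        ring
      · rw [if_neg d1]
        by_cases d2 : n - x.card < k
        · rw [if_pos d2, Nat.sub_sub_self hwn]
          ring
        · rw [if_neg d2, hc, hb k x.card le_rfl (by omega) (by omega) (by omega)]
          ring

theorem pdeg_final (M B : ℝ) (hM : 1 ≤ M) (hB : 0 ≤ B)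
    (base : ∀ L : ℕ, 10 ≤ L → Sim F n (80 * L) (M * (B * L)) ((1 / 2) ^ L))
    (k : ℕ) (hk : 1 ≤ k) (h : (Fin n → Bool) → Bool) (spec : ℕ → Bool)
    (hs : ∀ a, h a = spec (wt a))
    (hb : ∀ i j, k ≤ i → i + k ≤ n → k ≤ j → j + k ≤ n → spec i = spec j)
    (ε : ℝ) (hε : 0 < ε) (hε3 : ε < 1 / 3) :
    (pdeg F h ε : ℝ) ≤ (1200 + 12 * B) * M *
      (Real.sqrt (k * Real.logb 2 (1 / ε)) + Real.logb 2 (1 / ε)) := by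
  set l := Real.logb 2 (1 / ε) with hl
  have hl1 : 1 ≤ l := by
    rw [hl, Real.le_logb_iff_rpow_le (by norm_num) (by positivity), Real.rpow_one,
      le_div_iff₀ hε]
    linarith
  have h2l : (2 : ℝ) ^ l = 1 / ε := Real.rpow_logb (by norm_num) (by norm_num) (by positivity)
  set L := ⌈l⌉₊ + 10 with hL
  have hL1 : l ≤ (⌈l⌉₊ : ℝ) := Nat.le_ceil l
  have hL2 : (⌈l⌉₊ : ℝ) < l + 1 := Nat.ceil_lt_add_one (by linarith)
  have hLr : (L : ℝ) ≤ 12 * l := by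
    rw [hL]; push_cast; linarith
  have herr : 2 * (1 / 2 : ℝ) ^ L ≤ ε := by
    have e1 : 1 / ε ≤ (2 : ℝ) ^ ⌈l⌉₊ := by
      rw [← h2l, ← Real.rpow_natCast]
      exact Real.rpow_le_rpow_of_exponent_le (by norm_num) hL1
    have e2 : (1 / 2 : ℝ) ^ ⌈l⌉₊ ≤ ε := by
      rw [one_div, inv_pow]
      rw [one_div] at e1
      exact inv_le_of_inv_le₀ hε e1
    rw [hL, pow_add]
    norm_num at e2 ⊢
    have : 0 < ((1 : ℝ) / 2) ^ ⌈l⌉₊ := by positivity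
    norm_num at this
    linarith
  have hS := Sim.main M B hM hB base (3 * k) L (by omega)
  refine (pdeg_le_of_sim k hk hS herr (by positivity) h spec hs hb).trans ?_
  have hsq : Real.sqrt (((3 * k : ℕ) : ℝ) * L) ≤ 6 * Real.sqrt (k * l) := by
    apply Real.sqrt_le_iff.mpr
    refine ⟨by positivity, ?_⟩
    rw [mul_pow, Real.sq_sqrt (by positivity)]
    push_cast
    have : (0 : ℝ) ≤ k := by positivity
    nlinarith
  have hs0 := Real.sqrt_nonneg ((k : ℝ) * l)
  have key : (200 + B) * Real.sqrt (((3 * k : ℕ) : ℝ) * L) + B * L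
      ≤ (1200 + 12 * B) * (Real.sqrt (k * l) + l) := by
    have k1 := mul_le_mul_of_nonneg_left hsq (show 0 ≤ 200 + B by linarith)
    have k2 := mul_le_mul_of_nonneg_left hLr hB
    have k3 : 0 ≤ B * Real.sqrt (k * l) := by positivity
    nlinarith
  have := mul_le_mul_of_nonneg_left key (show 0 ≤ M by linarith)
  linarith

end helpers

/-- upper bound on the probabilistic degree of `k`-bounded
symmetric Boolean functions (`k ≥ 1`), over positive characteristic (i) and
characteristic 0 (ii). -/
theorem stmt4 :
    (∀ p : ℕ, p.Prime →
      ∃ C : ℝ, 0 < C ∧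
        ∀ (F : Type) [Field F] [CharP F p],
          ∀ n : ℕ, 1 ≤ n → ∀ k : ℕ, 1 ≤ k →
            ∀ (h : (Fin n → Bool) → Bool) (spec : ℕ → Bool),
              (∀ a, h a = spec (wt a)) →
              (∀ i j, k ≤ i → i + k ≤ n → k ≤ j → j + k ≤ n → spec i = spec j) →
              ∀ ε : ℝ, 0 < ε → ε < 1/3 →
                (pdeg F h ε : ℝ)
                  ≤ C * (Real.sqrt (k * Real.logb 2 (1/ε)) + Real.logb 2 (1/ε)))
    ∧
    (∃ C : ℝ, 0 < C ∧
      ∀ (F : Type) [Field F] [CharP F 0],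
        ∀ n : ℕ, 2 ≤ n → ∀ k : ℕ, 1 ≤ k →
          ∀ (h : (Fin n → Bool) → Bool) (spec : ℕ → Bool),
            (∀ a, h a = spec (wt a)) →
            (∀ i j, k ≤ i → i + k ≤ n → k ≤ j → j + k ≤ n → spec i = spec j) →
            ∀ ε : ℝ, 0 < ε → ε < 1/3 →
              (pdeg F h ε : ℝ)
                ≤ C * Real.logb 2 n *
                    (Real.sqrt (k * Real.logb 2 (1/ε)) + Real.logb 2 (1/ε))) := by
  constructor
  · intro p hp
    refine ⟨1200 + 12 * (600 * p), by positivity, ?_⟩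
    intro F _ _ n hn k hk h spec hs hb ε hε hε3
    have := pdeg_final (F := F) (n := n) 1 (600 * p) le_rfl (by positivity)
      (fun L hL => by simpa using basep (F := F) (n := n) p hp L hL) k hk h spec hs hb ε hε hε3
    simpa using this
  · refine ⟨(1200 + 12 * 1400) * 3, by norm_num, ?_⟩
    intro F _ _ n hn k hk h spec hs hb ε hε hε3
    have hr : n ≤ 2 ^ (Nat.log 2 n + 1) := (Nat.lt_pow_succ_log_self (by norm_num) n).le
    have hlog1 : (1 : ℝ) ≤ Real.logb 2 n := by
      have hn2 : (2 : ℝ) ≤ n := by exact_mod_cast hn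
      rw [Real.le_logb_iff_rpow_le (by norm_num) (by linarith), Real.rpow_one]
      exact hn2
    have hlog : ((Nat.log 2 n : ℕ) : ℝ) ≤ Real.logb 2 n := Real.natLog_le_logb n 2
    have hM : (((Nat.log 2 n + 1 : ℕ) : ℝ) + 1) ≤ 3 * Real.logb 2 n := by
      push_cast
      linarith
    have hfin := pdeg_final (F := F) (n := n) (3 * Real.logb 2 n) 1400 (by linarith) (by norm_num)
      (fun L hL => (base0 (F := F) (n := n) (Nat.log 2 n + 1) hr L hL).mono le_rfl
        (mul_le_mul_of_nonneg_right hM (by positivity)) le_rfl)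
      k hk h spec hs hb ε hε hε3
    calc (pdeg F h ε : ℝ) ≤ _ := hfin
      _ = _ := by ring
end
end

section
/- There is a constant c > 0 such that the following holds. Let F be a field of characteristic p (a prime or 0), n ≥ 2, and let f : {0,1}^n → {0,1} be a symmetric Boolean function with standard decomposition (g,h). For every ε ∈ [2^{−n}, 1/3]: (i) if per(g) > 1 and per(g) is not a power of p, then pdeg^F_ε(f) ≥ c·√(n·log(1/ε)) / (log n)^2; (ii) if per(g) > 1 and per(g) is a power of p, then pdeg^F_ε(f) ≥ c·min{ per(g), √(n·log(1/ε)) } / (log n)^2. -/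
noncomputable section

open scoped BigOperators

namespace PD

variable {K : Type} [Field K] {m : ℕ}

def chi (K : Type) [Field K] {m : ℕ} (S : Finset (Fin m)) : Finset (Fin m) → K :=
  fun x => if S ⊆ x then 1 else 0

def LD (K : Type) [Field K] (m k : ℕ) : Submodule K (Finset (Fin m) → K) :=
  Submodule.span K {g | ∃ S : Finset (Fin m), S.card ≤ k ∧ g = chi K S}

lemma chi_mem {S : Finset (Fin m)} {k : ℕ} (h : S.card ≤ k) : chi K S ∈ LD K m k :=
  Submodule.subset_span ⟨S, h, rfl⟩

lemma chi_mul (S T : Finset (Fin m)) : chi K S * chi K T = chi K (S ∪ T) := by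
  funext x
  simp only [chi, Pi.mul_apply, Finset.union_subset_iff]
  by_cases h1 : S ⊆ x <;> by_cases h2 : T ⊆ x <;> simp [h1, h2]

lemma LD_mono {k l : ℕ} (h : k ≤ l) : LD K m k ≤ LD K m l := by
  apply Submodule.span_mono
  rintro g ⟨S, hS, rfl⟩
  exact ⟨S, hS.trans h, rfl⟩

lemma LD_mul {k l : ℕ} {a b : Finset (Fin m) → K} (ha : a ∈ LD K m k) (hb : b ∈ LD K m l) :
    a * b ∈ LD K m (k + l) := by
  have h := Submodule.mul_mem_mul ha hb
  rw [LD, LD, Submodule.span_mul_span] at h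
  refine Submodule.span_mono ?_ h
  rintro _ ⟨_, ⟨S, hS, rfl⟩, _, ⟨T, hT, rfl⟩, rfl⟩
  exact ⟨S ∪ T, (Finset.card_union_le _ _).trans (by omega), chi_mul S T⟩

lemma one_mem : (1 : Finset (Fin m) → K) ∈ LD K m 0 := by
  have : (1 : Finset (Fin m) → K) = chi K ∅ := by funext x; simp [chi]
  rw [this]; exact chi_mem (by simp)

lemma LD_pow {k : ℕ} {a : Finset (Fin m) → K} (ha : a ∈ LD K m k) (e : ℕ) :
    a ^ e ∈ LD K m (e * k) := by
  induction e with
  | zero => simpa using one_mem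
  | succ e ih => rw [pow_succ, Nat.succ_mul]; exact LD_mul ih ha

lemma LD_prod {ι : Type} (s : Finset ι) (a : ι → Finset (Fin m) → K) (e : ι → ℕ)
    (h : ∀ i ∈ s, a i ∈ LD K m (e i)) : ∏ i ∈ s, a i ∈ LD K m (∑ i ∈ s, e i) := by
  classical
  induction s using Finset.induction_on with
  | empty => simpa using one_mem
  | insert i s hi ih =>
    rw [Finset.prod_insert hi, Finset.sum_insert hi]
    exact LD_mul (h i (by simp)) (ih fun j hj => h j (by simp [hj]))

lemma LD_poly {n d : ℕ} (P : MvPolynomial (Fin n) K) (hP : P.totalDegree ≤ d)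
    (y : Fin n → Finset (Fin m) → K) (hy : ∀ v, y v ∈ LD K m 1) :
    (fun x => MvPolynomial.eval (fun v => y v x) P) ∈ LD K m d := by
  have : (fun x => MvPolynomial.eval (fun v => y v x) P) =
      ∑ e ∈ P.support, P.coeff e • ∏ v, (y v) ^ (e v) := by
    funext x
    rw [MvPolynomial.eval_eq']
    simp [Finset.sum_apply, Finset.prod_apply]
  rw [this]
  refine Submodule.sum_mem _ fun e he => Submodule.smul_mem _ _ ?_
  refine LD_mono ?_ (LD_prod Finset.univ (fun v => y v ^ e v) (fun v => e v * 1)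
    fun v _ => LD_pow (hy v) _)
  refine le_trans ?_ ((MvPolynomial.le_totalDegree he).trans hP)
  simp [Finsupp.sum_fintype]

lemma LD_coeff {k : ℕ} {G : Finset (Fin m) → K} (hG : G ∈ LD K m k) :
    ∃ c : Finset (Fin m) → K, (∀ S, k < S.card → c S = 0) ∧
      ∀ x, G x = ∑ S, c S * chi K S x := by
  classical
  induction hG using Submodule.span_induction with
  | mem g hg =>
    obtain ⟨S, hS, rfl⟩ := hg
    refine ⟨fun T => if T = S then 1 else 0, fun T hT => ?_, fun x => ?_⟩
    · have : T ≠ S := by rintro rfl; omega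
      simp [this]
    · simp
  | zero => exact ⟨0, by simp, by simp⟩
  | add a b _ _ ha hb =>
    obtain ⟨c, hc, hc'⟩ := ha
    obtain ⟨d, hd, hd'⟩ := hb
    refine ⟨c + d, fun S hS => by simp [hc S hS, hd S hS], fun x => ?_⟩
    simp [hc', hd', add_mul, Finset.sum_add_distrib]
  | smul r a _ ha =>
    obtain ⟨c, hc, hc'⟩ := ha
    refine ⟨r • c, fun S hS => by simp [hc S hS], fun x => ?_⟩
    simp [hc', Finset.mul_sum, mul_assoc]

/-- alternating sum of a monomial over a cube not contained in the monomial. -/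
lemma alt_chi (U R y : Finset (Fin m)) (i : Fin m) (hi : i ∈ U) (hR : i ∉ R) :
    ∑ x ∈ U.powerset, (-1 : K) ^ x.card * chi K R (x ∪ y) = 0 := by
  classical
  obtain ⟨V, hV, rfl⟩ : ∃ V, i ∉ V ∧ U = insert i V := ⟨U.erase i, by simp, by simp [hi]⟩
  rw [Finset.sum_powerset_insert hV, ← Finset.sum_add_distrib]
  apply Finset.sum_eq_zero
  intro x hx
  have hix : i ∉ x := fun h => hV (Finset.mem_powerset.1 hx h)
  rw [Finset.card_insert_of_notMem hix]
  have : chi K R (insert i x ∪ y) = chi K R (x ∪ y) := by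
    unfold chi
    congr 1
    rw [Finset.insert_union, Finset.subset_insert_iff_of_notMem hR]
  rw [this]; ring

lemma alt_LD {k : ℕ} {T : Finset (Fin m) → K} (hT : T ∈ LD K m k) (U y : Finset (Fin m))
    (hU : k < U.card) : ∑ x ∈ U.powerset, (-1 : K) ^ x.card * T (x ∪ y) = 0 := by
  obtain ⟨c, hc, hc'⟩ := LD_coeff hT
  simp only [hc', Finset.mul_sum]
  rw [Finset.sum_comm]
  apply Finset.sum_eq_zero
  intro R _
  by_cases hR : k < R.card
  · simp [hc R hR]
  · obtain ⟨i, hi, hiR⟩ : ∃ i ∈ U, i ∉ R := by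
      by_contra! h
      have := Finset.card_le_card (show U ⊆ R from h)
      omega
    have := alt_chi (K := K) U R y i hi hiR
    calc _ = c R * ∑ x ∈ U.powerset, (-1 : K) ^ x.card * chi K R (x ∪ y) := by
          rw [Finset.mul_sum]; apply Finset.sum_congr rfl; intros; ring
      _ = 0 := by rw [this, mul_zero]

lemma top_coeff {k : ℕ} (c : Finset (Fin m) → K) (hc : ∀ S, k < S.card → c S = 0)
    (hne : c ≠ 0) :
    ∃ (S : Finset (Fin m)) (q : K), S.card ≤ k ∧ q ≠ 0 ∧ ∀ y, Disjoint S y →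
      ∑ x ∈ S.powerset, (-1 : K) ^ x.card * (∑ R, c R * chi K R (x ∪ y)) = q := by
  classical
  obtain ⟨S, hS, hmax⟩ := Finset.exists_max_image (Finset.univ.filter fun S => c S ≠ 0)
    Finset.card (by
      obtain ⟨S, hS⟩ := Function.ne_iff.1 hne
      exact ⟨S, by simpa using hS⟩)
  simp only [Finset.mem_filter, Finset.mem_univ, true_and] at hS hmax
  refine ⟨S, (-1) ^ S.card * c S, ?_, ?_, ?_⟩
  · by_contra h; exact hS (hc S (by omega))
  · exact mul_ne_zero (pow_ne_zero _ (by simp)) hS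
  · intro y hy
    simp only [Finset.mul_sum]
    rw [Finset.sum_comm, Finset.sum_eq_single S]
    · rw [Finset.sum_eq_single S]
      · simp [chi]
      · intro x hx hxS
        have hx' := Finset.mem_powerset.1 hx
        have : ¬ S ⊆ x ∪ y := fun h => hxS (Finset.Subset.antisymm hx' (hy.left_le_of_le_sup_right h))
        simp [chi, this]
      · simp
    · intro R _ hRS
      by_cases hcR : c R = 0
      · simp [hcR]
      · obtain ⟨i, hi, hiR⟩ : ∃ i ∈ S, i ∉ R := by
          by_contra! h
          exact hRS (Finset.eq_of_subset_of_card_le (show S ⊆ R from h) (hmax R hcR)).symm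
        calc _ = c R * ∑ x ∈ S.powerset, (-1 : K) ^ x.card * chi K R (x ∪ y) := by
              rw [Finset.mul_sum]; apply Finset.sum_congr rfl; intros; ring
          _ = 0 := by rw [alt_chi S R y i hi hiR, mul_zero]
    · simp

lemma top_LD {k : ℕ} {G : Finset (Fin m) → K} (hG : G ∈ LD K m k) (hne : G ≠ 0) :
    ∃ (S : Finset (Fin m)) (q : K), S.card ≤ k ∧ q ≠ 0 ∧ ∀ y, Disjoint S y →
      ∑ x ∈ S.powerset, (-1 : K) ^ x.card * G (x ∪ y) = q := by
  obtain ⟨c, hc, hc'⟩ := LD_coeff hG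
  have : c ≠ 0 := by
    rintro rfl
    exact hne (by funext x; simp [hc'])
  simpa only [hc'] using top_coeff c hc this

/-- a low degree function vanishing on enough consecutive layers is zero. -/
lemma interval {k w : ℕ} {G : Finset (Fin m) → K} (hG : G ∈ LD K m k) (hw : w + k ≤ m)
    (hz : ∀ x : Finset (Fin m), w ≤ x.card → x.card ≤ w + k → G x = 0) : G = 0 := by
  classical
  by_contra hne
  obtain ⟨S, q, hS, hq, h⟩ := top_LD hG hne
  obtain ⟨y, hy, hyc⟩ := Finset.exists_subset_card_eq (s := Sᶜ) (n := w) (by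
    rw [Finset.card_compl, Fintype.card_fin]; omega)
  have hd : Disjoint S y := (disjoint_compl_right (a := S)).mono_right hy
  apply hq
  rw [← h y hd]
  apply Finset.sum_eq_zero
  intro x hx
  have hx' := Finset.mem_powerset.1 hx
  have h1 : (x ∪ y).card = x.card + y.card := Finset.card_union_of_disjoint (hd.mono_left hx')
  have h2 := Finset.card_le_card hx'
  rw [hz _ (by omega) (by omega), mul_zero]

lemma geom {k l : ℕ} {Q T : Finset (Fin m) → K} (hQ : Q ∈ LD K m k) (hT : T ∈ LD K m l)
    (lam : K) (h0 : lam ≠ 0) (h1 : lam ≠ 1) (hT' : ∀ x, T x = Q x * lam ^ x.card)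
    (hkl : k + l < m) : Q = 0 := by
  classical
  by_contra hne
  obtain ⟨S, q, hS, hq, h⟩ := top_LD hQ hne
  have e1 : ∑ y ∈ Sᶜ.powerset, (-lam) ^ y.card *
      ∑ x ∈ S.powerset, (-1 : K) ^ x.card * Q (x ∪ y) = q * (1 - lam) ^ Sᶜ.card := by
    have : ∀ y ∈ Sᶜ.powerset, (-lam) ^ y.card *
      ∑ x ∈ S.powerset, (-1 : K) ^ x.card * Q (x ∪ y) = q * ((-lam) ^ y.card * 1 ^ (Sᶜ.card - y.card)) := by
      intro y hy
      rw [h y ((disjoint_compl_right (a := S)).mono_right (Finset.mem_powerset.1 hy))]; ring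
    rw [Finset.sum_congr rfl this, ← Finset.mul_sum, Finset.sum_pow_mul_eq_add_pow]
    ring
  have e2 : ∑ y ∈ Sᶜ.powerset, (-lam) ^ y.card *
      ∑ x ∈ S.powerset, (-1 : K) ^ x.card * Q (x ∪ y) = 0 := by
    simp only [Finset.mul_sum]
    rw [Finset.sum_comm]
    apply Finset.sum_eq_zero
    intro x hx
    have hz := alt_LD hT Sᶜ x (by rw [Finset.card_compl, Fintype.card_fin]; omega)
    calc _ = (-1 : K) ^ x.card * (lam⁻¹) ^ x.card *
          ∑ y ∈ Sᶜ.powerset, (-1 : K) ^ y.card * T (y ∪ x) := by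
          rw [Finset.mul_sum]
          apply Finset.sum_congr rfl
          intro y hy
          have hd : Disjoint x y := (disjoint_compl_right (a := S)).mono
            (Finset.mem_powerset.1 hx) (Finset.mem_powerset.1 hy)
          rw [hT', Finset.union_comm y x, Finset.card_union_of_disjoint hd, pow_add,
            show (-lam) ^ y.card = (-1) ^ y.card * lam ^ y.card by rw [← mul_pow]; simp]
          have : lam⁻¹ ^ x.card * lam ^ x.card = 1 := by
            rw [← mul_pow, inv_mul_cancel₀ h0, one_pow]
          linear_combination (-(-1 : K) ^ x.card * (-1) ^ y.card * Q (x ∪ y) * lam ^ y.card) * this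
      _ = 0 := by rw [hz, mul_zero]
  rw [e1] at e2
  exact mul_ne_zero hq (pow_ne_zero _ (sub_ne_zero.2 h1.symm)) e2

/-- A nonzero polynomial of degree at most `k` vanishing on a small set. -/
lemma exists_vanish {k : ℕ} (E : Finset (Finset (Fin m)))
    (hE : E.card < (Finset.univ.filter fun S : Finset (Fin m) => S.card ≤ k).card) :
    ∃ Q ∈ LD K m k, Q ≠ 0 ∧ ∀ x ∈ E, Q x = 0 := by
  classical
  let B := {S : Finset (Fin m) // S.card ≤ k}
  let Φ : (B → K) →ₗ[K] (E → K) :=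
    { toFun := fun c x => ∑ S, c S * chi K S.1 x.1
      map_add' := by intro a b; funext x; simp [add_mul, Finset.sum_add_distrib]
      map_smul' := by intro a b; funext x; simp [Finset.mul_sum, mul_assoc] }
  have hlt : Module.finrank K (E → K) < Module.finrank K (B → K) := by
    rw [Module.finrank_fintype_fun_eq_card, Module.finrank_fintype_fun_eq_card, Fintype.card_coe,
      Fintype.card_subtype]
    exact hE
  obtain ⟨c, hc, hne⟩ := Submodule.exists_mem_ne_zero_of_ne_bot
    (LinearMap.ker_ne_bot_of_finrank_lt (f := Φ) hlt)
  let c' : Finset (Fin m) → K := fun S => if h : S.card ≤ k then c ⟨S, h⟩ else 0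
  have hsum : ∀ x, ∑ S, c' S * chi K S x = ∑ S : B, c S * chi K S.1 x := by
    intro x
    have e1 : ∑ S : B, c S * chi K S.1 x = ∑ S : B, c' S.1 * chi K S.1 x := by
      apply Finset.sum_congr rfl
      intro S _
      have : c' S.1 = c S := by simp only [c', dif_pos S.2]; rfl
      rw [this]
    rw [e1, ← Finset.sum_subtype (Finset.univ.filter fun S : Finset (Fin m) => S.card ≤ k)
      (by simp) (fun S => c' S * chi K S x)]
    symm
    apply Finset.sum_subset (Finset.filter_subset _ _)
    intro S _ hS
    have : ¬ S.card ≤ k := by simpa using hS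
    simp [c', this]
  refine ⟨fun x => ∑ S, c' S * chi K S x, ?_, ?_, ?_⟩
  · have : (fun x => ∑ S, c' S * chi K S x) = ∑ S, c' S • chi K S := by
      funext x; simp [Finset.sum_apply]
    rw [this]
    refine Submodule.sum_mem _ fun S _ => ?_
    by_cases h : S.card ≤ k
    · exact Submodule.smul_mem _ _ (chi_mem h)
    · simp [c', h]
  · intro h0
    have hc' : c' ≠ 0 := by
      obtain ⟨S, hS⟩ := Function.ne_iff.1 hne
      refine Function.ne_iff.2 ⟨S.1, ?_⟩
      have : c' S.1 = c S := by simp only [c', dif_pos S.2]; rfl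
      rw [this]; exact hS
    obtain ⟨S, q, -, hq, h⟩ := top_coeff (k := k) c' (fun S hS => by simp [c', not_le.2 hS]) hc'
    apply hq
    rw [← h ∅ (by simp)]
    apply Finset.sum_eq_zero
    intro x _
    rw [congrFun h0 (x ∪ ∅)]; simp
  · intro x hx
    have := congrFun (LinearMap.mem_ker.1 hc) ⟨x, hx⟩
    simp only [hsum]
    simpa [Φ] using this
end PD

namespace PD
open Polynomial

section word
variable {K : Type} [Field K]

def shE (K : Type) [Field K] : (ℕ → K) →ₗ[K] (ℕ → K) :=
  { toFun := fun f i => f (i + 1)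
    map_add' := by intros; rfl
    map_smul' := by intros; rfl }

def ap (c : K[X]) (f : ℕ → K) : ℕ → K := Polynomial.aeval (shE K) c f

lemma shE_pow (j : ℕ) (f : ℕ → K) (i : ℕ) : ((shE K) ^ j) f i = f (i + j) := by
  induction j generalizing i with
  | zero => rfl
  | succ j ih =>
    rw [pow_succ']
    show ((shE K) ^ j) f (i + 1) = _
    rw [ih]; congr 1; omega

lemma ap_apply (c : K[X]) (f : ℕ → K) (i : ℕ) :
    ap c f i = ∑ j ∈ Finset.range (c.natDegree + 1), c.coeff j * f (i + j) := by
  unfold ap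
  rw [Polynomial.aeval_eq_sum_range]
  simp [Finset.sum_apply, LinearMap.sum_apply, shE_pow]

lemma ap_mul (a b : K[X]) (f : ℕ → K) : ap (a * b) f = ap a (ap b f) := by
  simp [ap]

lemma ap_sub (a b : K[X]) (f : ℕ → K) (i : ℕ) : ap (a - b) f i = ap a f i - ap b f i := by
  simp [ap]

lemma ap_one (f : ℕ → K) : ap (1 : K[X]) f = f := by
  simp [ap]

lemma ap_C (a : K) (f : ℕ → K) (i : ℕ) : ap (C a) f i = a * f i := by
  simp [ap]

lemma ap_Xpow (q : ℕ) (f : ℕ → K) (i : ℕ) : ap (X ^ q : K[X]) f i = f (i + q) := by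
  simp [ap, shE_pow]

lemma ap_X (f : ℕ → K) (i : ℕ) : ap (X : K[X]) f i = f (i + 1) := by
  simpa using ap_Xpow 1 f i

lemma ap_local (c : K[X]) (g : ℕ → K) (i : ℕ) (h : ∀ j, j ≤ c.natDegree → g (i + j) = 0) :
    ap c g i = 0 := by
  rw [ap_apply]
  apply Finset.sum_eq_zero
  intro j hj
  rw [h j (by simpa [Nat.lt_succ_iff] using hj), mul_zero]

lemma exists_ann (f : ℕ → K) (s u : ℕ) :
    ∃ c : K[X], c ≠ 0 ∧ c.natDegree ≤ u ∧ ∀ i, s ≤ i → i < s + u → ap c f i = 0 := by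
  let Φ : (Polynomial.degreeLT K (u + 1)) →ₗ[K] (Fin u → K) :=
    { toFun := fun c i => ap c.1 f (s + i)
      map_add' := by intro a b; funext x; simp [ap]
      map_smul' := by intro a b; funext x; simp [ap] }
  have hlt : Module.finrank K (Fin u → K) < Module.finrank K (Polynomial.degreeLT K (u + 1)) := by
    rw [Module.finrank_fintype_fun_eq_card, LinearEquiv.finrank_eq (Polynomial.degreeLTEquiv K (u+1)),
      Module.finrank_fintype_fun_eq_card]
    simp
  obtain ⟨c, hc, hne⟩ := Submodule.exists_mem_ne_zero_of_ne_bot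
    (LinearMap.ker_ne_bot_of_finrank_lt (f := Φ) hlt)
  refine ⟨c.1, by simpa using hne, ?_, ?_⟩
  · have := Polynomial.mem_degreeLT.1 c.2
    have := (Polynomial.natDegree_lt_iff_degree_lt (by simpa using hne)).2 this
    omega
  · intro i h1 h2
    have := congrFun (LinearMap.mem_ker.1 hc) ⟨i - s, by omega⟩
    have e : s + (i - s) = i := by omega
    simpa [Φ, e] using this

theorem dich [IsAlgClosed K] (f : ℕ → K) (s e u : ℕ) (hu : 1 ≤ u) (hL : s + 4 * u ≤ e) :
    (∃ (c : K[X]) (i0 : ℕ), c.natDegree ≤ u ∧ s + u ≤ i0 ∧ i0 + c.natDegree ≤ e ∧ ap c f i0 ≠ 0 ∧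
      ∀ i, i0 ≤ i + u → i < i0 → ap c f i = 0) ∨
    (∃ (c : K[X]) (i0 : ℕ), c.natDegree ≤ u ∧ s ≤ i0 ∧ i0 + u + c.natDegree ≤ e ∧ ap c f i0 ≠ 0 ∧
      ∀ i, i0 < i → i ≤ i0 + u → ap c f i = 0) ∨
    (∃ (c : K[X]) (lam κ : K), c.natDegree ≤ u ∧ lam ≠ 0 ∧ lam ≠ 1 ∧ κ ≠ 0 ∧
      ∀ i, s ≤ i → i + u ≤ e → ap c f i = κ * lam ^ i) ∨
    (∃ r, r ≤ u ∧ ∀ i, s ≤ i → i + r ≤ e → ap ((X - C 1) ^ r) f i = 0) := by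
  classical
  by_cases hA : ∃ (c : K[X]) (i0 : ℕ), c.natDegree ≤ u ∧ s + u ≤ i0 ∧ i0 + c.natDegree ≤ e ∧
      ap c f i0 ≠ 0 ∧ ∀ i, i0 ≤ i + u → i < i0 → ap c f i = 0
  · exact Or.inl hA
  by_cases hA' : ∃ (c : K[X]) (i0 : ℕ), c.natDegree ≤ u ∧ s ≤ i0 ∧ i0 + u + c.natDegree ≤ e ∧
      ap c f i0 ≠ 0 ∧ ∀ i, i0 < i → i ≤ i0 + u → ap c f i = 0
  · exact Or.inr (Or.inl hA')
  right; right
  push Not at hA hA'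
  have H : ∀ c : K[X], c.natDegree ≤ u → ∀ j, s ≤ j → j + u + c.natDegree ≤ e + 1 →
      (∀ i, j ≤ i → i < j + u → ap c f i = 0) → ∀ i, s ≤ i → i + c.natDegree ≤ e → ap c f i = 0 := by
    intro c hc j hj hje hz
    have right : ∀ i, j ≤ i → i + c.natDegree ≤ e → ap c f i = 0 := by
      intro i
      induction i using Nat.strong_induction_on with
      | _ i ih =>
        intro h1 h2
        by_cases h3 : i < j + u
        · exact hz i h1 h3
        · by_contra hne
          obtain ⟨k, hk1, hk2, hk3⟩ := hA c i hc (by omega) h2 hne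
          exact hk3 (ih k hk2 (by omega) (by omega))
    have left : ∀ t i, i + t = j → s ≤ i → ap c f i = 0 := by
      intro t
      induction t using Nat.strong_induction_on with
      | _ t ih =>
        intro i hit h1
        by_cases h3 : t = 0
        · exact right i (by omega) (by omega)
        · by_contra hne
          obtain ⟨k, hk1, hk2, hk3⟩ := hA' c i hc h1 (by omega) hne
          by_cases hkj : k < j
          · exact hk3 (ih (j - k) (by omega) k (by omega) (by omega))
          · exact hk3 (right k (by omega) (by omega))
    intro i h1 h2
    by_cases h3 : j ≤ i
    · exact right i h3 h2
    · exact left (j - i) i (by omega) h1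
  obtain ⟨c0, hc0, hc0d, hc0z⟩ := exists_ann f s u
  have hex : ∃ r, ∃ c : K[X], c ≠ 0 ∧ c.natDegree = r ∧ r ≤ u ∧
      ∀ i, s ≤ i → i + r ≤ e → ap c f i = 0 :=
    ⟨c0.natDegree, c0, hc0, rfl, hc0d, H c0 hc0d s le_rfl (by omega) hc0z⟩
  obtain ⟨c, hc, hcr, hru, hz⟩ := Nat.find_spec hex
  have hmin := fun t (ht : t < Nat.find hex) => Nat.find_min hex ht
  generalize Nat.find hex = r at *
  obtain ⟨q, hq, hqd⟩ := Polynomial.exists_eq_pow_rootMultiplicity_mul_and_not_dvd c hc 1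
  generalize Polynomial.rootMultiplicity 1 c = t at hq
  have hq0 : q ≠ 0 := by rintro rfl; exact hc (by rw [hq, mul_zero])
  by_cases hdeg : q.degree = 0
  · right
    obtain ⟨a, ha⟩ : ∃ a, q = C a := ⟨_, Polynomial.eq_C_of_degree_eq_zero hdeg⟩
    have ha0 : a ≠ 0 := by rintro rfl; exact hq0 (by rw [ha, C_0])
    have htr : t = r := by
      rw [← hcr, hq, ha, Polynomial.natDegree_mul (pow_ne_zero _ (X_sub_C_ne_zero 1)) (C_ne_zero.2 ha0),
        natDegree_pow, natDegree_X_sub_C, natDegree_C]; omega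
    refine ⟨r, hru, fun i h1 h2 => ?_⟩
    have := hz i h1 h2
    rw [hq, mul_comm, ap_mul, ha, ap_C, htr] at this
    exact (mul_eq_zero.1 this).resolve_left ha0
  · left
    obtain ⟨lam, hlam⟩ := IsAlgClosed.exists_root q hdeg
    have h1 : lam ≠ 1 := by
      rintro rfl; exact hqd (dvd_iff_isRoot.2 hlam)
    obtain ⟨q2, hq2⟩ := dvd_iff_isRoot.2 hlam
    obtain ⟨c2, hc2⟩ : ∃ c2, c = (X - C lam) * c2 := ⟨(X - C 1) ^ t * q2, by rw [hq, hq2]; ring⟩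
    have hc20 : c2 ≠ 0 := by rintro rfl; exact hc (by rw [hc2, mul_zero])
    have hd2 : c2.natDegree + 1 = r := by
      rw [← hcr, hc2, natDegree_mul (X_sub_C_ne_zero _) hc20, natDegree_X_sub_C]; omega
    have hrec : ∀ i, s ≤ i → i + r ≤ e → ap c2 f (i + 1) = lam * ap c2 f i := by
      intro i h1 h2
      have := hz i h1 h2
      rw [hc2, ap_mul, ap_sub, ap_X, ap_C] at this
      exact sub_eq_zero.1 this
    have hnz : ¬ ∀ i, s ≤ i → i + c2.natDegree ≤ e → ap c2 f i = 0 := fun h =>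
      hmin c2.natDegree (by omega) ⟨c2, hc20, rfl, by omega, h⟩
    have hlam0 : lam ≠ 0 := by
      rintro rfl
      apply hnz
      apply H c2 (by omega) (s + 1) (by omega) (by omega)
      intro i h1 h2
      obtain ⟨i', rfl⟩ : ∃ i', i = i' + 1 := ⟨i - 1, by omega⟩
      rw [hrec i' (by omega) (by omega), zero_mul]
    have hgeo : ∀ k, s + k + c2.natDegree ≤ e → ap c2 f (s + k) = ap c2 f s * lam ^ k := by
      intro k
      induction k with
      | zero => simp
      | succ k ih =>
        intro hk
        rw [← add_assoc, hrec (s + k) (by omega) (by omega), ih (by omega)]; ring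
    have hs0 : ap c2 f s ≠ 0 := by
      intro h0
      apply hnz
      intro i h1 h2
      obtain ⟨k, rfl⟩ := Nat.exists_eq_add_of_le h1
      rw [hgeo k h2, h0, zero_mul]
    refine ⟨c2, lam, ap c2 f s * (lam⁻¹) ^ s, by omega, hlam0, h1,
      mul_ne_zero hs0 (pow_ne_zero _ (inv_ne_zero hlam0)), ?_⟩
    intro i h1 h2
    obtain ⟨k, rfl⟩ := Nat.exists_eq_add_of_le h1
    rw [hgeo k (by omega), pow_add]
    have : lam⁻¹ ^ s * lam ^ s = 1 := by
      rw [← mul_pow, inv_mul_cancel₀ hlam0, one_pow]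
    linear_combination (-ap c2 f s * lam ^ k) * this

lemma block (h : ℕ → K) (a : ℕ)
    (hinj : ∀ i j : ℕ, i ≤ 2 * a → j ≤ 2 * a → (i : K) = j → i = j)
    (h01 : ∀ k, k ≤ 2 * a → h k = 0 ∨ h k = 1)
    (hrec : ∀ k, k + a + 1 ≤ 2 * a → ((fwdDiff (1 : ℕ))^[a + 1] h) k = 0) :
    ∀ k, k ≤ 2 * a → h k = h 0 := by
  classical
  let G : K[X] := Lagrange.interpolate (Finset.range (a + 1)) (fun i : ℕ => (i : K)) h
  have hvs : Set.InjOn (fun i : ℕ => (i : K)) (Finset.range (a + 1)) := by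
    intro i hi j hj hij
    simp at hi hj
    exact hinj i j (by omega) (by omega) hij
  have hGd : G.degree < ((a + 1 : ℕ) : WithBot ℕ) := by
    have := Lagrange.degree_interpolate_lt (s := Finset.range (a + 1)) h hvs
    rwa [Finset.card_range] at this
  have hGn : G.natDegree < a + 1 := by
    by_cases hG0 : G = 0
    · simp [hG0]
    · exact (natDegree_lt_iff_degree_lt hG0).2 hGd
  have hGe : ∀ k, k ≤ 2 * a → G.eval (k : K) = h k := by
    intro k
    induction k using Nat.strong_induction_on with
    | _ k ih =>
      intro hk
      by_cases hka : k < a + 1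
      · exact Lagrange.eval_interpolate_at_node h hvs (by simpa using hka)
      · obtain ⟨j, rfl⟩ : ∃ j, k = j + (a + 1) := ⟨k - (a + 1), by omega⟩
        have e1 := hrec j (by omega)
        have e2 := congrFun (Polynomial.fwdDiff_iter_eq_zero_of_degree_lt hGn) (j : K)
        rw [fwdDiff_iter_eq_sum_shift, Finset.sum_range_succ] at e1 e2
        simp only [Pi.zero_apply] at e2
        rw [← e1] at e2
        have e3 : ∀ i ∈ Finset.range (a + 1),
            ((-1 : ℤ) ^ (a + 1 - i) * ((a + 1).choose i : ℤ)) • G.eval ((j : K) + i • 1) =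
            ((-1 : ℤ) ^ (a + 1 - i) * ((a + 1).choose i : ℤ)) • h (j + i • 1) := by
          intro i hi
          have hi' := Finset.mem_range.1 hi
          have := ih (j + i) (by omega) (by omega)
          push_cast at this
          simp [this]
        rw [Finset.sum_congr rfl e3] at e2
        have e4 := add_left_cancel e2
        simpa using e4
  -- a majority value
  obtain ⟨v, hv⟩ : ∃ v : K, a + 1 ≤ ((Finset.range (2 * a + 1)).filter fun k => h k = v).card := by
    by_contra! hcon
    have h0 := hcon 0
    have h1 := hcon 1
    have : (Finset.range (2 * a + 1)) ⊆ ((Finset.range (2 * a + 1)).filter fun k => h k = 0) ∪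
        ((Finset.range (2 * a + 1)).filter fun k => h k = 1) := by
      intro k hk
      have := h01 k (by have := Finset.mem_range.1 hk; omega)
      simp only [Finset.mem_union, Finset.mem_filter]
      tauto
    have := (Finset.card_le_card this).trans (Finset.card_union_le _ _)
    rw [Finset.card_range] at this
    omega
  have hGv : G - C v = 0 := by
    refine Polynomial.eq_zero_of_degree_lt_of_eval_index_eq_zero
      (s := (Finset.range (2 * a + 1)).filter fun k => h k = v) (v := fun i : ℕ => (i : K)) ?_ ?_ ?_
    · intro i hi j hj hij
      simp at hi hj
      exact hinj i j (by omega) (by omega) hij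
    · refine lt_of_lt_of_le ?_ (Nat.cast_le.2 hv)
      refine lt_of_le_of_lt (degree_sub_le _ _) (max_lt hGd ?_)
      exact lt_of_le_of_lt degree_C_le (by exact_mod_cast Nat.succ_pos a)
    · intro i hi
      simp at hi
      rw [eval_sub, eval_C, hGe i (by omega), hi.2, sub_self]
  have hall : ∀ k, k ≤ 2 * a → h k = v := by
    intro k hk
    rw [← hGe k hk, sub_eq_zero.1 hGv, eval_C]
  intro k hk
  rw [hall k hk, hall 0 (by omega)]

lemma fwd_ap (f : ℕ → K) (q i N k : ℕ) :
    ((fwdDiff (1 : ℕ))^[N] (fun k => f (i + k * q))) k = ap ((X ^ q - 1) ^ N) f (i + k * q) := by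
  induction N generalizing f with
  | zero => simp [ap_one]
  | succ N ih =>
    rw [Function.iterate_succ_apply, pow_succ, ap_mul, ← ih]
    have : fwdDiff (1 : ℕ) (fun k => f (i + k * q)) = fun k => ap (X ^ q - 1) f (i + k * q) := by
      funext k
      rw [ap_sub, ap_Xpow, ap_one]
      simp only [fwdDiff]
      congr 2; ring
    rw [this]

lemma per_q (f : ℕ → K) (s e q a : ℕ) (ha : 1 ≤ a)
    (hinj : ∀ i j : ℕ, i ≤ 2 * a → j ≤ 2 * a → (i : K) = j → i = j)
    (h01 : ∀ i, s ≤ i → i ≤ e → f i = 0 ∨ f i = 1)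
    (hK : ∀ i, s ≤ i → i + (a + 1) * q ≤ e → ap ((X ^ q - 1) ^ (a + 1)) f i = 0)
    (hL : s + 4 * (a * q) ≤ e) : ∀ i, s ≤ i → i + q ≤ e → f i = f (i + q) := by
  have key : ∀ i, s ≤ i → i + 2 * a * q ≤ e → ∀ k, k ≤ 2 * a → f (i + k * q) = f i := by
    intro i h1 h2 k hk
    have := block (fun k => f (i + k * q)) a hinj (fun k hk => h01 _ (by nlinarith) (by nlinarith))
      (fun k hk => by
        rw [fwd_ap]
        apply hK _ (by nlinarith)
        have : (k + (a + 1)) * q ≤ 2 * a * q := Nat.mul_le_mul_right _ (by omega)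
        nlinarith) k hk
    simpa using this
  intro i h1 h2
  have haq : q ≤ a * q := Nat.le_mul_of_pos_left q ha
  by_cases h3 : i + 2 * a * q ≤ e
  · have := key i h1 h3 1 (by omega)
    rw [one_mul] at this; exact this.symm
  · have e0 : 2 * a * q = 2 * (a * q) := by ring
    have hle : s + 2 * (a * q) ≤ i + q := by omega
    obtain ⟨j, hj⟩ := Nat.exists_eq_add_of_le hle
    have k1 := key (s + j) (by omega) (by omega) (2 * a) le_rfl
    have k2 := key (s + j) (by omega) (by omega) (2 * a - 1) (by omega)
    have e1 : s + j + 2 * a * q = i + q := by omega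
    have e2 : s + j + (2 * a - 1) * q = i := by
      have : (2 * a - 1) * q + q = 2 * a * q := by
        rw [← Nat.succ_mul]; congr 1; omega
      omega
    rw [e1] at k1; rw [e2] at k2; rw [k1, k2]

lemma unip (p : ℕ) [CharP K p] (hp : p = 0 ∨ p.Prime) (f : ℕ → K) (s e r : ℕ)
    (h01 : ∀ i, s ≤ i → i ≤ e → f i = 0 ∨ f i = 1)
    (hr : ∀ i, s ≤ i → i + r ≤ e → ap ((X - C 1) ^ r) f i = 0)
    (hL : s + 8 * r ≤ e) :
    ∃ B, 1 ≤ B ∧ B ≤ 2 * r + 1 ∧ (B = 1 ∨ ∃ t, p.Prime ∧ B = p ^ t) ∧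
      ∀ i, s ≤ i → i + B ≤ e → f i = f (i + B) := by
  have hext : ∀ N, r ≤ N → ∀ i, s ≤ i → i + N ≤ e → ap ((X - C 1) ^ N) f i = 0 := by
    intro N hN i h1 h2
    obtain ⟨t, rfl⟩ := Nat.exists_eq_add_of_le hN
    rw [add_comm, pow_add, ap_mul]
    apply ap_local
    intro j hj
    rw [natDegree_pow, natDegree_X_sub_C] at hj
    exact hr _ (by omega) (by omega)
  by_cases hr2 : r < 2
  · refine ⟨1, le_rfl, by omega, Or.inl rfl, fun i h1 h2 => ?_⟩
    have := hext 1 (by omega) i h1 h2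
    rw [pow_one, ap_sub, ap_X, ap_C, one_mul] at this
    exact (sub_eq_zero.1 this).symm
  rcases hp with rfl | hp
  · have : CharZero K := CharP.charP_to_charZero K
    refine ⟨1, le_rfl, by omega, Or.inl rfl, ?_⟩
    refine per_q f s e 1 (r - 1) (by omega) (fun i j _ _ h => by exact_mod_cast h) h01 ?_ (by omega)
    intro i h1 h2
    have e1 : r - 1 + 1 = r := by omega
    rw [e1] at h2 ⊢
    have := hr i h1 (by omega)
    simpa using this
  · have : Fact p.Prime := ⟨hp⟩
    have hτ : 0 < Nat.clog p r := Nat.clog_pos hp.one_lt (by omega)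
    have hlt : p ^ (Nat.clog p r - 1) < r := Nat.pow_pred_clog_lt_self hp.one_lt (by omega)
    have hle : r ≤ p ^ (Nat.clog p r) := Nat.le_pow_clog hp.one_lt r
    obtain ⟨τ, hτ'⟩ : ∃ τ, Nat.clog p r = τ + 1 := ⟨Nat.clog p r - 1, by omega⟩
    rw [hτ'] at hlt hle
    simp only [Nat.add_sub_cancel] at hlt
    have hfrob : ∀ t, (X - C 1 : K[X]) ^ (p ^ t) = X ^ (p ^ t) - 1 := by
      intro t
      rw [sub_pow_char_pow]; simp
    have hqpos : 0 < p ^ τ := pow_pos hp.pos _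
    have hpq : p ^ (τ + 1) = p * p ^ τ := pow_succ' p τ
    generalize hq : p ^ τ = q at *
    set a := (r - 1) / q with ha
    have ha1 : 1 ≤ a := by rw [ha, Nat.one_le_div_iff hqpos]; omega
    have ha2 : a * q ≤ r - 1 := Nat.div_mul_le_self _ _
    have ha3 : r ≤ (a + 1) * q := by
      have := Nat.lt_div_mul_add (a := r - 1) hqpos
      rw [← ha] at this
      rw [add_mul, one_mul]; omega
    by_cases hap : 2 * a + 1 ≤ p
    · refine ⟨q, hqpos, by omega, Or.inr ⟨τ, hp, hq.symm⟩, ?_⟩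
      refine per_q f s e q a ha1 ?_ h01 ?_ (by omega)
      · intro i j hi hj hij
        have := (CharP.natCast_eq_natCast K p).1 hij
        rw [Nat.ModEq, Nat.mod_eq_of_lt (by omega), Nat.mod_eq_of_lt (by omega)] at this
        exact this
      · intro i h1 h2
        rw [← hq, ← hfrob, ← pow_mul, hq, mul_comm q]
        exact hext _ ha3 i h1 h2
    · have hb : p * q ≤ 2 * r := by
        have : p * q ≤ 2 * a * q := Nat.mul_le_mul_right _ (by omega)
        rw [mul_assoc] at this; omega
      refine ⟨p * q, Nat.mul_pos hp.pos hqpos, by omega, Or.inr ⟨τ + 1, hp, hpq.symm⟩, ?_⟩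
      intro i h1 h2
      have := hext (p ^ (τ + 1)) hle i h1 (by omega)
      rw [hfrob, ap_sub, ap_Xpow, ap_one, hpq] at this
      exact (sub_eq_zero.1 this).symm

end word
end PD

namespace PD

lemma choose_lower (μ h : ℕ) (hμ : 1 ≤ μ) (h4 : 4 * h ≤ μ) :
    (4 : ℝ) ^ μ / (2 * μ + 1) * Real.exp (-(4 * (h : ℝ) ^ 2 / μ)) ≤ (2 * μ).choose (μ - h) := by
  have hμ' : (0 : ℝ) < μ := by exact_mod_cast hμ
  have base : (4 : ℝ) ^ μ / (2 * μ + 1) ≤ (2 * μ).choose μ := by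
    rw [div_le_iff₀ (by positivity)]
    have := Nat.four_pow_le_two_mul_add_one_mul_central_binom μ
    have h2 : ((4 ^ μ : ℕ) : ℝ) ≤ ((2 * μ + 1) * (2 * μ).choose μ : ℕ) := by exact_mod_cast this
    push_cast at h2
    linarith
  have step : ∀ j, j ≤ h → (4 : ℝ) ^ μ / (2 * μ + 1) * Real.exp (-(4 * (h : ℝ) / μ)) ^ j ≤
      (2 * μ).choose (μ - j) := by
    intro j
    induction j with
    | zero => intro _; simpa using base
    | succ j ih =>
      intro hj
      have ih' := ih (by omega)
      have e1 := Nat.choose_succ_right_eq (2 * μ) (μ - (j + 1))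
      have e2 : μ - (j + 1) + 1 = μ - j := by omega
      have e3 : 2 * μ - (μ - (j + 1)) = μ + j + 1 := by omega
      rw [e2, e3] at e1
      have e4 : (((2 * μ).choose (μ - j) : ℕ) : ℝ) * ((μ : ℝ) - j) =
          ((2 * μ).choose (μ - (j + 1)) : ℕ) * ((μ : ℝ) + j + 1) := by
        have : (((2 * μ).choose (μ - j) * (μ - j) : ℕ) : ℝ) =
          ((2 * μ).choose (μ - (j + 1)) * (μ + j + 1) : ℕ) := by exact_mod_cast e1
        rw [Nat.cast_mul, Nat.cast_sub (by omega)] at this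
        push_cast at this ⊢
        exact this
      have hjR : (j : ℝ) + 1 ≤ h := by exact_mod_cast hj
      have h4R : 4 * (h : ℝ) ≤ μ := by exact_mod_cast h4
      have hexp : Real.exp (-(4 * (h : ℝ) / μ)) * ((μ : ℝ) + j + 1) ≤ (μ : ℝ) - j := by
        set t : ℝ := 2 * h / μ with ht
        have ht0 : 0 ≤ t := by positivity
        have ht1 : t ≤ 1 / 2 := by rw [ht, div_le_iff₀ hμ']; linarith
        have hlog : -(2 * t) ≤ Real.log (1 - t) := by
          have := Real.one_sub_inv_le_log_of_pos (show (0 : ℝ) < 1 - t by linarith)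
          refine le_trans ?_ this
          have : (1 - t)⁻¹ ≤ 1 + 2 * t := by
            rw [inv_le_iff_one_le_mul₀ (by linarith)]
            nlinarith
          linarith
        have h5 : Real.exp (-(2 * t)) ≤ 1 - t := by
          rw [← Real.exp_log (show (0 : ℝ) < 1 - t by linarith)]
          exact Real.exp_le_exp.2 hlog
        have h6 : -(4 * (h : ℝ) / μ) = -(2 * t) := by rw [ht]; ring
        rw [h6]
        have h7 : t * μ = 2 * h := by rw [ht]; field_simp
        calc Real.exp (-(2 * t)) * ((μ : ℝ) + j + 1) ≤ (1 - t) * ((μ : ℝ) + j + 1) :=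
              mul_le_mul_of_nonneg_right h5 (by positivity)
          _ ≤ (μ : ℝ) - j := by nlinarith
      have hpos : (0 : ℝ) < (μ : ℝ) + j + 1 := by positivity
      have h8 : (((2 * μ).choose (μ - j) : ℕ) : ℝ) * Real.exp (-(4 * (h : ℝ) / μ)) ≤
          ((2 * μ).choose (μ - (j + 1)) : ℕ) := by
        refine le_of_mul_le_mul_right ?_ hpos
        rw [← e4, mul_assoc]
        exact mul_le_mul_of_nonneg_left hexp (by positivity)
      refine le_trans ?_ h8
      rw [pow_succ, ← mul_assoc]
      exact mul_le_mul_of_nonneg_right ih' (Real.exp_pos _).le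
  have := step h le_rfl
  rw [← Real.exp_nat_mul] at this
  convert this using 3
  ring

lemma outside_upper (μ t : ℕ) (hμ : 1 ≤ μ) :
    (((Finset.univ : Finset (Finset (Fin (2 * μ)))).filter
      fun x => x.card + t < μ ∨ μ + t < x.card).card : ℝ) ≤
      2 * 4 ^ μ * Real.exp (-((t : ℝ) ^ 2 / μ)) := by
  have hμ' : (0 : ℝ) < μ := by exact_mod_cast hμ
  set s : ℝ := t / μ with hs
  have hs0 : 0 ≤ s := by positivity
  have sum1 : ∀ s : ℝ, ∑ x : Finset (Fin (2 * μ)), Real.exp (s * (2 * x.card - 2 * μ)) ≤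
      4 ^ μ * Real.exp (μ * s ^ 2) := by
    intro s
    have e1 := Fintype.sum_pow_mul_eq_add_pow (Fin (2 * μ)) (Real.exp s) (Real.exp (-s))
    rw [Fintype.card_fin] at e1
    have e2 : ∀ x : Finset (Fin (2 * μ)), Real.exp (s * (2 * x.card - 2 * μ)) =
        Real.exp s ^ x.card * Real.exp (-s) ^ (2 * μ - x.card) := by
      intro x
      have hx : x.card ≤ 2 * μ := by simpa using Finset.card_le_univ x
      rw [← Real.exp_nat_mul, ← Real.exp_nat_mul, ← Real.exp_add, Nat.cast_sub hx]
      congr 1; push_cast; ring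
    rw [Finset.sum_congr rfl fun x _ => e2 x, e1]
    have e3 : Real.exp s + Real.exp (-s) = 2 * Real.cosh s := by rw [Real.cosh_eq]; ring
    rw [e3, pow_mul, mul_pow, mul_pow]
    have e4 : Real.cosh s ^ 2 ≤ Real.exp (s ^ 2) := by
      have := Real.cosh_le_exp_half_sq s
      calc Real.cosh s ^ 2 ≤ Real.exp (s ^ 2 / 2) ^ 2 :=
            pow_le_pow_left₀ (Real.cosh_pos s).le this 2
        _ = Real.exp (s ^ 2) := by rw [← Real.exp_nat_mul]; congr 1; push_cast; ring
    rw [show (2 : ℝ) ^ 2 = 4 by norm_num]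
    refine mul_le_mul_of_nonneg_left ?_ (by positivity)
    rw [Real.exp_nat_mul]
    exact pow_le_pow_left₀ (by positivity) e4 μ
  have hsum : ∑ x : Finset (Fin (2 * μ)), (Real.exp (s * (2 * x.card - 2 * μ)) +
      Real.exp (-s * (2 * x.card - 2 * μ))) ≤ 2 * 4 ^ μ * Real.exp (μ * s ^ 2) := by
    rw [Finset.sum_add_distrib]
    have h1 := sum1 s
    have h2 := sum1 (-s)
    rw [neg_sq] at h2
    linarith
  have hlow : (((Finset.univ : Finset (Finset (Fin (2 * μ)))).filter
      fun x => x.card + t < μ ∨ μ + t < x.card).card : ℝ) * Real.exp (2 * s * t) ≤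
      2 * 4 ^ μ * Real.exp (μ * s ^ 2) := by
    refine le_trans ?_ hsum
    rw [← nsmul_eq_mul]
    refine le_trans (Finset.card_nsmul_le_sum _ _ _ ?_)
      (Finset.sum_le_sum_of_subset_of_nonneg (Finset.filter_subset _ _) fun x _ _ => by positivity)
    intro x hx
    simp only [Finset.mem_filter, Finset.mem_univ, true_and] at hx
    rcases hx with hx | hx
    · have hxR : (x.card : ℝ) + t ≤ μ := by exact_mod_cast hx.le
      refine le_trans (Real.exp_le_exp.2 ?_) (le_add_of_nonneg_left (Real.exp_pos _).le)
      nlinarith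
    · have hxR : (μ : ℝ) + t ≤ x.card := by exact_mod_cast hx.le
      refine le_trans (Real.exp_le_exp.2 ?_) (le_add_of_nonneg_right (Real.exp_pos _).le)
      nlinarith
  have h1 : (μ : ℝ) * s ^ 2 = (t : ℝ) ^ 2 / μ := by rw [hs]; field_simp
  have h2 : 2 * s * t = 2 * ((t : ℝ) ^ 2 / μ) := by rw [hs]; ring
  rw [h1, h2] at hlow
  refine le_of_mul_le_mul_right (hlow.trans (le_of_eq ?_)) (Real.exp_pos (2 * ((t : ℝ) ^ 2 / μ)))
  rw [mul_assoc (2 * 4 ^ μ : ℝ), ← Real.exp_add]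
  congr 2; ring

lemma count (n N h μ : ℕ) (δ : ℝ) (hμ : 1 ≤ μ) (h4 : 4 * h ≤ μ) (hn : 2 * (2 * μ + 1) ≤ n)
    (hN : (n : ℝ) ≤ Real.exp N) (hμN : μ * N ≤ h ^ 2) (hδ0 : 0 ≤ δ)
    (hδ1 : δ ≤ Real.exp (-(4 * N))) (hδ2 : δ ≤ Real.exp (-(8 * (h : ℝ) ^ 2 / μ))) :
    n * δ * 4 ^ μ + (((Finset.univ : Finset (Finset (Fin (2 * μ)))).filter
      fun x => x.card + 4 * h < μ ∨ μ + 4 * h < x.card).card : ℝ) <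
    ((Finset.univ.filter fun S : Finset (Fin (2 * μ)) => S.card ≤ μ - h).card : ℝ) := by
  have hμ' : (0 : ℝ) < μ := by exact_mod_cast hμ
  have hnR : 2 * (2 * (μ : ℝ) + 1) ≤ n := by exact_mod_cast hn
  have hn3 : (6 : ℝ) ≤ n := by
    have : (1 : ℝ) ≤ μ := by exact_mod_cast hμ
    linarith
  have hch : ((2 * μ).choose (μ - h) : ℝ) ≤
      ((Finset.univ.filter fun S : Finset (Fin (2 * μ)) => S.card ≤ μ - h).card : ℝ) := by
    have : (Finset.powersetCard (μ - h) (Finset.univ : Finset (Fin (2 * μ)))).card ≤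
        (Finset.univ.filter fun S : Finset (Fin (2 * μ)) => S.card ≤ μ - h).card := by
      apply Finset.card_le_card
      intro S hS
      simp only [Finset.mem_powersetCard] at hS
      simp [hS.2]
    rw [Finset.card_powersetCard, Finset.card_univ, Fintype.card_fin] at this
    exact_mod_cast this
  refine lt_of_lt_of_le ?_ ((choose_lower μ h hμ h4).trans hch)
  have hout := outside_upper μ (4 * h) hμ
  set y : ℝ := (h : ℝ) ^ 2 / μ with hy
  have hyN : (N : ℝ) ≤ y := by
    rw [hy, le_div_iff₀ hμ']
    have : ((μ * N : ℕ) : ℝ) ≤ (h ^ 2 : ℕ) := by exact_mod_cast hμN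
    push_cast at this; linarith
  have e1 : ((4 * h : ℕ) : ℝ) ^ 2 / μ = 16 * y := by rw [hy]; push_cast; ring
  have e2 : 4 * (h : ℝ) ^ 2 / μ = 4 * y := by rw [hy]; ring
  have e3 : 8 * (h : ℝ) ^ 2 / μ = 8 * y := by rw [hy]; ring
  rw [e1] at hout; rw [e2]; rw [e3] at hδ2
  have hN0 : (0 : ℝ) ≤ N := Nat.cast_nonneg _
  have hnpos : (0 : ℝ) < n := by linarith
  have hinv : Real.exp (-(N : ℝ)) ≤ 1 / n := by
    rw [Real.exp_neg, ← one_div]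
    exact one_div_le_one_div_of_le hnpos hN
  set Z := Real.exp (-(4 * y)) with hZ
  have hZpos : 0 < Z := Real.exp_pos _
  -- bound on δ
  have hδ3 : δ ≤ Z * (1 / n) ^ 2 := by
    have h1 : δ ≤ Real.exp (-(4 * y)) * Real.exp (-(N : ℝ)) ^ 2 := by
      rw [← Real.exp_nat_mul, ← Real.exp_add]
      push_cast
      by_cases hc : 2 * (N : ℝ) ≤ 4 * y
      · exact hδ2.trans (Real.exp_le_exp.2 (by linarith))
      · exact hδ1.trans (Real.exp_le_exp.2 (by linarith))
    refine h1.trans (mul_le_mul_of_nonneg_left ?_ hZpos.le)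
    exact pow_le_pow_left₀ (Real.exp_pos _).le hinv 2
  have hout2 : Real.exp (-(16 * y)) ≤ Z * (1 / n) ^ 2 := by
    have h1 : Real.exp (-(16 * y)) ≤ Real.exp (-(4 * y)) * Real.exp (-(N : ℝ)) ^ 2 := by
      rw [← Real.exp_nat_mul, ← Real.exp_add]
      push_cast
      exact Real.exp_le_exp.2 (by linarith)
    refine h1.trans (mul_le_mul_of_nonneg_left ?_ hZpos.le)
    exact pow_le_pow_left₀ (Real.exp_pos _).le hinv 2
  have h4pos : (0 : ℝ) < 4 ^ μ := by positivity
  have f1 : n * δ * 4 ^ μ ≤ 4 ^ μ * Z * (1 / n) := by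
    calc n * δ * 4 ^ μ ≤ n * (Z * (1 / n) ^ 2) * 4 ^ μ := by gcongr
      _ = 4 ^ μ * Z * (1 / n) := by field_simp
  have f2 : 2 * 4 ^ μ * Real.exp (-(16 * y)) ≤ 4 ^ μ * Z * (2 * (1 / n) ^ 2) := by
    calc 2 * 4 ^ μ * Real.exp (-(16 * y)) ≤ 2 * 4 ^ μ * (Z * (1 / n) ^ 2) := by gcongr
      _ = _ := by ring
  have f3 : (1 : ℝ) / n + 2 * (1 / n) ^ 2 < 1 / (2 * μ + 1) := by
    have g1 : (1 : ℝ) / (n / 2) ≤ 1 / (2 * μ + 1) :=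
      one_div_le_one_div_of_le (by positivity) (by linarith)
    have g2 : (1 : ℝ) / (n / 2) = 1 / n + 1 / n := by field_simp; norm_num
    have g3 : (0:ℝ) < 1 / n := by positivity
    have g4 : (1:ℝ) / n ≤ 1 / 6 := one_div_le_one_div_of_le (by norm_num) hn3
    nlinarith
  calc _ ≤ 4 ^ μ * Z * (1 / n) + 4 ^ μ * Z * (2 * (1 / n) ^ 2) := add_le_add f1 (hout.trans f2)
    _ = 4 ^ μ * Z * (1 / n + 2 * (1 / n) ^ 2) := by ring
    _ < 4 ^ μ * Z * (1 / (2 * μ + 1)) := by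
        apply mul_lt_mul_of_pos_left f3; positivity
    _ = _ := by ring
end PD

namespace PD
open Polynomial

def pt (n m : ℕ) (x : Finset (Fin m)) (t : ℕ) : Fin n → Bool := fun v =>
  if h : v.val < m then decide ((⟨v.val, h⟩ : Fin m) ∈ x) else decide (v.val < m + t)

lemma wt_pt {n m t : ℕ} (x : Finset (Fin m)) (h : m + t ≤ n) : wt (pt n m x t) = x.card + t := by
  obtain ⟨r, rfl⟩ : ∃ r, n = m + r := ⟨n - m, by omega⟩
  rw [wt, Finset.card_filter, Fin.sum_univ_add]
  congr 1
  · simp [pt]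
  · have : ∀ i : Fin r, (if pt (m + r) m x t (Fin.natAdd m i) = true then 1 else 0)
        = (fun j : ℕ => if j < t then 1 else 0) i.val := by
      intro i; simp [pt]
    rw [Finset.sum_congr rfl (fun i _ => this i), Fin.sum_univ_eq_sum_range (fun j : ℕ => if j < t then 1 else 0) r,
      ← Finset.card_filter]
    have : (Finset.range r).filter (fun j => j < t) = Finset.range t := by
      ext j; simp; omega
    rw [this, Finset.card_range]

lemma pt_mem {K : Type} [Field K] {n m : ℕ} (t : ℕ) (v : Fin n) :
    (fun x : Finset (Fin m) => bF K (pt n m x t v)) ∈ LD K m 1 := by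
  by_cases h : v.val < m
  · have : (fun x : Finset (Fin m) => bF K (pt n m x t v)) = chi K {⟨v.val, h⟩} := by
      funext x; simp [bF, pt, h, chi]
    rw [this]; exact chi_mem (by simp)
  · have : (fun x : Finset (Fin m) => bF K (pt n m x t v)) =
        (bF K (decide (v.val < m + t))) • (1 : Finset (Fin m) → K) := by
      funext x; simp [pt, h]
    rw [this]; exact Submodule.smul_mem _ _ (LD_mono (by omega) one_mem)

lemma mulmem {K : Type} [Field K] {n m k d : ℕ} {Q : Finset (Fin m) → K} (hQ : Q ∈ LD K m k)
    (fh : ℕ → K) (T : ℕ → Finset (Fin m) → K) (hT : ∀ t, m + t ≤ n → T t ∈ LD K m d)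
    (hTQ : ∀ t, m + t ≤ n → ∀ x, Q x ≠ 0 → T t x = fh (x.card + t))
    (c : K[X]) (a : ℕ) (ha : a + c.natDegree + m ≤ n) :
    (fun x => Q x * ap c fh (x.card + a)) ∈ LD K m (k + d) := by
  have : (fun x => Q x * ap c fh (x.card + a)) =
      Q * ∑ j ∈ Finset.range (c.natDegree + 1), c.coeff j • T (a + j) := by
    funext x
    by_cases hx : Q x = 0
    · simp [hx]
    · rw [Pi.mul_apply, ap_apply, Finset.sum_apply]
      congr 1
      apply Finset.sum_congr rfl
      intro j hj
      have hj' := Finset.mem_range.1 hj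
      rw [Pi.smul_apply, smul_eq_mul, hTQ (a + j) (by omega) x hx, add_assoc]
  rw [this]
  apply LD_mul hQ
  apply Submodule.sum_mem
  intro j hj
  have hj' := Finset.mem_range.1 hj
  exact Submodule.smul_mem _ _ (hT _ (by omega))

lemma algcore {K : Type} [Field K] [IsAlgClosed K] {n μ h d s e : ℕ} (h1 : 1 ≤ h) (hd : d < h)
    (h4 : 4 * h ≤ μ) (hs : 2 * μ ≤ s) (hse : s + 2 * μ + 32 * h ≤ e) (hen : e + 2 * μ ≤ n)
    {Q : Finset (Fin (2 * μ)) → K} (hQ : Q ∈ LD K (2 * μ) (μ - h)) (hQ0 : Q ≠ 0)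
    (hQm : ∀ x, (x.card + 4 * h < μ ∨ μ + 4 * h < x.card) → Q x = 0)
    (fh : ℕ → K) (T : ℕ → Finset (Fin (2 * μ)) → K)
    (hT : ∀ t, 2 * μ + t ≤ n → T t ∈ LD K (2 * μ) d)
    (hTQ : ∀ t, 2 * μ + t ≤ n → ∀ x, Q x ≠ 0 → T t x = fh (x.card + t)) :
    ∃ r ≤ 8 * h, ∀ i, s ≤ i → i + r ≤ e → ap ((X - C 1)^r) fh i = 0 := by
  rcases dich fh s e (8 * h) (by omega) (by omega) with hA | hA | hA | hA
  · exfalso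
    obtain ⟨c, i0, hc, hi0, hi0e, hne, hz⟩ := hA
    apply hQ0
    refine interval (w := μ) (k := μ - 1) (LD_mono (by omega) hQ) (by omega) ?_
    intro x hx1 hx2
    by_cases hx3 : μ + 4 * h < x.card
    · exact hQm x (Or.inr hx3)
    have hmem := mulmem hQ fh T hT hTQ c (i0 - x.card) (by omega)
    have h0 := interval (w := 0) (k := μ - 1) (LD_mono (by omega) hmem) (by omega) (by
      intro y _ hy
      by_cases hy3 : y.card + 4 * h < μ
      · simp [hQm y (Or.inl hy3)]
      · rw [hz _ (by omega) (by omega), mul_zero])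
    have h0x := congrFun h0 x
    have hxx : x.card + (i0 - x.card) = i0 := by omega
    simp only [hxx, Pi.zero_apply, mul_eq_zero] at h0x
    exact h0x.resolve_right hne
  · exfalso
    obtain ⟨c, i0, hc, hi0, hi0e, hne, hz⟩ := hA
    apply hQ0
    refine interval (w := 0) (k := μ - 1) (LD_mono (by omega) hQ) (by omega) ?_
    intro x hx1 hx2
    by_cases hx3 : x.card + 4 * h < μ
    · exact hQm x (Or.inl hx3)
    have hmem := mulmem hQ fh T hT hTQ c (i0 - x.card) (by omega)
    have h0 := interval (w := μ + 1) (k := μ - 1) (LD_mono (by omega) hmem) (by omega) (by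
      intro y hy _
      by_cases hy3 : μ + 4 * h < y.card
      · simp [hQm y (Or.inr hy3)]
      · rw [hz _ (by omega) (by omega), mul_zero])
    have h0x := congrFun h0 x
    have hxx : x.card + (i0 - x.card) = i0 := by omega
    simp only [hxx, Pi.zero_apply, mul_eq_zero] at h0x
    exact h0x.resolve_right hne
  · exfalso
    obtain ⟨c, lam, κ, hc, hl0, hl1, hκ, hz⟩ := hA
    apply hQ0
    have hmem := mulmem hQ fh T hT hTQ c s (by omega)
    refine geom hQ (Submodule.smul_mem _ ((κ * lam ^ s)⁻¹) hmem) lam hl0 hl1 ?_ (by omega)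
    intro x
    have hx : x.card ≤ 2 * μ := by simpa using Finset.card_le_univ x
    rw [Pi.smul_apply, smul_eq_mul, hz _ (by omega) (by omega)]
    have : lam ^ s ≠ 0 := pow_ne_zero _ hl0
    field_simp
    ring
  · exact hA

open Classical in
lemma sample {F : Type} [Field F] (K : Type) [Field K] {n μ h N : ℕ} (f : (Fin n → Bool) → Bool)
    (P : ProbPoly F n) (δ : ℝ) (herr : ∀ a, errAt P f a ≤ δ)
    (hμ : 1 ≤ μ) (h4 : 4*h ≤ μ) (hn : 2*(2*μ+1) ≤ n) (hN : (n:ℝ) ≤ Real.exp N)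
    (hμN : μ*N ≤ h^2) (hδ0 : 0 ≤ δ) (hδ1 : δ ≤ Real.exp (-(4*N)))
    (hδ2 : δ ≤ Real.exp (-(8*(h:ℝ)^2/μ))) :
    ∃ i, ∃ Q ∈ LD K (2 * μ) (μ - h), Q ≠ 0 ∧
      (∀ x, (x.card + 4 * h < μ ∨ μ + 4 * h < x.card) → Q x = 0) ∧
      ∀ x, Q x ≠ 0 → ∀ t, 2 * μ + t ≤ n →
        MvPolynomial.eval (fun v => bF F (pt n (2 * μ) x t v)) (P.poly i)
          = bF F (f (pt n (2 * μ) x t)) := by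
  let bad : Fin P.k → Finset (Finset (Fin (2 * μ)) × ℕ) := fun i =>
    (Finset.univ ×ˢ Finset.range (n - 2 * μ + 1)).filter fun q =>
      ¬ MvPolynomial.eval (fun v => bF F (pt n (2 * μ) q.1 q.2 v)) (P.poly i)
          = bF F (f (pt n (2 * μ) q.1 q.2))
  set R : ℝ := n * δ * 4 ^ μ with hR
  have hsum : ∑ i, P.w i * ((bad i).card : ℝ) ≤ R := by
    have e1 : ∀ i, P.w i * ((bad i).card : ℝ) =
        ∑ q ∈ (Finset.univ ×ˢ Finset.range (n - 2 * μ + 1) : Finset (Finset (Fin (2 * μ)) × ℕ)),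
          if MvPolynomial.eval (fun v => bF F (pt n (2 * μ) q.1 q.2 v)) (P.poly i)
          = bF F (f (pt n (2 * μ) q.1 q.2)) then 0 else P.w i := by
      intro i
      rw [Finset.card_filter]
      push_cast
      rw [Finset.mul_sum]
      apply Finset.sum_congr rfl
      intro q _
      split_ifs <;> simp_all
    simp only [e1]
    rw [Finset.sum_comm]
    calc _ ≤ ∑ q ∈ (Finset.univ ×ˢ Finset.range (n - 2 * μ + 1) :
            Finset (Finset (Fin (2 * μ)) × ℕ)), δ := by
          apply Finset.sum_le_sum
          intro q _
          have := herr (pt n (2 * μ) q.1 q.2)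
          unfold errAt at this
          exact this
      _ = ((4:ℝ) ^ μ * ((n - 2 * μ + 1 : ℕ) : ℝ)) * δ := by
          rw [Finset.sum_const, Finset.card_product, nsmul_eq_mul]
          simp [pow_mul]
      _ ≤ ((4:ℝ) ^ μ * n) * δ := by
          gcongr
          omega
      _ = R := by rw [hR]; ring
  obtain ⟨i, hi⟩ : ∃ i, ((bad i).card : ℝ) ≤ R := by
    by_contra hcon
    push Not at hcon
    have h1 : ∑ i, P.w i * ((bad i).card - R) ≤ 0 := by
      simp only [mul_sub, Finset.sum_sub_distrib, ← Finset.sum_mul, P.w_sum]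
      linarith
    have h2 : ∀ i ∈ Finset.univ, 0 ≤ P.w i * ((bad i).card - R) := fun i _ =>
      mul_nonneg (P.w_nonneg i) (by linarith [hcon i])
    have h3 := (Finset.sum_eq_zero_iff_of_nonneg h2).1 (le_antisymm h1 (Finset.sum_nonneg h2))
    have h4 : ∀ i, P.w i = 0 := by
      intro i
      have := h3 i (Finset.mem_univ i)
      rcases mul_eq_zero.1 this with h | h
      · exact h
      · linarith [hcon i]
    have := P.w_sum
    simp [h4] at this
  have hcount := count n N h μ δ hμ h4 hn hN hμN hδ0 hδ1 hδ2
  obtain ⟨Q, hQ, hQ0, hQz⟩ := exists_vanish (K := K) (k := μ - h)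
    (((bad i).image Prod.fst) ∪ (Finset.univ.filter fun x : Finset (Fin (2*μ)) =>
      x.card + 4*h < μ ∨ μ + 4*h < x.card)) (by
      have a1 := Finset.card_union_le ((bad i).image Prod.fst)
        (Finset.univ.filter fun x : Finset (Fin (2*μ)) => x.card + 4*h < μ ∨ μ + 4*h < x.card)
      have a2 : ((bad i).image Prod.fst).card ≤ (bad i).card := Finset.card_image_le
      have a3 := a1.trans (Nat.add_le_add_right a2 _)
      have a4 : ((((bad i).image Prod.fst) ∪ (Finset.univ.filter fun x : Finset (Fin (2*μ)) =>
        x.card + 4*h < μ ∨ μ + 4*h < x.card)).card : ℝ) ≤ (bad i).card +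
        (Finset.univ.filter fun x : Finset (Fin (2*μ)) =>
        x.card + 4*h < μ ∨ μ + 4*h < x.card).card := by exact_mod_cast a3
      have a5 := lt_of_le_of_lt a4 (lt_of_le_of_lt (add_le_add_left hi _) hcount)
      exact_mod_cast a5)
  refine ⟨i, Q, hQ, hQ0, ?_, ?_⟩
  · intro x hx
    apply hQz
    rw [Finset.mem_union]; right
    simpa using hx
  · intro x hx t ht
    by_contra hb
    apply hx
    apply hQz
    rw [Finset.mem_union]; left
    rw [Finset.mem_image]
    refine ⟨(x, t), ?_, rfl⟩
    simp only [bad, Finset.mem_filter, Finset.mem_product, Finset.mem_univ, Finset.mem_range, true_and]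
    exact ⟨by omega, hb⟩

lemma totdeg_map {F K : Type} [Field F] [Field K] (φ : F →+* K) {n : ℕ} (q : MvPolynomial (Fin n) F) :
    (MvPolynomial.map φ q).totalDegree ≤ q.totalDegree :=
  Finset.sup_mono (MvPolynomial.support_map_subset _ _)

lemma core {F : Type} [Field F] (p : ℕ) [CharP F p] (hp : p = 0 ∨ p.Prime) {n μ h N d : ℕ}
    (f : (Fin n → Bool) → Bool) (specF : ℕ → Bool) (hf : ∀ a, f a = specF (wt a))
    (P : ProbPoly F n) (hP : ∀ i, (P.poly i).totalDegree ≤ d) (hd : d < h)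
    (δ : ℝ) (herr : ∀ a, errAt P f a ≤ δ)
    (h4 : 4*h ≤ μ) (hn : 20 * μ ≤ n) (hnh : 64 * h + 2 * μ + (n + 2) / 3 ≤ 2 * n / 3)
    (hN : (n:ℝ) ≤ Real.exp N)
    (hμN : μ*N ≤ h^2) (hδ0 : 0 ≤ δ) (hδ1 : δ ≤ Real.exp (-(4*N)))
    (hδ2 : δ ≤ Real.exp (-(8*(h:ℝ)^2/μ))) :
    ∃ B, 1 ≤ B ∧ B ≤ 16 * h + 1 ∧ (B = 1 ∨ ∃ t, p.Prime ∧ B = p ^ t) ∧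
      ∀ i, (n + 2) / 3 ≤ i → i + B ≤ 2 * n / 3 → specF i = specF (i + B) := by
  let K := AlgebraicClosure F
  have : CharP K p := charP_of_injective_algebraMap (algebraMap F K).injective p
  obtain ⟨i, Q, hQ, hQ0, hQm, hQe⟩ := sample K f P δ herr (by omega) h4 (by omega) hN hμN hδ0 hδ1 hδ2
  have hmap : ∀ b, algebraMap F K (bF F b) = bF K b := by
    intro b; cases b <;> simp [bF]
  let T : ℕ → Finset (Fin (2 * μ)) → K := fun t x =>
    MvPolynomial.eval (fun v => bF K (pt n (2 * μ) x t v)) (MvPolynomial.map (algebraMap F K) (P.poly i))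
  obtain ⟨r, hr, hr'⟩ := algcore (K := K) (n := n) (μ := μ) (h := h) (d := d) (s := (n + 2) / 3)
    (e := 2 * n / 3) (by omega) hd h4 (by omega) (by omega) (by omega) hQ hQ0 hQm
    (fun i => bF K (specF i)) T
    (by
      intro t _
      exact LD_poly _ ((totdeg_map _ _).trans (hP i)) _ (fun v => pt_mem t v))
    (by
      intro t ht x hx
      have h1 := congrArg (algebraMap F K) (hQe x hx t ht)
      rw [hmap, hf, wt_pt x ht] at h1
      rw [← h1]
      simp only [T, MvPolynomial.eval_map]
      rw [MvPolynomial.eval₂_eq', MvPolynomial.eval_eq']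
      simp [hmap])
  obtain ⟨B, hB1, hB2, hB3, hB4⟩ := unip p hp (fun i => bF K (specF i)) _ _ r
    (by intro i _ _; cases specF i <;> simp [bF]) hr' (by omega)
  refine ⟨B, hB1, by omega, hB3, ?_⟩
  intro i hi hie
  have := hB4 i hi hie
  revert this
  cases specF i <;> cases specF (i + B) <;> simp [bF]
end PD

namespace PD

def extF (specF : ℕ → Bool) (s B : ℕ) : ℕ → Bool := fun i => specF (s + (i + s * (B - 1)) % B)

lemma extF_per (specF : ℕ → Bool) (s B : ℕ) : Function.Periodic (extF specF s B) B := by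
  intro i
  simp only [extF]
  rw [show i + B + s * (B - 1) = i + s * (B - 1) + B by ring, Nat.add_mod_right]

lemma extF_idx {s B i : ℕ} (hB : 1 ≤ B) : (s + (i + s * (B - 1)) % B) % B = i % B := by
  obtain ⟨C, rfl⟩ : ∃ C, B = C + 1 := ⟨B - 1, by omega⟩
  rw [Nat.add_mod_mod, Nat.add_sub_cancel, show s + (i + s * C) = i + (C + 1) * s by ring,
    Nat.add_mul_mod_self_left]

lemma extF_agree (specF : ℕ → Bool) (s e B : ℕ) (hB : 1 ≤ B)
    (hper : ∀ i, s ≤ i → i + B ≤ e → specF i = specF (i + B)) (i : ℕ) (h1 : s ≤ i) (h2 : i ≤ e) :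
    extF specF s B i = specF i := by
  induction i using Nat.strong_induction_on with
  | _ i ih =>
    by_cases hi : s + B ≤ i
    · have := extF_per specF s B (i - B)
      rw [Nat.sub_add_cancel (by omega)] at this
      rw [this, ih (i - B) (by omega) (by omega) (by omega), hper (i - B) (by omega) (by omega),
        Nat.sub_add_cancel (by omega)]
    · obtain ⟨C, rfl⟩ : ∃ C, B = C + 1 := ⟨B - 1, by omega⟩
      simp only [extF]
      rw [Nat.add_sub_cancel, show i + s * C = (i - s) + (C + 1) * s by
        obtain ⟨j, rfl⟩ := Nat.exists_eq_add_of_le h1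
        rw [Nat.add_sub_cancel_left]; ring, Nat.add_mul_mod_self_left, Nat.mod_eq_of_lt (by omega)]
      congr 1; omega

lemma period_le (n : ℕ) (g : ℕ → Bool) (b : ℕ) (hb : 1 ≤ b) (h : ∀ i, i + b ≤ n → g i = g (i + b)) :
    period n g ≤ b := Nat.sInf_le ⟨hb, h⟩

lemma period_spec (n : ℕ) (g : ℕ → Bool) :
    1 ≤ period n g ∧ ∀ i, i + period n g ≤ n → g i = g (i + period n g) :=
  Nat.sInf_mem (s := {b | 1 ≤ b ∧ ∀ i, i + b ≤ n → g i = g (i + b)})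
    ⟨n + 1, by omega, fun i hi => by omega⟩

lemma per_le {n s e : ℕ} {specF specG : ℕ → Bool}
    (hmin : ∀ specG' : ℕ → Bool, (∀ i, s ≤ i → i ≤ e → specG' i = specF i) →
      period n specG ≤ period n specG')
    {B : ℕ} (hB : 1 ≤ B) (hper : ∀ i, s ≤ i → i + B ≤ e → specF i = specF (i + B)) : period n specG ≤ B :=
  (hmin _ (extF_agree specF s e B hB hper)).trans
    (period_le _ _ _ hB fun i _ => (extF_per specF s B i).symm)

lemma per_dvd {n s e : ℕ} {specF specG : ℕ → Bool}
    (hG : ∀ i, s ≤ i → i ≤ e → specG i = specF i)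
    (hmin : ∀ specG' : ℕ → Bool, (∀ i, s ≤ i → i ≤ e → specG' i = specF i) →
      period n specG ≤ period n specG')
    {B : ℕ} (hB : 1 ≤ B) (hper : ∀ i, s ≤ i → i + B ≤ e → specF i = specF (i + B))
    (hse : s + 2 * B ≤ e) (hen : e ≤ n) : period n specG ∣ B := by
  have hle := per_le hmin hB hper
  obtain ⟨hb1, hb⟩ := period_spec n specG
  set b := period n specG with hbdef
  have hbp : Function.Periodic (extF specF s B) b := by
    intro i
    have hmod := extF_idx (s := s) (i := i) hB
    have hlt := Nat.mod_lt (i + s * (B - 1)) (by omega : B > 0)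
    set i' := s + (i + s * (B - 1)) % B with hi'
    have e0 : extF specF s B i = specF i' := rfl
    have e1 : extF specF s B (i + b) = extF specF s B (i' + b) := by
      rw [← (extF_per specF s B).map_mod_nat (i + b), ← (extF_per specF s B).map_mod_nat (i' + b),
        Nat.add_mod i, Nat.add_mod i', hmod]
    rw [e1, extF_agree specF s e B hB hper _ (by omega) (by omega), e0,
      ← hG i' (by omega) (by omega), ← hG (i' + b) (by omega) (by omega), ← hb i' (by omega)]
  by_contra hnd
  have hr : 1 ≤ B % b := Nat.pos_of_ne_zero fun h => hnd (Nat.dvd_of_mod_eq_zero h)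
  have hrp : ∀ i, extF specF s B (i + B % b) = extF specF s B i := by
    intro i
    have h1 := (hbp.nat_mul (B / b)) (i + B % b)
    have h2 : i + B % b + (B / b) * b = i + B := by
      rw [add_assoc, mul_comm, Nat.mod_add_div]
    have h3 := extF_per specF s B i
    rw [← h3, ← h2, ← h1]; simp
  have := (hmin _ (extF_agree specF s e B hB hper)).trans
    (period_le n _ _ hr fun i _ => (hrp i).symm)
  have := Nat.mod_lt B (by omega : b > 0)
  omega

lemma deg_pos {F : Type} [Field F] {n : ℕ} (f : (Fin n → Bool) → Bool) (specF : ℕ → Bool)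
    (hf : ∀ a, f a = specF (wt a)) (i j : ℕ) (hi : i ≤ n) (hj : j ≤ n) (hij : specF i ≠ specF j)
    (P : ProbPoly F n) (ε : ℝ) (hε : ε ≤ 1/3) (herr : ∀ a, errAt P f a ≤ ε) :
    ¬ ∀ i, (P.poly i).totalDegree ≤ 0 := by
  intro hd
  have h1 := herr (pt n 0 ∅ i)
  have h2 := herr (pt n 0 ∅ j)
  have hw := P.w_sum
  unfold errAt at h1 h2
  have : (1:ℝ) ≤ ε + ε := by
    refine le_trans ?_ (add_le_add h1 h2)
    rw [← hw, ← Finset.sum_add_distrib]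
    apply Finset.sum_le_sum
    intro k _
    obtain ⟨c, hc⟩ : ∃ c, P.poly k = MvPolynomial.C c :=
      ⟨_, MvPolynomial.totalDegree_eq_zero_iff_eq_C.1 (Nat.le_zero.1 (hd k))⟩
    have hne : bF F (f (pt n 0 ∅ i)) ≠ bF F (f (pt n 0 ∅ j)) := by
      rw [hf, hf, wt_pt _ (by omega), wt_pt _ (by omega)]
      simp only [Finset.card_empty, zero_add]
      revert hij
      cases specF i <;> cases specF j <;> simp [bF]
    have hw0 := P.w_nonneg k
    have hev : ∀ g : Fin n → F, MvPolynomial.eval g (P.poly k) = c := by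
      intro g; rw [hc, MvPolynomial.eval_C]
    split_ifs with h3 h4 h4
    · exact absurd ((h3.symm.trans (hev _)).trans ((hev _).symm.trans h4)) hne
    all_goals linarith
  linarith
end PD

namespace PD

open Classical in
lemma ofFam {F : Type} [Field F] {n : ℕ} (ι : Type) [Fintype ι] (w : ι → ℝ) (hw : ∀ i, 0 ≤ w i)
    (hs : ∑ i, w i = 1) (q : ι → MvPolynomial (Fin n) F) (f : (Fin n → Bool) → Bool) (d : ℕ) (δ : ℝ)
    (hd : ∀ i, (q i).totalDegree ≤ d)
    (herr : ∀ a, (∑ i, if MvPolynomial.eval (fun v => bF F (a v)) (q i) = bF F (f a)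
      then 0 else w i) ≤ δ) :
    ∃ P : ProbPoly F n, (∀ i, (P.poly i).totalDegree ≤ d) ∧ ∀ a, errAt P f a ≤ δ := by
  let e := (Fintype.equivFin ι).symm
  refine ⟨⟨Fintype.card ι, fun i => w (e i), fun i => hw _, ?_, fun i => q (e i)⟩, fun i => hd _, ?_⟩
  · rw [← hs]; exact Equiv.sum_comp e w
  · intro a
    refine le_trans (le_of_eq ?_) (herr a)
    unfold errAt
    exact Equiv.sum_comp e (fun i => if MvPolynomial.eval (fun v => bF F (a v)) (q i) = bF F (f a)
      then 0 else w i)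

def maj {R : Type} [CommRing R] {l : ℕ} (y : Fin l → R) : R :=
  ∑ A ∈ (Finset.univ : Finset (Finset (Fin l))).filter (fun A => l < 2 * A.card),
    (∏ i ∈ A, y i) * ∏ i ∈ Aᶜ, (1 - y i)

lemma meet {l : ℕ} (A G : Finset (Fin l)) (h : l < A.card + G.card) : ∃ i ∈ A, i ∈ G := by
  by_contra hc
  push Not at hc
  have : Disjoint A G := Finset.disjoint_left.2 hc
  have h2 := Finset.card_union_of_disjoint this
  have h3 := Finset.card_le_univ (A ∪ G)
  rw [Fintype.card_fin] at h3
  omega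

lemma maj_zero {R : Type} [CommRing R] {l : ℕ} (y : Fin l → R) (G : Finset (Fin l))
    (hG : l < 2 * G.card) (h : ∀ i ∈ G, y i = 0) : maj y = 0 := by
  apply Finset.sum_eq_zero
  intro A hA
  rw [Finset.mem_filter] at hA
  obtain ⟨i, hi, hi'⟩ := meet A G (by omega)
  rw [Finset.prod_eq_zero hi (h i hi'), zero_mul]

lemma maj_one {R : Type} [CommRing R] {l : ℕ} (y : Fin l → R) (G : Finset (Fin l))
    (hG : l < 2 * G.card) (h : ∀ i ∈ G, y i = 1) : maj y = 1 := by
  have h1 : ∑ A : Finset (Fin l), (∏ i ∈ A, y i) * ∏ i ∈ Aᶜ, (1 - y i) = 1 := by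
    have := Finset.prod_add y (fun i => 1 - y i) Finset.univ
    simp only [add_sub_cancel, Finset.prod_const_one, Finset.powerset_univ] at this
    refine Eq.trans ?_ this.symm
    apply Finset.sum_congr rfl
    intro A _
    rw [Finset.compl_eq_univ_sdiff]
  rw [← h1, maj, Finset.sum_filter]
  apply Finset.sum_congr rfl
  intro A _
  split_ifs with hA
  · rfl
  · obtain ⟨i, hi, hi'⟩ := meet Aᶜ G (by
      rw [Finset.card_compl, Fintype.card_fin]
      have := Finset.card_le_univ A
      rw [Fintype.card_fin] at this
      omega)
    rw [Finset.prod_eq_zero hi (by rw [h i hi', sub_self]), mul_zero]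

lemma maj_deg {F : Type} [Field F] {n l d : ℕ} (y : Fin l → MvPolynomial (Fin n) F)
    (h : ∀ i, (y i).totalDegree ≤ d) : (maj y).totalDegree ≤ l * d := by
  apply MvPolynomial.totalDegree_finsetSum_le
  intro A _
  refine (MvPolynomial.totalDegree_mul _ _).trans ?_
  have h1 : (∏ i ∈ A, y i).totalDegree ≤ A.card * d := by
    refine (MvPolynomial.totalDegree_finsetProd _ _).trans ?_
    exact (Finset.sum_le_card_nsmul _ _ d fun i _ => h i).trans (by simp)
  have h2 : (∏ i ∈ Aᶜ, (1 - y i)).totalDegree ≤ Aᶜ.card * d := by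
    refine (MvPolynomial.totalDegree_finsetProd _ _).trans ?_
    refine (Finset.sum_le_card_nsmul _ _ d fun i _ => ?_).trans (by simp)
    refine (MvPolynomial.totalDegree_sub _ _).trans ?_
    simpa using h i
  have h3 : A.card + Aᶜ.card = l := by rw [Finset.card_add_card_compl, Fintype.card_fin]
  calc _ ≤ A.card * d + Aᶜ.card * d := add_le_add h1 h2
    _ = l * d := by rw [← add_mul, h3]

lemma maj_eval {F : Type} [Field F] {n l : ℕ} (y : Fin l → MvPolynomial (Fin n) F) (g : Fin n → F) :
    MvPolynomial.eval g (maj y) = maj (fun i => MvPolynomial.eval g (y i)) := by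
  simp [maj, map_sum, map_prod]

open Classical in
lemma amplify {F : Type} [Field F] {n d : ℕ} (f : (Fin n → Bool) → Bool) (P : ProbPoly F n)
    (ε : ℝ) (hε : ε ≤ 1/3) (hd : ∀ i, (P.poly i).totalDegree ≤ d) (herr : ∀ a, errAt P f a ≤ ε)
    (q : ℕ) :
    ∃ P' : ProbPoly F n, (∀ i, (P'.poly i).totalDegree ≤ (2 * q) * d) ∧
      ∀ a, errAt P' f a ≤ (8/9)^q := by
  refine ofFam (Fin (2 * q) → Fin P.k) (fun σ => ∏ j, P.w (σ j))
    (fun σ => Finset.prod_nonneg fun j _ => P.w_nonneg _) ?_ (fun σ => maj fun j => P.poly (σ j))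
    f _ _ (fun σ => maj_deg _ fun j => hd _) ?_
  · have := Finset.prod_univ_sum (fun _ : Fin (2 * q) => (Finset.univ : Finset (Fin P.k)))
      (fun _ i => P.w i)
    simp only [P.w_sum, Finset.prod_const_one, Fintype.piFinset_univ] at this
    exact this.symm
  · intro a
    let bad : Fin P.k → Prop := fun i =>
      ¬ MvPolynomial.eval (fun v => bF F (a v)) (P.poly i) = bF F (f a)
    let g : Fin P.k → ℝ := fun i => P.w i * (if bad i then 2 else 1)
    have hg : ∑ i, g i ≤ 4/3 := by
      have h1 : ∑ i, g i = 1 + errAt P f a := by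
        unfold errAt
        rw [← P.w_sum, ← Finset.sum_add_distrib]
        apply Finset.sum_congr rfl
        intro i _
        simp only [g, bad]
        split_ifs <;> first | contradiction | ring
      rw [h1]; linarith [herr a]
    have hg0 : 0 ≤ ∑ i, g i := Finset.sum_nonneg fun i _ =>
      mul_nonneg (P.w_nonneg i) (by split_ifs <;> norm_num)
    have key : ∀ σ : Fin (2 * q) → Fin P.k,
        (if MvPolynomial.eval (fun v => bF F (a v)) (maj fun j => P.poly (σ j)) = bF F (f a)
          then 0 else ∏ j, P.w (σ j)) ≤ (1/2)^q * ∏ j, g (σ j) := by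
      intro σ
      have hpos : 0 ≤ ∏ j, P.w (σ j) := Finset.prod_nonneg fun j _ => P.w_nonneg _
      have hgp : ∏ j, g (σ j) = (∏ j, P.w (σ j)) *
          2 ^ (Finset.univ.filter fun j => bad (σ j)).card := by
        simp only [g]
        rw [Finset.prod_mul_distrib, Finset.prod_ite]
        simp
      rw [hgp]
      split_ifs with h
      · positivity
      · have hq : q ≤ (Finset.univ.filter fun j => bad (σ j)).card := by
          by_contra hlt
          apply h
          have hc : 2 * q < 2 * (Finset.univ.filter fun j => ¬ bad (σ j)).card := by
            have := Finset.card_filter_add_card_filter_not (s := (Finset.univ : Finset (Fin (2*q))))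
              (fun j => bad (σ j))
            simp only [Finset.card_univ, Fintype.card_fin] at this
            omega
          have hgood : ∀ j ∈ Finset.univ.filter (fun j => ¬ bad (σ j)),
              MvPolynomial.eval (fun v => bF F (a v)) (P.poly (σ j)) = bF F (f a) := by
            intro j hj
            have := (Finset.mem_filter.1 hj).2
            exact not_not.1 this
          rw [maj_eval]
          cases hfa : f a
          · rw [maj_zero _ _ hc (fun j hj => by rw [hgood j hj, hfa]; simp [bF])]; simp [bF]
          · rw [maj_one _ _ hc (fun j hj => by rw [hgood j hj, hfa]; simp [bF])]; simp [bF]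
        have h2 : (2:ℝ)^q ≤ 2 ^ (Finset.univ.filter fun j => bad (σ j)).card :=
          pow_le_pow_right₀ (by norm_num) hq
        calc ∏ j, P.w (σ j) = (1/2)^q * ((∏ j, P.w (σ j)) * 2 ^ q) := by
              rw [mul_left_comm, ← mul_pow]; norm_num
          _ ≤ _ := by gcongr
    calc _ ≤ ∑ σ : Fin (2 * q) → Fin P.k, (1/2:ℝ)^q * ∏ j, g (σ j) :=
          Finset.sum_le_sum fun σ _ => key σ
      _ = (1/2)^q * (∑ i, g i)^(2*q) := by
          rw [← Finset.mul_sum]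
          have := Finset.prod_univ_sum (fun _ : Fin (2 * q) => (Finset.univ : Finset (Fin P.k)))
            (fun _ i => g i)
          simp only [Finset.prod_const, Fintype.piFinset_univ, Finset.card_univ, Fintype.card_fin] at this
          rw [this]
      _ ≤ (1/2)^q * (4/3)^(2*q) := by gcongr
      _ = (8/9)^q := by rw [pow_mul, ← mul_pow]; norm_num

lemma exact_poly {F : Type} [Field F] {n : ℕ} (f : (Fin n → Bool) → Bool) :
    ∃ q : MvPolynomial (Fin n) F, ∀ a : Fin n → Bool,
      MvPolynomial.eval (fun v => bF F (a v)) q = bF F (f a) := by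
  refine ⟨∑ b : Fin n → Bool, MvPolynomial.C (bF F (f b)) *
    ∏ v, (if b v then MvPolynomial.X v else 1 - MvPolynomial.X v), ?_⟩
  intro a
  rw [map_sum, Finset.sum_eq_single a]
  · rw [map_mul, MvPolynomial.eval_C, map_prod, Finset.prod_eq_one, mul_one]
    intro v _
    cases h : a v <;> simp [bF, h]
  · intro b _ hb
    obtain ⟨v, hv⟩ := Function.ne_iff.1 hb
    rw [map_mul, map_prod, Finset.prod_eq_zero (Finset.mem_univ v), mul_zero]
    revert hv
    cases h : a v <;> cases h' : b v <;> simp [bF, h]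
  · simp

lemma pdeg_spec {F : Type} [Field F] {n : ℕ} (f : (Fin n → Bool) → Bool) (ε : ℝ) (hε : 0 ≤ ε) :
    ∃ P : ProbPoly F n, (∀ i, (P.poly i).totalDegree ≤ pdeg F f ε) ∧ ∀ a, errAt P f a ≤ ε := by
  refine Nat.sInf_mem
    (s := {d | ∃ P : ProbPoly F n, (∀ i, (P.poly i).totalDegree ≤ d) ∧ ∀ a, errAt P f a ≤ ε}) ?_
  obtain ⟨q, hq⟩ := exact_poly (F := F) f
  refine ⟨q.totalDegree, ofFam Unit (fun _ => 1) (by simp) (by simp) (fun _ => q) f _ _ (by simp) ?_⟩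
  intro a
  simp [hq, hε]
end PD

namespace PD

lemma final_nat {F : Type} [Field F] (p : ℕ) [CharP F p] (hp : p = 0 ∨ p.Prime) {n μ h N d : ℕ}
    (f : (Fin n → Bool) → Bool) (specF specG : ℕ → Bool) (hf : ∀ a, f a = specF (wt a))
    (hG : ∀ i, (n + 2) / 3 ≤ i → i ≤ 2 * n / 3 → specG i = specF i)
    (hmin : ∀ specG' : ℕ → Bool, (∀ i, (n + 2) / 3 ≤ i → i ≤ 2 * n / 3 → specG' i = specF i) →
      period n specG ≤ period n specG')
    (hb1 : 1 < period n specG)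
    (hcase : (¬ ∃ t : ℕ, period n specG = p ^ t) ∨ 16 * h + 1 < period n specG)
    (P : ProbPoly F n) (hP : ∀ i, (P.poly i).totalDegree ≤ d)
    (δ : ℝ) (herr : ∀ a, errAt P f a ≤ δ)
    (h4 : 4*h ≤ μ) (hn : 20 * μ ≤ n) (hnh : 64 * h + 2 * μ + (n + 2) / 3 ≤ 2 * n / 3)
    (hN : (n:ℝ) ≤ Real.exp N)
    (hμN : μ*N ≤ h^2) (hδ0 : 0 ≤ δ) (hδ1 : δ ≤ Real.exp (-(4*N)))
    (hδ2 : δ ≤ Real.exp (-(8*(h:ℝ)^2/μ))) : h ≤ d := by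
  by_contra hd
  push Not at hd
  obtain ⟨B, hB1, hB2, hB3, hB4⟩ := core p hp f specF hf P hP hd δ herr h4 hn hnh hN hμN hδ0 hδ1 hδ2
  have hle := per_le hmin hB1 hB4
  rcases hcase with hc | hc
  · have hdvd := per_dvd hG hmin hB1 hB4 (by omega) (by omega)
    rcases hB3 with rfl | ⟨t, hpp, rfl⟩
    · omega
    · obtain ⟨k, _, hk⟩ := (Nat.dvd_prime_pow hpp).1 hdvd
      exact hc ⟨k, hk⟩
  · omega

lemma boost {F : Type} [Field F] {n d : ℕ} (f : (Fin n → Bool) → Bool) (P : ProbPoly F n)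
    (ε : ℝ) (hε : ε ≤ 1/3) (hd : ∀ i, (P.poly i).totalDegree ≤ d) (herr : ∀ a, errAt P f a ≤ ε)
    (N : ℕ) (hN : 1 ≤ N) :
    ∃ P' : ProbPoly F n, (∀ i, (P'.poly i).totalDegree ≤ (288 * N) * d) ∧
      ∀ a, errAt P' f a ≤ min ε (Real.exp (-(16 * N))) := by
  by_cases h : ε ≤ Real.exp (-(16 * N))
  · refine ⟨P, fun i => (hd i).trans (Nat.le_mul_of_pos_left _ (by omega)), ?_⟩
    rw [min_eq_left h]; exact herr
  · obtain ⟨P', h1, h2⟩ := amplify f P ε hε hd herr (144 * N)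
    refine ⟨P', fun i => (h1 i).trans (le_of_eq (by ring)), fun a => (h2 a).trans ?_⟩
    rw [min_eq_right (le_of_lt (not_le.1 h))]
    have h3 : (8/9:ℝ) ≤ Real.exp (-(1/9)) := by
      have := Real.add_one_le_exp (-(1/9):ℝ); linarith
    calc (8/9:ℝ)^(144 * N) ≤ (Real.exp (-(1/9)))^(144*N) := by gcongr
      _ = Real.exp (-(16*N)) := by rw [← Real.exp_nat_mul]; congr 1; push_cast; ring

lemma final_real {F : Type} [Field F] (p : ℕ) [CharP F p] (hp : p = 0 ∨ p.Prime) {n : ℕ} (hn2 : 2 ≤ n)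
    (f : (Fin n → Bool) → Bool) (specF specG : ℕ → Bool) (hf : ∀ a, f a = specF (wt a))
    (hG : ∀ i, (n + 2) / 3 ≤ i → i ≤ 2 * n / 3 → specG i = specF i)
    (hmin : ∀ specG' : ℕ → Bool, (∀ i, (n + 2) / 3 ≤ i → i ≤ 2 * n / 3 → specG' i = specF i) →
      period n specG ≤ period n specG')
    (hb1 : 1 < period n specG) (ε : ℝ) (hε1 : 1 / (2:ℝ)^n ≤ ε) (hε2 : ε ≤ 1/3)
    (Y : ℝ) (hY0 : 0 ≤ Y) (hY : Y ≤ Real.sqrt (n * Real.logb 2 (1/ε)))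
    (hcase : (¬ ∃ t : ℕ, period n specG = p ^ t) ∨ Y ≤ period n specG) :
    (1 / 10^7) * Y / (Real.logb 2 n)^2 ≤ (pdeg F f ε : ℝ) := by
  have hεpos : 0 < ε := lt_of_lt_of_le (by positivity) hε1
  obtain ⟨P, hP, herr⟩ := pdeg_spec (F := F) f ε hεpos.le
  set d := pdeg F f ε with hd
  -- the trivial bound
  have hd1 : 1 ≤ d := by
    by_contra h0
    obtain ⟨i, hi1, hi2, hi3⟩ : ∃ i, (n + 2) / 3 ≤ i ∧ i + 1 ≤ 2 * n / 3 ∧ specF i ≠ specF (i + 1) := by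
      by_contra hcon
      push Not at hcon
      have := per_le hmin le_rfl hcon
      omega
    exact deg_pos f specF hf i (i + 1) (by omega) (by omega) hi3 P ε hε2 herr
      (fun j => (hP j).trans (by omega))
  -- logarithms
  set lg := Real.logb 2 n with hlg
  have hnpos : (0:ℝ) < n := by exact_mod_cast (by omega : 0 < n)
  have hlg1 : 1 ≤ lg := by
    rw [hlg, Real.le_logb_iff_rpow_le (by norm_num) hnpos]
    simpa using (by exact_mod_cast hn2 : (2:ℝ) ≤ n)
  set N := Nat.clog 2 n with hNdef
  have hN1 : 1 ≤ N := Nat.clog_pos (by norm_num) hn2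
  have hnN : n ≤ 2 ^ N := Nat.le_pow_clog (by norm_num) n
  have hNlg : (N:ℝ) ≤ 2 * lg := by
    have h1 : 2 ^ (N - 1) ≤ n := (Nat.pow_pred_clog_lt_self (by norm_num) (by omega)).le
    have h2 : ((N - 1 : ℕ):ℝ) ≤ lg := by
      rw [hlg, Real.le_logb_iff_rpow_le (by norm_num) hnpos, Real.rpow_natCast]
      exact_mod_cast h1
    rw [Nat.cast_sub hN1] at h2
    push_cast at h2
    linarith
  have hN1' : (1:ℝ) ≤ N := by exact_mod_cast hN1
  have hnexp : (n:ℝ) ≤ Real.exp N := by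
    have h1 : (n:ℝ) ≤ 2 ^ N := by exact_mod_cast hnN
    refine h1.trans ?_
    have h2 : (2:ℝ) ≤ Real.exp 1 := by have := Real.add_one_le_exp (1:ℝ); linarith
    calc (2:ℝ)^N ≤ (Real.exp 1)^N := by gcongr
      _ = Real.exp N := by rw [← Real.exp_nat_mul, mul_one]
  have hd1' : (1:ℝ) ≤ d := by exact_mod_cast hd1
  -- reduction to a clean inequality
  suffices hmain : Y ≤ 16000 * N ∨ Y ≤ 4000 * (288 * N * d) by
    have hYb : Y ≤ 10^7 * (lg * d) := by
      have hld : 0 ≤ lg * d := by positivity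
      have hldl : lg ≤ lg * d := le_mul_of_one_le_right (by linarith) hd1'
      rcases hmain with h | h
      · linarith
      · have : (N:ℝ) * d ≤ 2 * lg * d := by gcongr
        nlinarith
    rw [div_le_iff₀ (by positivity)]
    have : lg * d ≤ d * lg ^ 2 := by nlinarith [mul_nonneg (sub_nonneg.2 hlg1) (by positivity : 0 ≤ lg * d)]
    linarith
  by_cases hYN : Y ≤ 16000 * N
  · exact Or.inl hYN
  right
  push Not at hYN
  set Λ := Real.logb 2 (1/ε) with hΛ
  have hΛ0 : 0 ≤ Λ := by
    apply Real.logb_nonneg (by norm_num)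
    rw [le_div_iff₀ hεpos]; linarith
  have hΛn : Λ ≤ n := by
    rw [hΛ, Real.logb_le_iff_le_rpow (by norm_num) (by positivity), Real.rpow_natCast,
      div_le_iff₀ hεpos]
    rwa [div_le_iff₀ (by positivity), mul_comm] at hε1
  have hεexp : ε = Real.exp (-(Λ * Real.log 2)) := by
    rw [hΛ, Real.logb, div_mul_cancel₀ _ (by positivity), one_div, Real.log_inv, neg_neg,
      Real.exp_log hεpos]
  have hY2 : Y ^ 2 ≤ n * Λ := by
    have := pow_le_pow_left₀ hY0 hY 2
    rwa [Real.sq_sqrt (by positivity)] at this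
  have hYn : Y ≤ n := by
    apply le_of_sq_le_sq _ hnpos.le
    nlinarith
  set h := ⌊Y / 2000⌋₊ with hh
  have hhY : (h:ℝ) ≤ Y / 2000 := Nat.floor_le (by positivity)
  have hhY2 : Y / 2000 < h + 1 := Nat.lt_floor_add_one _
  have hhl : Y ≤ 4000 * h := by linarith
  have hhn : 2000 * h ≤ n := by
    have : (2000:ℝ) * h ≤ n := by linarith
    exact_mod_cast this
  have hhN : 4 * N ≤ h := by
    have : (4:ℝ) * N ≤ h := by linarith
    exact_mod_cast this
  suffices h ≤ 288 * N * d by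
    have h' : (h:ℝ) ≤ 288 * N * d := by exact_mod_cast this
    linarith
  obtain ⟨P', hP', herr'⟩ := boost f P ε hε2 hP herr N hN1
  set μ := min (n / 200) (h ^ 2 / N) with hμ
  have hμ1 : μ ≤ n / 200 := min_le_left _ _
  have hμ2 : μ ≤ h ^ 2 / N := min_le_right _ _
  have h4 : 4 * h ≤ μ := by
    rw [hμ, le_min_iff]
    refine ⟨by omega, ?_⟩
    rw [Nat.le_div_iff_mul_le (by omega)]
    nlinarith
  have hμpos : (0:ℝ) < μ := by exact_mod_cast (by omega : 0 < μ)
  refine final_nat (μ := μ) (N := N) p hp f specF specG hf hG hmin hb1 ?_ P' hP' _ herr' h4 (by omega) (by omega) hnexp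
    ?_ (le_min hεpos.le (Real.exp_pos _).le) ?_ ?_
  · rcases hcase with hc | hc
    · exact Or.inl hc
    · right
      have : (16:ℝ) * h + 1 < period n specG := by linarith
      exact_mod_cast this
  · exact (Nat.mul_le_mul_right N hμ2).trans (Nat.div_mul_le_self _ _)
  · refine (min_le_right _ _).trans (Real.exp_le_exp.2 ?_)
    linarith
  · rcases min_choice (n / 200) (h ^ 2 / N) with hc | hc
    · rw [← hμ] at hc
      refine (min_le_left _ _).trans ?_
      rw [hεexp]
      apply Real.exp_le_exp.2
      have hn400 : (n:ℝ) ≤ 400 * μ := by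
        have : n ≤ 400 * μ := by omega
        exact_mod_cast this
      have hl2 : (0.6:ℝ) ≤ Real.log 2 := by have := Real.log_two_gt_d9; linarith
      rw [neg_le_neg_iff, div_le_iff₀ hμpos]
      have hh2 : (h:ℝ)^2 ≤ (Y/2000)^2 := pow_le_pow_left₀ (by positivity) hhY 2
      have a1 : (n:ℝ) * Λ ≤ 400 * μ * Λ := by gcongr
      have a2 : 0 ≤ (μ:ℝ) * Λ := by positivity
      have a3 : μ * Λ * 0.6 ≤ μ * Λ * Real.log 2 := by gcongr
      nlinarith
    · rw [← hμ] at hc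
      refine (min_le_right _ _).trans ?_
      apply Real.exp_le_exp.2
      rw [neg_le_neg_iff, div_le_iff₀ hμpos]
      have b1 : h ^ 2 < N * (h ^ 2 / N + 1) := by
        exact Nat.lt_mul_div_succ _ (by omega)
      rw [← hc] at b1
      have b2 : h ^ 2 ≤ 2 * (N * μ) := by nlinarith
      have b3 : (h:ℝ)^2 ≤ 2 * (N * μ) := by exact_mod_cast b2
      linarith
end PD

/-- lower bound for `pdeg_ε(f)` in terms of the periodic part of
its standard decomposition: case (i) `per(g) > 1` not a power of `p`, and
case (ii) `per(g) > 1` a power of `p`. -/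
theorem stmt6 :
    ∃ c : ℝ, 0 < c ∧
      ∀ (F : Type) [Field F] (p : ℕ) [CharP F p], (p = 0 ∨ p.Prime) →
        ∀ n : ℕ, 2 ≤ n →
          ∀ (f : (Fin n → Bool) → Bool) (specF specG : ℕ → Bool),
            (∀ a, f a = specF (wt a)) →
            (∀ i, (n + 2) / 3 ≤ i → i ≤ 2 * n / 3 → specG i = specF i) →
            (∀ specG' : ℕ → Bool,
              (∀ i, (n + 2) / 3 ≤ i → i ≤ 2 * n / 3 → specG' i = specF i) →
              period n specG ≤ period n specG') →
            ∀ ε : ℝ, 1 / (2:ℝ)^n ≤ ε → ε ≤ 1/3 →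
              (1 < period n specG → ¬(∃ t : ℕ, period n specG = p ^ t) →
                c * Real.sqrt (n * Real.logb 2 (1/ε)) / (Real.logb 2 n)^2
                  ≤ (pdeg F f ε : ℝ)) ∧
              (1 < period n specG → (∃ t : ℕ, period n specG = p ^ t) →
                c * min (period n specG : ℝ) (Real.sqrt (n * Real.logb 2 (1/ε)))
                    / (Real.logb 2 n)^2
                  ≤ (pdeg F f ε : ℝ)) := by
  refine ⟨1 / 10^7, by norm_num, ?_⟩
  intro F _ p _ hp n hn2 f specF specG hf hG hmin ε hε1 hε2
  refine ⟨fun hb1 hc => ?_, fun hb1 _ => ?_⟩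
  · exact PD.final_real p hp hn2 f specF specG hf hG hmin hb1 ε hε1 hε2 _ (Real.sqrt_nonneg _)
      le_rfl (Or.inl hc)
  · exact PD.final_real p hp hn2 f specF specG hf hG hmin hb1 ε hε1 hε2 _
      (le_min (Nat.cast_nonneg _) (Real.sqrt_nonneg _)) (min_le_right _ _) (Or.inr (min_le_left _ _))
end
end

section
/- There is a constant c > 0 such that for every field F, every n ≥ 1, every ε ∈ (1/2^n, 1/5), and every Boolean function g : {0,1}^n → {0,1} that agrees with the Majority function Maj_n on at least a (1−ε) fraction of the 2^n inputs, pdeg^F_ε(g) ≥ c·√(n·log(1/ε)). -/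
noncomputable section

open scoped BigOperators

namespace Smol

variable {F : Type} [Field F] {n : ℕ}

/-- Multilinear monomial as a function on the cube. -/
def mono (F : Type) [Field F] {n : ℕ} (T : Finset (Fin n)) : (Fin n → Bool) → F :=
  fun a => ∏ i ∈ T, bF F (a i)

/-- Functions on the cube of degree at most `k`. -/
def V (F : Type) [Field F] (n k : ℕ) : Submodule F ((Fin n → Bool) → F) :=
  Submodule.span F (mono F '' {T : Finset (Fin n) | T.card ≤ k})

lemma mono_mem {T : Finset (Fin n)} {k : ℕ} (h : T.card ≤ k) : mono F T ∈ V F n k :=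
  Submodule.subset_span ⟨T, h, rfl⟩

lemma V_mono {k l : ℕ} (h : k ≤ l) : V F n k ≤ V F n l :=
  Submodule.span_mono (Set.image_mono fun _ hT => le_trans hT h)

lemma bF_idem (b : Bool) : bF F b * bF F b = bF F b := by
  cases b <;> simp [bF]

lemma bF_pow (b : Bool) (k : ℕ) (hk : k ≠ 0) : bF F b ^ k = bF F b := by
  cases b <;> simp [bF, hk]

lemma mono_mul (T U : Finset (Fin n)) : mono F T * mono F U = mono F (T ∪ U) := by
  classical
  funext a
  have key : ∀ W : Finset (Fin n), mono F W a = if ∀ i ∈ W, a i = true then 1 else 0 := by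
    intro W
    unfold mono bF
    split_ifs with h
    · exact Finset.prod_eq_one fun i hi => by simp [h i hi]
    · push Not at h
      obtain ⟨i, hi, h⟩ := h
      exact Finset.prod_eq_zero hi (by simp [h])
  rw [Pi.mul_apply, key, key, key]
  by_cases h1 : ∀ i ∈ T, a i = true <;> by_cases h2 : ∀ i ∈ U, a i = true
  · rw [if_pos h1, if_pos h2, if_pos]; · simp
    intro i hi; rcases Finset.mem_union.1 hi with h | h
    · exact h1 i h
    · exact h2 i h
  · rw [if_neg h2, if_neg (c := ∀ i ∈ T ∪ U, a i = true)]; · exact mul_zero _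
    intro h; exact h2 fun i hi => h i (Finset.mem_union_right _ hi)
  · rw [if_neg h1, if_neg (c := ∀ i ∈ T ∪ U, a i = true)]; · exact zero_mul _
    intro h; exact h1 fun i hi => h i (Finset.mem_union_left _ hi)
  · rw [if_neg h1, if_neg (c := ∀ i ∈ T ∪ U, a i = true)]; · exact zero_mul _
    intro h; exact h1 fun i hi => h i (Finset.mem_union_left _ hi)

lemma mul_mem_V {k l : ℕ} {f g : (Fin n → Bool) → F} (hf : f ∈ V F n k) (hg : g ∈ V F n l) :
    f * g ∈ V F n (k + l) := by
  have h := Submodule.mul_mem_mul hf hg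
  unfold V at h
  rw [Submodule.span_mul_span] at h
  refine (Submodule.span_le.2 ?_) h
  rintro _ ⟨_, ⟨T, hT, rfl⟩, _, ⟨U, hU, rfl⟩, rfl⟩
  simp only [mono_mul]
  exact mono_mem ((Finset.card_union_le _ _).trans (add_le_add hT hU))

lemma one_mem_V (k : ℕ) : (1 : (Fin n → Bool) → F) ∈ V F n k := by
  have : (1 : (Fin n → Bool) → F) = mono F ∅ := by funext a; simp [mono]
  rw [this]; exact mono_mem (by simp)

lemma prod_mem_V (s : Finset (Fin n)) (f : Fin n → (Fin n → Bool) → F)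
    (hf : ∀ i, f i ∈ V F n 1) : ∏ i ∈ s, f i ∈ V F n s.card := by
  classical
  induction s using Finset.induction_on with
  | empty => simpa using one_mem_V 0
  | insert i s hi ih =>
    rw [Finset.prod_insert hi, Finset.card_insert_of_notMem hi, add_comm]
    exact mul_mem_V (hf i) ih

lemma eval_mem_V (p : MvPolynomial (Fin n) F) (d : ℕ) (hd : p.totalDegree ≤ d) :
    (fun a : Fin n → Bool => MvPolynomial.eval (fun v => bF F (a v)) p) ∈ V F n d := by
  have : (fun a : Fin n → Bool => MvPolynomial.eval (fun v => bF F (a v)) p)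
      = ∑ m ∈ p.support, p.coeff m • mono F m.support := by
    funext a
    rw [MvPolynomial.eval_eq, Finset.sum_apply]
    refine Finset.sum_congr rfl fun m _ => ?_
    simp only [Pi.smul_apply, smul_eq_mul, mono]
    congr 1
    exact Finset.prod_congr rfl fun i hi => bF_pow _ _ (Finsupp.mem_support_iff.1 hi)
  rw [this]
  refine Submodule.sum_mem _ fun m hm => Submodule.smul_mem _ _ (mono_mem ?_)
  refine le_trans ?_ ((MvPolynomial.le_totalDegree hm).trans hd)
  rw [Finsupp.sum, Finset.card_eq_sum_ones]
  exact Finset.sum_le_sum fun i hi => Nat.one_le_iff_ne_zero.2 (Finsupp.mem_support_iff.1 hi)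

lemma exists_poly (f : (Fin n → Bool) → F) : ∃ p : MvPolynomial (Fin n) F,
    ∀ a : Fin n → Bool, MvPolynomial.eval (fun v => bF F (a v)) p = f a := by
  classical
  refine ⟨∑ b : Fin n → Bool, MvPolynomial.C (f b) *
    ∏ i, (if b i then MvPolynomial.X i else 1 - MvPolynomial.X i), fun a => ?_⟩
  rw [map_sum, Finset.sum_eq_single a]
  · rw [map_mul, map_prod, Finset.prod_eq_one]
    · simp
    · intro i _
      cases h : a i <;> simp [bF, h]
  · intro b _ hb
    obtain ⟨i, hi⟩ := Function.ne_iff.1 hb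
    rw [map_mul, map_prod, Finset.prod_eq_zero (Finset.mem_univ i), mul_zero]
    cases h : a i <;> cases h' : b i <;> simp_all [bF]
  · simp

lemma low_interp (f : (Fin n → Bool) → F) (k : ℕ) :
    ∃ h ∈ V F n k, ∀ a, wt a ≤ k → h a = f a := by
  obtain ⟨p, hp⟩ := exists_poly f
  have h1 := eval_mem_V p _ le_rfl
  rw [show (fun a : Fin n → Bool => MvPolynomial.eval (fun v => bF F (a v)) p) = f from
    funext hp] at h1
  clear hp
  unfold V at h1
  induction h1 using Submodule.span_induction with
  | mem x hx =>
    obtain ⟨T, -, rfl⟩ := hx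
    by_cases hT : T.card ≤ k
    · exact ⟨_, mono_mem hT, fun _ _ => rfl⟩
    · refine ⟨0, Submodule.zero_mem _, fun a ha => ?_⟩
      have : ∃ i ∈ T, a i = false := by
        by_contra! hcon
        apply hT
        refine le_trans (Finset.card_le_card ?_) ha
        intro i hi
        simpa using hcon i hi
      obtain ⟨i, hi, hai⟩ := this
      exact (Finset.prod_eq_zero hi (by simp [bF, hai])).symm
  | zero => exact ⟨0, Submodule.zero_mem _, fun _ _ => rfl⟩
  | add x y _ _ hx hy =>
    obtain ⟨u, hu, hu'⟩ := hx
    obtain ⟨v, hv, hv'⟩ := hy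
    exact ⟨u + v, Submodule.add_mem _ hu hv, fun a ha => by simp [hu' a ha, hv' a ha]⟩
  | smul c x _ hx =>
    obtain ⟨u, hu, hu'⟩ := hx
    exact ⟨c • u, Submodule.smul_mem _ _ hu, fun a ha => by simp [hu' a ha]⟩

lemma wt_not (a : Fin n → Bool) : wt (fun i => !a i) + wt a = n := by
  unfold wt
  have := Finset.card_filter_add_card_filter_not (s := (Finset.univ : Finset (Fin n)))
    (fun i => a i = true)
  simp at this ⊢
  omega

lemma flip_mem_V {k : ℕ} {f : (Fin n → Bool) → F} (hf : f ∈ V F n k) :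
    (fun a => f (fun i => !a i)) ∈ V F n k := by
  unfold V at hf
  induction hf using Submodule.span_induction with
  | mem x hx =>
    obtain ⟨T, hT, rfl⟩ := hx
    refine V_mono hT ?_
    have : (fun a : Fin n → Bool => mono F T (fun i => !a i))
        = ∏ i ∈ T, ((1 : (Fin n → Bool) → F) - mono F {i}) := by
      funext a
      rw [Finset.prod_apply]
      refine Finset.prod_congr rfl fun i _ => ?_
      cases h : a i <;> simp [mono, bF, h]
    rw [this]
    exact prod_mem_V T _ fun i => Submodule.sub_mem _ (one_mem_V 1) (mono_mem (by simp))
  | zero => exact Submodule.zero_mem _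
  | add x y _ _ hx hy => exact Submodule.add_mem _ hx hy
  | smul c x _ hx => exact Submodule.smul_mem _ c hx

lemma high_interp (f : (Fin n → Bool) → F) (k : ℕ) :
    ∃ h ∈ V F n k, ∀ a, n ≤ wt a + k → h a = f a := by
  obtain ⟨h, hh, hf⟩ := low_interp (fun a => f (fun i => !a i)) k
  refine ⟨_, flip_mem_V hh, fun a ha => ?_⟩
  have := hf (fun i => !a i) (by have := wt_not a; omega)
  simpa using this

lemma finrank_V (k : ℕ) : Module.finrank F (V F n k) ≤
    (Finset.univ.filter fun T : Finset (Fin n) => T.card ≤ k).card := by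
  classical
  have : V F n k = Submodule.span F
      (((Finset.univ.filter fun T : Finset (Fin n) => T.card ≤ k).image (mono F) : Finset _) :
        Set ((Fin n → Bool) → F)) := by
    unfold V; congr 1; simp
  rw [this]
  exact (finrank_span_finset_le_card _).trans Finset.card_image_le

lemma card_wt (P : ℕ → Prop) [DecidablePred P] :
    (Finset.univ.filter fun a : Fin n → Bool => P (wt a)).card =
    (Finset.univ.filter fun T : Finset (Fin n) => P T.card).card := by
  classical
  refine Finset.card_bij' (fun a _ => Finset.univ.filter fun i => a i = true)
    (fun T _ => fun i => decide (i ∈ T)) ?_ ?_ ?_ ?_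
  · intro a ha
    rw [Finset.mem_filter] at ha ⊢
    exact ⟨Finset.mem_univ _, ha.2⟩
  · intro T hT
    rw [Finset.mem_filter] at hT ⊢
    refine ⟨Finset.mem_univ _, ?_⟩
    have : wt (fun i => decide (i ∈ T)) = T.card := by simp [wt]
    rw [this]; exact hT.2
  · intro a _; funext i; simp
  · intro T _; ext i; simp

open Classical in
lemma smolensky {d : ℕ} {p : (Fin n → Bool) → F} (hp : p ∈ V F n d) :
    (Finset.univ.filter fun a : Fin n → Bool => p a = bF F (decide (n < 2 * wt a))).card ≤
    (Finset.univ.filter fun a : Fin n → Bool => wt a ≤ n / 2 + d).card := by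
  set S := Finset.univ.filter fun a : Fin n → Bool => p a = bF F (decide (n < 2 * wt a)) with hS
  let r : V F n (n / 2 + d) →ₗ[F] (S → F) :=
    (LinearMap.funLeft F F (fun s : S => (s : Fin n → Bool))).comp (V F n (n/2+d)).subtype
  have hr : Function.Surjective r := by
    intro f
    let f' : (Fin n → Bool) → F := fun a => if h : a ∈ S then f ⟨a, h⟩ else 0
    obtain ⟨A, hA, hA'⟩ := low_interp f' (n / 2)
    obtain ⟨B, hB, hB'⟩ := high_interp f' (n / 2)
    refine ⟨⟨A + (B - A) * p, Submodule.add_mem _ (V_mono (Nat.le_add_right _ _) hA)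
      (mul_mem_V (Submodule.sub_mem _ hB hA) hp)⟩, ?_⟩
    funext ⟨a, ha⟩
    have hpa : p a = bF F (decide (n < 2 * wt a)) := by simpa [hS] using ha
    have hfa : f' a = f ⟨a, ha⟩ := by simp [f', ha]
    change A a + (B a - A a) * p a = _
    rw [hpa, ← hfa]
    by_cases h : n < 2 * wt a
    · rw [hB' a (by omega)]; simp [h, bF]
    · rw [hA' a (by omega)]; simp [h, bF]
  have h1 := LinearMap.finrank_le_finrank_of_surjective hr
  rw [Module.finrank_fintype_fun_eq_card, Fintype.card_coe] at h1
  rw [card_wt (fun w => w ≤ n / 2 + d)]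
  exact h1.trans (finrank_V _)

open Classical in
lemma average (P : ProbPoly F n) (g : (Fin n → Bool) → Bool) (ε : ℝ)
    (h : ∀ a, errAt P g a ≤ ε) : ∃ i,
    ((Finset.univ.filter fun a : Fin n → Bool =>
      ¬ MvPolynomial.eval (fun v => bF F (a v)) (P.poly i) = bF F (g a)).card : ℝ) ≤ ε * 2 ^ n := by
  by_contra! hcon
  have h1 : ∑ a, errAt P g a ≤ ε * 2 ^ n := by
    refine (Finset.sum_le_sum fun a _ => h a).trans ?_
    simp [mul_comm]
  unfold errAt at h1
  rw [Finset.sum_comm] at h1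
  have h2 : ∀ i, ∑ a : Fin n → Bool,
      (if MvPolynomial.eval (fun v => bF F (a v)) (P.poly i) = bF F (g a) then 0 else P.w i)
      = P.w i * ((Finset.univ.filter fun a : Fin n → Bool =>
      ¬ MvPolynomial.eval (fun v => bF F (a v)) (P.poly i) = bF F (g a)).card : ℝ) := by
    intro i
    rw [Finset.card_filter]
    push_cast
    rw [Finset.mul_sum]
    exact Finset.sum_congr rfl fun a _ => by split_ifs <;> simp_all
  simp_rw [h2] at h1
  have h3 : ∃ i, 0 < P.w i := by
    by_contra! hw
    have := Finset.sum_nonpos (s := Finset.univ) fun i _ => hw i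
    rw [P.w_sum] at this; linarith
  obtain ⟨i, hi⟩ := h3
  have h4 : ∑ i, P.w i * (ε * 2 ^ n) < ∑ i, P.w i * ((Finset.univ.filter fun a : Fin n → Bool =>
      ¬ MvPolynomial.eval (fun v => bF F (a v)) (P.poly i) = bF F (g a)).card : ℝ) :=
    Finset.sum_lt_sum (fun i _ => mul_le_mul_of_nonneg_left (hcon i).le (P.w_nonneg i))
      ⟨i, Finset.mem_univ _, mul_lt_mul_of_pos_left (hcon i) hi⟩
  rw [← Finset.sum_mul, P.w_sum] at h4
  linarith

lemma pdeg_spec (g : (Fin n → Bool) → Bool) (ε : ℝ) (hε : 0 ≤ ε) :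
    ∃ P : ProbPoly F n, (∀ i, (P.poly i).totalDegree ≤ pdeg F g ε) ∧ ∀ a, errAt P g a ≤ ε := by
  have : {d | ∃ P : ProbPoly F n, (∀ i, (P.poly i).totalDegree ≤ d) ∧
      ∀ a, errAt P g a ≤ ε}.Nonempty := by
    obtain ⟨p, hp⟩ := exists_poly (fun a => bF F (g a))
    refine ⟨p.totalDegree, ⟨1, fun _ => 1, fun _ => zero_le_one, by simp, fun _ => p⟩,
      fun _ => le_rfl, fun a => ?_⟩
    simp [errAt, hp, hε]
  exact Nat.sInf_mem this

/-- Degree zero with small error forces a constant function. -/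
lemma const_of_zero (P : ProbPoly F n) (g : (Fin n → Bool) → Bool) (ε : ℝ) (hε : ε < 1/5)
    (h0 : ∀ i, (P.poly i).totalDegree ≤ 0) (h : ∀ a, errAt P g a ≤ ε) (a b : Fin n → Bool) :
    g a = g b := by
  classical
  by_contra hab
  have h1 : (1 : ℝ) ≤ errAt P g a + errAt P g b := by
    unfold errAt
    rw [← P.w_sum, ← Finset.sum_add_distrib]
    refine Finset.sum_le_sum fun i _ => ?_
    have hC := MvPolynomial.totalDegree_eq_zero_iff_eq_C.1 (Nat.le_zero.1 (h0 i))
    rw [hC]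
    have hw := P.w_nonneg i
    have hne : bF F (g a) ≠ bF F (g b) := by
      cases h1 : g a <;> cases h2 : g b <;> simp_all [bF]
    simp only [MvPolynomial.eval_C]
    split_ifs with h1 h2 <;> first | exact absurd (h1.symm.trans h2) hne | linarith
  have := h a; have := h b; linarith

end Smol

namespace Smol

/-- Central binomial upper bound. -/
lemma cb_bound (k : ℕ) : (2 * k + 1) * k.centralBinom ^ 2 ≤ 16 ^ k := by
  induction k with
  | zero => simp
  | succ k ih =>
    have h := Nat.succ_mul_centralBinom_succ k
    have h2 : (k + 1) ^ 2 * ((2 * (k + 1) + 1) * (k+1).centralBinom ^ 2)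
        ≤ (k + 1) ^ 2 * 16 ^ (k + 1) := by
      calc (k + 1) ^ 2 * ((2 * (k + 1) + 1) * (k+1).centralBinom ^ 2)
          = (2 * k + 3) * ((k + 1) * (k + 1).centralBinom) ^ 2 := by ring
        _ = 4 * ((2 * k + 3) * (2 * k + 1)) * ((2 * k + 1) * k.centralBinom ^ 2) := by
            rw [h]; ring
        _ ≤ 4 * (4 * (k + 1) ^ 2) * 16 ^ k := by
            refine Nat.mul_le_mul (Nat.mul_le_mul_left 4 ?_) ih
            nlinarith
        _ = _ := by ring
    exact Nat.le_of_mul_le_mul_left h2 (by positivity)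

lemma mid_bound (n : ℕ) : (n + 1) * (n.choose (n / 2)) ^ 2 ≤ 4 ^ n := by
  obtain ⟨k, rfl | rfl⟩ := Nat.even_or_odd' n
  · have := cb_bound k
    rw [Nat.centralBinom_eq_two_mul_choose] at this
    rw [show 2 * k / 2 = k by omega, pow_mul]
    exact this
  · have := cb_bound (k + 1)
    rw [Nat.centralBinom_eq_two_mul_choose] at this
    have h2 : (2 * (k + 1)).choose (k + 1) = 2 * (2 * k + 1).choose k := by
      rw [show 2 * (k + 1) = (2 * k + 1) + 1 by ring, Nat.choose_succ_succ,
        Nat.choose_symm_half]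
      ring
    rw [h2] at this
    rw [show (2 * k + 1) / 2 = k by omega, pow_succ 4, pow_mul]
    norm_num
    rw [pow_succ 16] at this
    nlinarith [sq_nonneg ((2 * k + 1).choose k)]

/-- The number of points of weight greater than `k`. -/
def T (n k : ℕ) : ℕ := ∑ j ∈ Finset.Ioc k n, n.choose j

lemma card_gt (n k : ℕ) :
    (Finset.univ.filter fun a : Fin n → Bool => k < wt a).card = T n k := by
  rw [card_wt (fun w => k < w)]
  have : (Finset.univ.filter fun U : Finset (Fin n) => k < U.card)
      = (Finset.Ioc k n).biUnion fun j => Finset.powersetCard j Finset.univ := by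
    ext U
    have := Finset.card_le_univ U
    simp at this
    simp [Finset.mem_powersetCard, this]
  rw [this, Finset.card_biUnion]
  · simp [T]
  · intro i _ j _ hij
    exact Finset.pairwise_disjoint_powersetCard _ hij

lemma T_half_le (n : ℕ) : 2 * T n (n / 2) ≤ 2 ^ n := by
  have h : T n (n/2) ≤ (Finset.univ.filter fun a : Fin n → Bool => ¬ n / 2 < wt a).card := by
    rw [← card_gt]
    refine Finset.card_le_card_of_injOn (fun a i => !a i) ?_ ?_
    · intro a ha
      have := wt_not a
      simp at ha ⊢
      omega
    · intro a _ b _ h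
      funext i
      simpa using congrFun h i
  have h2 := Finset.card_filter_add_card_filter_not (s := (Finset.univ : Finset (Fin n → Bool)))
    (fun a => n / 2 < wt a)
  rw [card_gt] at h2
  simp only [Finset.card_univ, Fintype.card_pi, Fintype.card_bool, Finset.prod_const,
    Fintype.card_fin] at h2
  omega

lemma T_half_ge (n : ℕ) : 2 ^ n ≤ 2 * T n (n / 2) + n.choose (n / 2) := by
  have h : (Finset.univ.filter fun a : Fin n → Bool => wt a < n / 2).card ≤ T n (n/2) := by
    rw [← card_gt]
    refine Finset.card_le_card_of_injOn (fun a i => !a i) ?_ ?_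
    · intro a ha
      have := wt_not a
      simp at ha ⊢
      omega
    · intro a _ b _ h
      funext i
      simpa using congrFun h i
  have h3 : (Finset.univ.filter fun a : Fin n → Bool => wt a = n / 2).card
      = n.choose (n / 2) := by
    rw [card_wt (fun w => w = n / 2), ← Finset.powerset_univ, ← Finset.powersetCard_eq_filter]
    simp
  have h4 : (Finset.univ.filter fun a : Fin n → Bool => ¬ n / 2 < wt a).card ≤
      (Finset.univ.filter fun a : Fin n → Bool => wt a < n / 2).card +
      (Finset.univ.filter fun a : Fin n → Bool => wt a = n / 2).card := by
    classical
    rw [← Finset.card_union_of_disjoint]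
    · refine Finset.card_le_card fun a ha => ?_
      simp at ha ⊢
      omega
    · rw [Finset.disjoint_filter]; intro a _ h; omega
  have h2 := Finset.card_filter_add_card_filter_not (s := (Finset.univ : Finset (Fin n → Bool)))
    (fun a => n / 2 < wt a)
  rw [card_gt] at h2
  simp only [Finset.card_univ, Fintype.card_pi, Fintype.card_bool, Finset.prod_const,
    Fintype.card_fin] at h2
  omega

lemma T_shift (n k d : ℕ) : T n k ≤ T n (k + d) + d * n.choose (n / 2) := by
  have : Finset.Ioc k n ⊆ Finset.Ioc (k + d) n ∪ Finset.Ioc k (k + d) := by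
    intro x; simp; omega
  refine (Finset.sum_le_sum_of_subset this).trans ?_
  rw [Finset.sum_union]
  · have h := Finset.sum_le_card_nsmul (Finset.Ioc k (k + d)) (fun j => n.choose j)
      (n.choose (n / 2)) (fun j _ => Nat.choose_le_middle j n)
    simp at h
    unfold T
    omega
  · rw [Finset.disjoint_left]; intro x; simp; omega

lemma choose_anti (n i j : ℕ) (hi : n / 2 ≤ i) (hij : i ≤ j) : n.choose j ≤ n.choose i := by
  induction j, hij using Nat.le_induction with
  | base => exact le_rfl
  | succ j hij ih =>
    refine le_trans ?_ ih
    have h := Nat.choose_succ_right_eq n j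
    have h2 : n.choose j * (n - j) ≤ n.choose j * (j + 1) := Nat.mul_le_mul_left _ (by omega)
    rw [← h] at h2
    exact Nat.le_of_mul_le_mul_right h2 (by omega)

/-- Gaussian lower bound for binomial coefficients. -/
lemma choose_lower (n j : ℕ) (hj : 4 * j ≤ n / 2 + 1) :
    (n.choose (n / 2) : ℝ) * (4:ℝ) ^ (-((j:ℝ) ^ 2 / ((n / 2 : ℕ) + 1 : ℝ))) ≤
      n.choose (n / 2 + j) := by
  induction j with
  | zero => simp
  | succ j ih =>
    have ih := ih (by omega)
    set m := n / 2 with hm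
    have hrec : (n.choose (m + j + 1) : ℝ) * (m + j + 1) = n.choose (m + j) * (n - (m + j) : ℝ) := by
      have := Nat.choose_succ_right_eq n (m + j)
      have h2 : m + j ≤ n := by omega
      have := congrArg (Nat.cast : ℕ → ℝ) this
      push_cast [Nat.cast_sub h2] at this
      linarith
    have hmn : (2 * m : ℝ) ≤ n := by
      have : 2 * m ≤ n := by omega
      exact_mod_cast this
    have hj' : (4 * (j + 1) : ℝ) ≤ m + 1 := by exact_mod_cast hj
    set x : ℝ := (2 * j + 1) / (m + 1) with hx
    have hm1 : (0:ℝ) < m + 1 := by positivity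
    have hx0 : 0 ≤ x := by positivity
    have hx1 : x ≤ 1 / 2 := by rw [hx, div_le_iff₀ hm1]; linarith
    -- 4^{-x} ≤ 1 - x
    have hconv : (4:ℝ) ^ (-x) ≤ 1 - x := by
      have hc := convexOn_exp.2 (Set.mem_univ (0:ℝ)) (Set.mem_univ (-Real.log 2))
        (show (0:ℝ) ≤ 1 - 2 * x by linarith) (show (0:ℝ) ≤ 2 * x by linarith) (by ring)
      simp only [smul_eq_mul, mul_zero, zero_add, Real.exp_zero, Real.exp_neg,
        Real.exp_log (show (0:ℝ) < 2 by norm_num)] at hc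
      rw [Real.rpow_def_of_pos (by norm_num), show (4:ℝ) = 2 ^ 2 by norm_num, Real.log_pow]
      rw [show ((2:ℕ):ℝ) * Real.log 2 * -x = 2 * x * -Real.log 2 by push_cast; ring]
      linarith
    have hfac : (1 - x) * (m + j + 1) ≤ (n - (m + j) : ℝ) := by
      have : x * (m + j + 1) ≥ 2 * j + 1 := by
        have : x * (m + 1) = 2 * j + 1 := by rw [hx]; field_simp
        nlinarith [mul_nonneg hx0 (Nat.cast_nonneg (α := ℝ) j)]
      linarith
    have hexp : (4:ℝ) ^ (-(((j + 1 : ℕ):ℝ) ^ 2 / (m + 1 : ℝ)))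
        = (4:ℝ) ^ (-((j:ℝ) ^ 2 / (m + 1 : ℝ))) * (4:ℝ) ^ (-x) := by
      rw [← Real.rpow_add (by norm_num)]
      congr 1
      rw [hx]; push_cast; field_simp; ring
    rw [hexp, ← add_assoc]
    have hpos : (0:ℝ) < m + j + 1 := by positivity
    refine le_of_mul_le_mul_right ?_ hpos
    rw [hrec]
    calc _ = ((n.choose m : ℝ) * (4:ℝ) ^ (-((j:ℝ) ^ 2 / (m + 1 : ℝ)))) *
            ((4:ℝ) ^ (-x) * (m + j + 1)) := by ring
      _ ≤ (n.choose (m + j) : ℝ) * ((1 - x) * (m + j + 1)) := by gcongr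
      _ ≤ _ := by gcongr

lemma T_lower (n d : ℕ) (hd : n / 2 + 2 * d ≤ n) :
    d * n.choose (n / 2 + 2 * d) ≤ T n (n / 2 + d) := by
  have h1 : Finset.Ioc (n / 2 + d) (n / 2 + 2 * d) ⊆ Finset.Ioc (n / 2 + d) n :=
    Finset.Ioc_subset_Ioc_right hd
  refine le_trans ?_ (Finset.sum_le_sum_of_subset h1)
  have h2 : ∀ j ∈ Finset.Ioc (n / 2 + d) (n / 2 + 2 * d),
      n.choose (n / 2 + 2 * d) ≤ n.choose j := by
    intro j hj
    simp at hj
    exact choose_anti n j _ (by omega) hj.2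
  have := Finset.card_nsmul_le_sum _ _ _ h2
  simp at this
  rwa [show n / 2 + 2 * d - (n / 2 + d) = d by omega] at this

end Smol

namespace Smol

/-- The numerical heart of the lower bound. -/
lemma numeric (n d : ℕ) (ε : ℝ) (hn : 1 ≤ n) (hd : 1 ≤ d) (h1 : 1 / (2:ℝ)^n < ε) (h2 : ε < 1/5)
    (hT : (T n (n / 2 + d) : ℝ) ≤ 2 * ε * 2 ^ n) :
    (1/54 : ℝ) * Real.sqrt (n * Real.logb 2 (1/ε)) ≤ d := by
  have hε : 0 < ε := lt_trans (by positivity) h1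
  set L := Real.logb 2 (1/ε) with hL
  have hεL : ε = (2:ℝ) ^ (-L) := by
    rw [hL, one_div, Real.logb_inv, neg_neg, Real.rpow_logb (by norm_num) (by norm_num) hε]
  have hLn : L ≤ n := by
    by_contra! hcon
    rw [hεL, one_div, ← Real.rpow_natCast, ← Real.rpow_neg (by norm_num),
      Real.rpow_lt_rpow_left_iff (by norm_num)] at h1
    linarith
  have hnR : (1:ℝ) ≤ n := by exact_mod_cast hn
  have hdR : (1:ℝ) ≤ d := by exact_mod_cast hd
  suffices h : n * L ≤ (54 * d) ^ 2 by
    have := Real.sqrt_le_sqrt h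
    rw [Real.sqrt_sq (by positivity)] at this
    linarith
  by_cases hbig : 4 * (2 * d) ≤ n / 2 + 1
  swap
  · have h3 : n ≤ 16 * d := by omega
    have h3 : (n:ℝ) ≤ 16 * d := by exact_mod_cast h3
    nlinarith
  set M : ℝ := (n.choose (n / 2) : ℝ) with hM
  have hMpos : 0 < M := by
    have : 0 < n.choose (n / 2) := Nat.choose_pos (by omega)
    rw [hM]; exact_mod_cast this
  have hN : (0:ℝ) < 2 ^ n := by positivity
  -- central mass
  have hA : (2:ℝ) ^ n / 20 ≤ d * M := by
    have ha : (2:ℝ) ^ n ≤ 2 * T n (n/2) + M := by rw [hM]; exact_mod_cast T_half_ge n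
    have hb : (T n (n/2) : ℝ) ≤ T n (n / 2 + d) + d * M := by rw [hM]; exact_mod_cast T_shift n (n/2) d
    nlinarith
  have hB : (n + 1) * M ^ 2 ≤ ((2:ℝ) ^ n) ^ 2 := by
    rw [← pow_mul, mul_comm n 2, pow_mul]
    norm_num
    rw [hM]; exact_mod_cast mid_bound n
  have hC : (n:ℝ) ≤ 400 * d ^ 2 := by
    have h3 : ((2:ℝ) ^ n) ^ 2 ≤ (20 * (d * M)) ^ 2 := by
      apply pow_le_pow_left₀ hN.le; linarith
    have h4 : (n + 1) * M ^ 2 ≤ (400 * d ^ 2) * M ^ 2 := by nlinarith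
    have := le_of_mul_le_mul_right h4 (by positivity)
    linarith
  have hD := choose_lower n (2 * d) hbig
  have hE : (d : ℝ) * n.choose (n / 2 + 2 * d) ≤ T n (n / 2 + d) := by
    exact_mod_cast T_lower n d (by omega)
  have hm : (n:ℝ) / 2 ≤ ((n / 2 : ℕ) : ℝ) + 1 := by
    have : n ≤ 2 * (n / 2 + 1) := by omega
    have : (n:ℝ) ≤ 2 * (((n / 2 : ℕ) : ℝ) + 1) := by exact_mod_cast this
    linarith
  have hexp : (2:ℝ) ^ (-(16 * (d:ℝ) ^ 2 / n)) ≤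
      (4:ℝ) ^ (-(((2 * d : ℕ):ℝ) ^ 2 / ((n / 2 : ℕ) + 1 : ℝ))) := by
    rw [show (4:ℝ) = 2 ^ (2:ℝ) by norm_num, ← Real.rpow_mul (by norm_num)]
    apply Real.rpow_le_rpow_of_exponent_le (by norm_num)
    have : ((2 * d : ℕ):ℝ) ^ 2 / ((n / 2 : ℕ) + 1 : ℝ) ≤ 8 * (d:ℝ) ^ 2 / n := by
      rw [div_le_div_iff₀ (by positivity) (by positivity)]
      push_cast
      nlinarith [sq_nonneg (d:ℝ)]
    have h8 : 16 * (d:ℝ) ^ 2 / n = 2 * (8 * (d:ℝ) ^ 2 / n) := by ring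
    linarith
  set y := (2:ℝ) ^ (-(16 * (d:ℝ) ^ 2 / n)) with hy
  have hy0 : 0 < y := by positivity
  have hF : (2:ℝ) ^ n / 20 * y ≤ 2 * ε * 2 ^ n := by
    calc (2:ℝ) ^ n / 20 * y ≤ d * M * y := by gcongr
      _ = d * (M * y) := by ring
      _ ≤ d * (n.choose (n / 2 + 2 * d)) := by
          gcongr
          exact (mul_le_mul_of_nonneg_left hexp hMpos.le).trans hD
      _ ≤ _ := hE.trans hT
  have hG : y ≤ 2 ^ (6:ℝ) * ε := by
    have : (2:ℝ) ^ n * y ≤ 2 ^ n * (40 * ε) := by linarith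
    have := le_of_mul_le_mul_left this hN
    norm_num
    linarith
  rw [hεL, ← Real.rpow_add (by norm_num), hy, Real.rpow_le_rpow_left_iff (by norm_num)] at hG
  have hH : L ≤ 6 + 16 * (d:ℝ) ^ 2 / n := by linarith
  have : n * L ≤ n * (6 + 16 * (d:ℝ) ^ 2 / n) := by gcongr
  have h9 : n * (6 + 16 * (d:ℝ) ^ 2 / n) = 6 * n + 16 * (d:ℝ) ^ 2 := by field_simp
  nlinarith

open Classical in
lemma main (F : Type) [Field F] (n : ℕ) (hn : 1 ≤ n)
    (ε : ℝ) (h1 : 1 / (2:ℝ)^n < ε) (h2 : ε < 1/5) (g : (Fin n → Bool) → Bool)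
    (hg : (1 - ε) * 2^n ≤
      ((Finset.univ.filter
        fun a : Fin n → Bool => g a = decide (n < 2 * wt a)).card : ℝ)) :
    (1/54 : ℝ) * Real.sqrt (n * Real.logb 2 (1/ε)) ≤ (pdeg F g ε : ℝ) := by
  have hε : 0 < ε := lt_trans (by positivity) h1
  have hN : (0:ℝ) < 2 ^ n := by positivity
  obtain ⟨P, hP, herr⟩ := pdeg_spec (F := F) g ε hε.le
  have hsplit : ∀ k, ((Finset.univ.filter fun a : Fin n → Bool => wt a ≤ k).card : ℝ)
      = 2 ^ n - T n k := by
    intro k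
    have h2 := Finset.card_filter_add_card_filter_not (s := (Finset.univ : Finset (Fin n → Bool)))
      (fun a => k < wt a)
    rw [card_gt] at h2
    simp only [Finset.card_univ, Fintype.card_pi, Fintype.card_bool, Finset.prod_const,
      Fintype.card_fin, not_lt] at h2
    have : (T n k : ℝ) + ((Finset.univ.filter fun a : Fin n → Bool => wt a ≤ k).card : ℝ)
      = 2 ^ n := by exact_mod_cast h2
    linarith
  have hhalf : ∀ a : Fin n → Bool, n < 2 * wt a ↔ n / 2 < wt a := fun a => by omega
  have hd : 1 ≤ pdeg F g ε := by
    by_contra hd0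
    have hd0 : pdeg F g ε = 0 := by omega
    rw [hd0] at hP
    have hc := fun a => const_of_zero P g ε h2 hP herr a (fun _ => false)
    cases hb : g (fun _ => false)
    · simp only [hb] at hc
      have : (Finset.univ.filter fun a : Fin n → Bool => g a = decide (n < 2 * wt a))
          = Finset.univ.filter fun a : Fin n → Bool => wt a ≤ n / 2 := by
        ext a
        simp [hc a]
        omega
      rw [this, hsplit] at hg
      have ha : (2:ℝ) ^ n ≤ 2 * T n (n/2) + n.choose (n / 2) := by exact_mod_cast T_half_ge n
      have h3 : 3 ≤ n := by
        by_contra! h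
        interval_cases n <;> norm_num at h1 <;> linarith
      have hM : 2 * (n.choose (n / 2) : ℝ) ≤ 2 ^ n := by
        have hB : (n + 1) * (n.choose (n / 2) : ℝ) ^ 2 ≤ ((2:ℝ) ^ n) ^ 2 := by
          rw [← pow_mul, mul_comm n 2, pow_mul]
          norm_num
          exact_mod_cast mid_bound n
        have h3 : (3:ℝ) ≤ n := by exact_mod_cast h3
        refine le_of_sq_le_sq ?_ hN.le
        nlinarith [sq_nonneg (n.choose (n / 2) : ℝ)]
      nlinarith
    · simp only [hb] at hc
      have : (Finset.univ.filter fun a : Fin n → Bool => g a = decide (n < 2 * wt a))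
          = Finset.univ.filter fun a : Fin n → Bool => n / 2 < wt a := by
        ext a
        simp [hc a]
        omega
      rw [this, card_gt] at hg
      have ha : (2:ℝ) * T n (n/2) ≤ 2 ^ n := by exact_mod_cast T_half_le n
      nlinarith
  refine numeric n _ ε hn hd h1 h2 ?_
  obtain ⟨i, hi⟩ := average P g ε herr
  have hs := smolensky (eval_mem_V (P.poly i) _ (hP i))
  have hs' : ((Finset.univ.filter fun a : Fin n → Bool =>
      MvPolynomial.eval (fun v => bF F (a v)) (P.poly i) = bF F (decide (n < 2 * wt a))).card : ℝ)
      ≤ 2 ^ n - T n (n / 2 + pdeg F g ε) := by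
    rw [← hsplit]; exact_mod_cast hs
  have hsub : (Finset.univ.filter fun a : Fin n → Bool => g a = decide (n < 2 * wt a)).card ≤
      (Finset.univ.filter fun a : Fin n → Bool =>
      MvPolynomial.eval (fun v => bF F (a v)) (P.poly i) = bF F (decide (n < 2 * wt a))).card +
      (Finset.univ.filter fun a : Fin n → Bool =>
      ¬ MvPolynomial.eval (fun v => bF F (a v)) (P.poly i) = bF F (g a)).card := by
    refine le_trans (Finset.card_le_card ?_) (Finset.card_union_le _ _)
    intro a ha
    rw [Finset.mem_filter] at ha
    rw [Finset.mem_union, Finset.mem_filter, Finset.mem_filter, ← ha.2]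
    by_cases h : MvPolynomial.eval (fun v => bF F (a v)) (P.poly i) = bF F (g a)
    · exact Or.inl ⟨Finset.mem_univ _, h⟩
    · exact Or.inr ⟨Finset.mem_univ _, h⟩
  have hsub' := (Nat.cast_le (α := ℝ)).2 hsub
  push_cast at hsub'
  linarith

end Smol

/-- Smolensky's lower bound for functions agreeing with Majority
on a `1-ε` fraction of inputs. -/
theorem stmt7 :
    ∃ c : ℝ, 0 < c ∧
      ∀ (F : Type) [Field F] (n : ℕ), 1 ≤ n →
        ∀ ε : ℝ, 1 / (2:ℝ)^n < ε → ε < 1/5 →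
          ∀ g : (Fin n → Bool) → Bool,
            (1 - ε) * 2^n ≤
              ((Finset.univ.filter
                  fun a : Fin n → Bool => g a = decide (n < 2 * wt a)).card : ℝ) →
            c * Real.sqrt (n * Real.logb 2 (1/ε)) ≤ (pdeg F g ε : ℝ) := by
  exact ⟨1/54, by norm_num, fun F _ n hn ε h1 h2 g hg => Smol.main F n hn ε h1 h2 g hg⟩
end
end
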